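/- With N(r, ℓ) as above, for ℓ ≥ 1 one has the recursive bound N(r, ℓ) ≤ 2r² + 2·N(r+1, ℓ−1). Consequently N(r, ℓ) is finite for all r and ℓ. -/

import Mathlib

/-- The closed unit disk. -/
abbrev ClosedDisk : Set ℂ := Metric.closedBall 0 1

/-- `ArcFamilyBound r l M` says: for any configuration of `r` marked points on the boundary of
the closed disk and `l` punctures in its interior, any family of pairwise disjoint (except
possibly at marked endpoints), pairwise non-homotopic (rel endpoints, in the punctured disk)
simple arcs with endpoints among the marked points has at most `M` members. -/
def ArcFamilyBound (r l M : ℕ) : Prop :=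
  ∀ (marked : Fin r → ℂ) (punct : Fin l → ℂ),
    (∀ i, marked i ∈ frontier ClosedDisk) → Function.Injective marked →
    (∀ j, punct j ∈ interior ClosedDisk) → Function.Injective punct →
    ∀ (m : ℕ) (γ : Fin m → C(unitInterval, ↥(ClosedDisk \ Set.range punct))),
      (∀ i, Function.Injective (γ i)) →
      (∀ i, ((γ i 0 : ℂ) ∈ Set.range marked ∧ (γ i 1 : ℂ) ∈ Set.range marked)) →
      (∀ i j, i ≠ j → ∀ s t : unitInterval,
        (γ i s : ℂ) = (γ j t : ℂ) → (γ i s : ℂ) ∈ Set.range marked) →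
      (∀ i j, i ≠ j → ¬ (γ i).HomotopicRel (γ j) {0, 1}) →
      m ≤ M

open Set Complex ComplexConjugate

section Log

/-- A nonvanishing continuous function on a simply connected space has a continuous logarithm. -/
theorem exists_continuous_log {A : Type*} [TopologicalSpace A] [SimplyConnectedSpace A]
    [LocallyPathConnectedSpace A] {f : A → ℂ} (hf : Continuous f) (h0 : ∀ a, f a ≠ 0)
    (a₀ : A) (l : ℂ) (hl : exp l = f a₀) :
    ∃ Λ : A → ℂ, Continuous Λ ∧ Λ a₀ = l ∧ ∀ a, exp (Λ a) = f a := by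
  obtain ⟨F, ⟨h1, h2⟩, -⟩ := Complex.isCoveringMapOn_exp.existsUnique_continuousMap_lifts
    ⟨f, hf⟩ (a₀ := a₀) (e₀ := l) hl (by simpa using h0)
  exact ⟨F, F.continuous, h1, fun a => congrFun h2 a⟩

theorem continuous_log_sub_eq {A : Type*} [TopologicalSpace A] [PreconnectedSpace A]
    {Λ M : A → ℂ} (hΛ : Continuous Λ) (hM : Continuous M) (h : ∀ a, exp (Λ a) = exp (M a))
    (a b : A) : Λ b - Λ a = M b - M a := by
  have := (Complex.isCoveringMap_exp).eq_of_comp_eq (g₁ := Λ)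
    (g₂ := fun x => M x + (Λ a - M a)) hΛ (by fun_prop) (by
      funext x
      refine Subtype.ext ?_
      simp [exp_add, exp_sub, h]) a (by simp)
  have := congrFun this b
  rw [this]; ring

/-- The increment over `[a, b]` of a continuous logarithm of `f`. -/
noncomputable def dlog (f : ℝ → ℂ) (a b : ℝ) : ℂ :=
  open Classical in
  if h : ∃ Λ : ℝ → ℂ, Continuous Λ ∧ ∀ t, exp (Λ t) = f t then h.choose b - h.choose a else 0

theorem dlog_eq {f Λ : ℝ → ℂ} (hΛ : Continuous Λ) (h : ∀ t, exp (Λ t) = f t) (a b : ℝ) :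
    dlog f a b = Λ b - Λ a := by
  have h' : ∃ Λ : ℝ → ℂ, Continuous Λ ∧ ∀ t, exp (Λ t) = f t := ⟨Λ, hΛ, h⟩
  rw [dlog, dif_pos h']
  exact continuous_log_sub_eq h'.choose_spec.1 hΛ (fun t => by rw [h'.choose_spec.2, h]) a b

theorem exists_log_real {f : ℝ → ℂ} (hf : Continuous f) (h0 : ∀ t, f t ≠ 0) :
    ∃ Λ : ℝ → ℂ, Continuous Λ ∧ ∀ t, exp (Λ t) = f t := by
  obtain ⟨Λ, h1, -, h2⟩ := exists_continuous_log hf h0 0 (log (f 0)) (exp_log (h0 0))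
  exact ⟨Λ, h1, h2⟩

theorem exp_dlog {f : ℝ → ℂ} (hf : Continuous f) (h0 : ∀ t, f t ≠ 0) (a b : ℝ) :
    exp (dlog f a b) = f b / f a := by
  obtain ⟨Λ, h1, h2⟩ := exists_log_real hf h0
  rw [dlog_eq h1 h2, exp_sub, h2, h2]

theorem dlog_mul {f g : ℝ → ℂ} (hf : Continuous f) (h0 : ∀ t, f t ≠ 0) (hg : Continuous g)
    (hg0 : ∀ t, g t ≠ 0) (a b : ℝ) :
    dlog (fun t => f t * g t) a b = dlog f a b + dlog g a b := by
  obtain ⟨Λ, h1, h2⟩ := exists_log_real hf h0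
  obtain ⟨M, h3, h4⟩ := exists_log_real hg hg0
  rw [dlog_eq h1 h2, dlog_eq h3 h4, dlog_eq (Λ := fun t => Λ t + M t) (by fun_prop)
    (fun t => by rw [exp_add, h2, h4])]
  ring

theorem dlog_const (c : ℂ) (a b : ℝ) : dlog (fun _ => c) a b = 0 := by
  by_cases hc : c = 0
  · rw [dlog, dif_neg]
    rintro ⟨Λ, -, h⟩
    exact exp_ne_zero _ ((h 0).trans hc)
  · rw [dlog_eq (Λ := fun _ => log c) continuous_const (fun _ => exp_log hc), sub_self]

theorem dlog_reverse {f : ℝ → ℂ} (hf : Continuous f) (h0 : ∀ t, f t ≠ 0) :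
    dlog (fun t => f (1 - t)) 0 1 = - dlog f 0 1 := by
  obtain ⟨Λ, h1, h2⟩ := exists_log_real hf h0
  rw [dlog_eq h1 h2, dlog_eq (Λ := fun t => Λ (1 - t)) (by fun_prop) (fun t => h2 _)]
  simp

end Log

section Crossing

/-- The branch of the logarithm which is continuous on the closed upper half-plane minus `0`. -/
noncomputable def upperLog (w : ℂ) : ℂ := log (-I * w) + Real.pi / 2 * I

theorem exp_upperLog {w : ℂ} (hw : w ≠ 0) : exp (upperLog w) = w := by
  rw [upperLog, exp_add, exp_log (by simp [hw]), exp_pi_div_two_mul_I]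
  linear_combination -w * I_mul_I

theorem continuousAt_upperLog {w : ℂ} (hw : w ≠ 0) (him : 0 ≤ w.im) :
    ContinuousAt upperLog w := by
  unfold upperLog
  refine ContinuousAt.add (ContinuousAt.clog (by fun_prop) ?_) continuousAt_const
  rcases him.lt_or_eq with h | h
  · left; simpa using h
  · right
    simp only [neg_mul, neg_im, mul_im, I_re, zero_mul, I_im, one_mul, zero_add]
    intro h'
    exact hw (Complex.ext (by simpa using h') h.symm)

theorem upperLog_im_of_pos {w : ℂ} (h : w.im = 0) (hr : 0 < w.re) : (upperLog w).im = 0 := by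
  obtain ⟨r, rfl⟩ : ∃ r : ℝ, w = r := ⟨w.re, Complex.ext rfl h⟩
  have hr : 0 < r := hr
  have : (-I * (r : ℂ)) = (r : ℂ) * (-I) := by ring
  rw [upperLog, this, add_im, log_im, arg_real_mul _ hr, arg_neg_I]
  simp

theorem upperLog_im_of_neg {w : ℂ} (h : w.im = 0) (hr : w.re < 0) :
    (upperLog w).im = Real.pi := by
  obtain ⟨r, rfl⟩ : ∃ r : ℝ, w = r := ⟨w.re, Complex.ext rfl h⟩
  have hr : 0 < -r := by simpa using hr
  have : (-I * (r : ℂ)) = ((-r : ℝ) : ℂ) * I := by push_cast; ring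
  rw [upperLog, this, add_im, log_im, arg_real_mul _ hr, arg_I]
  simp

theorem dlog_eq_upperLog {f : ℝ → ℂ} (hf : Continuous f) (h0 : ∀ t, f t ≠ 0)
    (him : ∀ t, 0 ≤ (f t).im) (a b : ℝ) : dlog f a b = upperLog (f b) - upperLog (f a) :=
  dlog_eq (Λ := fun t => upperLog (f t))
    (continuous_iff_continuousAt.2 fun t =>
      (continuousAt_upperLog (h0 t) (him t)).comp hf.continuousAt)
    (fun t => exp_upperLog (h0 t)) a b

theorem dlog_eq_upperLog_neg {f : ℝ → ℂ} (hf : Continuous f) (h0 : ∀ t, f t ≠ 0)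
    (him : ∀ t, (f t).im ≤ 0) (a b : ℝ) :
    dlog f a b = upperLog (-f b) - upperLog (-f a) := by
  rw [← dlog_eq_upperLog (f := fun t => -f t) hf.neg (by simpa using h0) (by simpa using him)]
  have := dlog_mul (f := f) (g := fun _ => -1) hf h0 continuous_const (by simp) a b
  rw [dlog_const, add_zero] at this
  simpa using this.symm

theorem not_disjoint_of_interlaced {μ ν : ℝ → ℂ} (hμ : Continuous μ) (hν : Continuous ν)
    (hμ0 : ∀ t, 0 ≤ (μ t).im) (hν0 : ∀ t, 0 ≤ (ν t).im) {x₁ x₂ x₃ x₄ : ℝ}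
    (h₁ : μ 0 = x₁) (h₂ : ν 0 = x₂) (h₃ : μ 1 = x₃) (h₄ : ν 1 = x₄)
    (h12 : x₁ < x₂) (h23 : x₂ < x₃) (h34 : x₃ < x₄) (hd : ∀ s t, μ s ≠ ν t) : False := by
  obtain ⟨Λ, hΛ, -, hE⟩ := exists_continuous_log (A := ℝ × ℝ) (f := fun p => μ p.1 - ν p.2)
    (by fun_prop) (fun p => sub_ne_zero.2 (hd _ _)) (0, 0) _ (exp_log (sub_ne_zero.2 (hd 0 0)))
  have e1 : Λ (1, 0) - Λ (0, 0) = dlog (fun t => μ t - ν 0) 0 1 :=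
    (dlog_eq (Λ := fun t => Λ (t, 0)) (by fun_prop) (fun t => hE _) 0 1).symm
  have e2 : Λ (1, 1) - Λ (0, 1) = dlog (fun t => μ t - ν 1) 0 1 :=
    (dlog_eq (Λ := fun t => Λ (t, 1)) (by fun_prop) (fun t => hE _) 0 1).symm
  have e3 : Λ (0, 1) - Λ (0, 0) = dlog (fun t => μ 0 - ν t) 0 1 :=
    (dlog_eq (Λ := fun t => Λ (0, t)) (by fun_prop) (fun t => hE _) 0 1).symm
  have e4 : Λ (1, 1) - Λ (1, 0) = dlog (fun t => μ 1 - ν t) 0 1 :=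
    (dlog_eq (Λ := fun t => Λ (1, t)) (by fun_prop) (fun t => hE _) 0 1).symm
  rw [dlog_eq_upperLog (by fun_prop) (fun t => sub_ne_zero.2 (hd _ _))
    (fun t => by simp [h₂, hμ0])] at e1
  rw [dlog_eq_upperLog (by fun_prop) (fun t => sub_ne_zero.2 (hd _ _))
    (fun t => by simp [h₄, hμ0])] at e2
  rw [dlog_eq_upperLog_neg (by fun_prop) (fun t => sub_ne_zero.2 (hd _ _))
    (fun t => by simp [h₁, hν0])] at e3
  rw [dlog_eq_upperLog_neg (by fun_prop) (fun t => sub_ne_zero.2 (hd _ _))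
    (fun t => by simp [h₃, hν0])] at e4
  have i1 := congrArg Complex.im e1
  have i2 := congrArg Complex.im e2
  have i3 := congrArg Complex.im e3
  have i4 := congrArg Complex.im e4
  rw [h₁, h₂, h₃, sub_im, sub_im, upperLog_im_of_pos (by simp) (by simpa),
    upperLog_im_of_neg (by simp) (by simpa)] at i1
  rw [h₁, h₄, h₃, sub_im, sub_im, upperLog_im_of_neg (by simp) (by simpa),
    upperLog_im_of_neg (by simp) (by simp; linarith)] at i2
  rw [h₁, h₄, h₂, sub_im, sub_im, upperLog_im_of_pos (by simp) (by simp; linarith),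
    upperLog_im_of_pos (by simp) (by simpa)] at i3
  rw [h₄, h₂, h₃, sub_im, sub_im, upperLog_im_of_pos (by simp) (by simp; linarith),
    upperLog_im_of_neg (by simp) (by simpa)] at i4
  have := Real.pi_pos
  linarith

/-- Two curves in the closed upper half-plane with interlaced endpoints on the real line meet. -/
theorem exists_eq_of_interlaced {μ ν : ℝ → ℂ} (hμ : Continuous μ) (hν : Continuous ν)
    (hμ0 : ∀ t, 0 ≤ (μ t).im) (hν0 : ∀ t, 0 ≤ (ν t).im) {x₁ x₂ x₃ x₄ : ℝ} {a b c d : ℝ}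
    (h₁ : μ a = x₁) (h₃ : μ b = x₃) (h₂ : ν c = x₂) (h₄ : ν d = x₄)
    (h12 : x₁ < x₂) (h23 : x₂ < x₃) (h34 : x₃ < x₄) :
    ∃ s ∈ uIcc a b, ∃ t ∈ uIcc c d, μ s = ν t := by
  by_contra! h
  have key : ∀ a b u : ℝ, a + (b - a) * (projIcc (0 : ℝ) 1 zero_le_one u : ℝ) ∈ uIcc a b := by
    intro a b u
    rw [← segment_eq_uIcc]
    refine ⟨1 - (projIcc (0 : ℝ) 1 zero_le_one u : ℝ), projIcc (0 : ℝ) 1 zero_le_one u,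
      sub_nonneg.2 (projIcc (0 : ℝ) 1 zero_le_one u).2.2, (projIcc (0 : ℝ) 1 zero_le_one u).2.1,
      by ring, by simp; ring⟩
  refine not_disjoint_of_interlaced
    (μ := fun u => μ (a + (b - a) * (projIcc (0 : ℝ) 1 zero_le_one u : ℝ)))
    (ν := fun u => ν (c + (d - c) * (projIcc (0 : ℝ) 1 zero_le_one u : ℝ)))
    (hμ.comp ?_) (hν.comp ?_) (fun _ => hμ0 _) (fun _ => hν0 _)
    (x₁ := x₁) (x₂ := x₂) (x₃ := x₃) (x₄ := x₄) ?_ ?_ ?_ ?_ h12 h23 h34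
    (fun s t => h _ (key _ _ _) _ (key _ _ _))
  · have := continuous_projIcc (a := (0 : ℝ)) (b := 1) (h := zero_le_one)
    fun_prop
  · have := continuous_projIcc (a := (0 : ℝ)) (b := 1) (h := zero_le_one)
    fun_prop
  · simpa using h₁
  · simpa using h₂
  · simpa using h₃
  · simpa using h₄

end Crossing

section HalfPlane

/-- The Blaschke factor of the upper half-plane at `q`. -/
noncomputable def halfKernel (z q : ℂ) : ℂ := (z - q) / (z - conj q)

/-- The branch in `[0, 2πi]` of the logarithm of `halfKernel y q / halfKernel x q`. -/
noncomputable def angleLog (x y : ℝ) (q : ℂ) : ℂ := 2 * (upperLog ((y - q) / (x - q))).im * I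

theorem im_div_nonneg {x y : ℝ} (hxy : x ≤ y) {q : ℂ} (hq : 0 ≤ q.im) :
    0 ≤ (((y : ℂ) - q) / (x - q)).im := by
  rw [div_im]
  simp only [sub_im, ofReal_im, zero_sub, sub_re, ofReal_re]
  rw [← sub_div]
  refine div_nonneg ?_ (normSq_nonneg _)
  nlinarith

theorem exp_angleLog {x y : ℝ} {q : ℂ} (hx : (x : ℂ) ≠ q) (hy : (y : ℂ) ≠ q) :
    exp (angleLog x y q) = halfKernel y q / halfKernel x q := by
  set w : ℂ := (y - q) / (x - q) with hw
  have hx' : (x : ℂ) - q ≠ 0 := sub_ne_zero.2 hx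
  have hy' : (y : ℂ) - q ≠ 0 := sub_ne_zero.2 hy
  have hw0 : w ≠ 0 := div_ne_zero hy' hx'
  have e1 : angleLog x y q = upperLog w - conj (upperLog w) := by
    rw [angleLog, ← hw, Complex.sub_conj]
    push_cast; ring
  have hx'' : (x : ℂ) - conj q ≠ 0 := by
    have := (map_ne_zero (starRingEnd ℂ)).2 hx'; simpa using this
  have hy'' : (y : ℂ) - conj q ≠ 0 := by
    have := (map_ne_zero (starRingEnd ℂ)).2 hy'; simpa using this
  rw [e1, exp_sub, exp_conj, exp_upperLog hw0, hw, halfKernel, halfKernel]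
  simp only [map_div₀, map_sub, conj_ofReal]
  field_simp

theorem angleLog_im {x y : ℝ} (hxy : x < y) {q : ℂ} (hq : 0 < q.im) :
    0 < (angleLog x y q).im ∧ (angleLog x y q).im < 2 * Real.pi := by
  set w : ℂ := (y - q) / (x - q) with hw
  have hx' : (x : ℂ) - q ≠ 0 := by
    intro h; have := congrArg Complex.im h; simp at this; linarith
  have h1 : 0 < w.im := by
    rw [hw, div_im]
    simp only [sub_im, ofReal_im, zero_sub, sub_re, ofReal_re]
    rw [← sub_div]
    refine div_pos ?_ (normSq_pos.2 hx')
    nlinarith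
  have h3 := abs_lt.1 (abs_arg_lt_pi_div_two_iff.2 (Or.inl (show 0 < (-I * w).re by
    simpa using h1)))
  have h2 : (upperLog w).im = arg (-I * w) + Real.pi / 2 := by
    rw [upperLog, add_im, log_im]
    simp
  have : (angleLog x y q).im = 2 * (arg (-I * w) + Real.pi / 2) := by
    rw [angleLog, ← hw, h2]
    simp
  rw [this]
  constructor <;> linarith

/-- `q` can be joined to a real point outside `[x, y]` in the complement of a curve from `x` to
`y`: the kernel at `q` has the expected increment. -/
theorem dlog_halfKernel_of_joinedIn {α : ℝ → ℂ} (hα : Continuous α) (him : ∀ t, 0 ≤ (α t).im)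
    {x y : ℝ} (hx : α 0 = x) (hy : α 1 = y) (hxy : x < y) {q : ℂ} {d : ℝ} (hd : d ∉ Icc x y)
    (hj : JoinedIn {z | 0 ≤ z.im ∧ ∀ t, α t ≠ z} q d) :
    dlog (fun t => halfKernel (α t) q) 0 1 = angleLog x y q := by
  obtain ⟨γ, hγ⟩ := hj
  set δ : ℝ → ℂ := ⇑γ.extend with hδ
  have hδc : Continuous δ := γ.extend.continuous
  have hδm : ∀ s, 0 ≤ (δ s).im ∧ ∀ t, α t ≠ δ s := fun s => hγ _
  have hδ0 : δ 0 = q := γ.extend_zero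
  have hδ1 : δ 1 = d := γ.extend_one
  have hn : ∀ t s, α t - conj (δ s) ≠ 0 := by
    intro t s h
    have h1 := congrArg Complex.im h
    simp only [sub_im, conj_im, sub_neg_eq_add, zero_im] at h1
    have h2 := congrArg Complex.re h
    simp only [sub_re, conj_re, zero_re] at h2
    refine (hδm s).2 t (Complex.ext (by linarith) ?_)
    linarith [him t, (hδm s).1]
  obtain ⟨Λ, hΛ, -, hE⟩ := exists_continuous_log (A := ℝ × ℝ)
    (f := fun p => halfKernel (α p.1) (δ p.2))
    (by
      unfold halfKernel
      exact Continuous.div (by fun_prop) (by fun_prop) (fun p => hn _ _))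
    (fun p => div_ne_zero (sub_ne_zero.2 ((hδm _).2 _)) (hn _ _)) (0, 0) _
    (exp_log (div_ne_zero (sub_ne_zero.2 ((hδm _).2 _)) (hn _ _)))
  have hwn : ∀ s, ((y : ℂ) - δ s) / (x - δ s) ≠ 0 := fun s =>
    div_ne_zero (by rw [← hy]; exact sub_ne_zero.2 ((hδm _).2 _))
      (by rw [← hx]; exact sub_ne_zero.2 ((hδm _).2 _))
  have hBc : Continuous fun s => angleLog x y (δ s) := by
    have h1 : Continuous fun s => ((y : ℂ) - δ s) / (x - δ s) :=
      Continuous.div (by fun_prop) (by fun_prop)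
        (fun s => by rw [← hx]; exact sub_ne_zero.2 ((hδm _).2 _))
    have h2 : Continuous fun s => upperLog (((y : ℂ) - δ s) / (x - δ s)) :=
      continuous_iff_continuousAt.2 fun s =>
        ContinuousAt.comp (f := fun s => ((y : ℂ) - δ s) / (x - δ s))
          (continuousAt_upperLog (hwn s) (im_div_nonneg hxy.le (hδm s).1)) h1.continuousAt
    unfold angleLog
    have := continuous_im.comp h2
    exact (continuous_const.mul (continuous_ofReal.comp this)).mul continuous_const
  have key := continuous_log_sub_eq (Λ := fun s => Λ (1, s) - Λ (0, s))
    (M := fun s => angleLog x y (δ s)) (by fun_prop) hBc (by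
      intro s
      rw [exp_sub, hE, hE, exp_angleLog, hx, hy]
      · rw [← hx]; exact (hδm _).2 _
      · rw [← hy]; exact (hδm _).2 _) 0 1
  have e1 : Λ (1, 1) - Λ (0, 1) = 0 := by
    rw [← dlog_eq (f := fun _ => 1) (Λ := fun t => Λ (t, 1)) (by fun_prop), dlog_const]
    intro t
    rw [hE]
    simp only [halfKernel, hδ1, conj_ofReal]
    apply div_self
    have := (hδm 1).2 t
    rw [hδ1] at this
    exact sub_ne_zero.2 this
  have e2 : angleLog x y (δ 1) = 0 := by
    rw [angleLog, hδ1, upperLog_im_of_pos]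
    · simp
    · rw [← ofReal_sub, ← ofReal_sub, ← ofReal_div, ofReal_im]
    · rw [← ofReal_sub, ← ofReal_sub, ← ofReal_div, ofReal_re]
      rw [mem_Icc, not_and_or, not_le, not_le] at hd
      rcases hd with hd | hd
      · exact div_pos (by linarith) (by linarith)
      · exact div_pos_of_neg_of_neg (by linarith) (by linarith)
  have e3 : dlog (fun t => halfKernel (α t) q) 0 1 = Λ (1, 0) - Λ (0, 0) :=
    dlog_eq (Λ := fun t => Λ (t, 0)) (by fun_prop) (fun t => by rw [hE, hδ0]) 0 1
  simp only [e1, e2, hδ0] at key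
  rw [e3]
  linear_combination -key

/-- The endpoints of a lift of a simple arc of the disk are less than `2π` apart. -/
theorem abs_sub_lt_of_lift {α : ℝ → ℂ} (hα : Continuous α) (him : ∀ t, 0 ≤ (α t).im)
    {x y c : ℝ} (hc : 0 < c) (hx : α 0 = x) (hy : α 1 = y)
    (hs : ∀ s ∈ Icc (0 : ℝ) 1, ∀ t ∈ Icc (0 : ℝ) 1, α s ≠ α t + c) : |y - x| < c := by
  have h0 : (0 : ℝ) ∈ Icc (0 : ℝ) 1 := by simp
  have h1 : (1 : ℝ) ∈ Icc (0 : ℝ) 1 := by simp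
  by_contra! h
  have e1 : y ≠ x + c := fun h => hs 1 h1 0 h0 (by rw [hx, hy, h]; push_cast; ring)
  have e2 : x ≠ y + c := fun h => hs 0 h0 1 h1 (by rw [hx, hy, h]; push_cast; ring)
  rcases le_abs.1 h with h | h
  · have h : x + c < y := lt_of_le_of_ne (by linarith) e1.symm
    obtain ⟨s, hs', t, ht, he⟩ := exists_eq_of_interlaced hα (ν := fun t => α t + c)
      (by fun_prop) him (by simpa using him) (a := 0) (b := 1) (c := 0) (d := 1)
      (x₁ := x) (x₂ := x + c) (x₃ := y) (x₄ := y + c) hx hy (by simp [hx]) (by simp [hy])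
      (by linarith) h (by linarith)
    rw [uIcc_of_le zero_le_one] at hs' ht
    exact hs s hs' t ht he
  · have h : y + c < x := lt_of_le_of_ne (by linarith) e2.symm
    obtain ⟨s, hs', t, ht, he⟩ := exists_eq_of_interlaced hα (ν := fun t => α t + c)
      (by fun_prop) him (by simpa using him) (a := 1) (b := 0) (c := 1) (d := 0)
      (x₁ := y) (x₂ := y + c) (x₃ := x) (x₄ := x + c) hy hx (by simp [hy]) (by simp [hx])
      (by linarith) h (by linarith)
    rw [uIcc_of_ge zero_le_one] at hs' ht
    exact hs s hs' t ht he

/-- A simple arc of the closed disk with endpoints on the circle turns less than once around the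
origin. -/
theorem dlog_of_injOn {f : ℝ → ℂ} (hf : Continuous f) (h0 : ∀ t, f t ≠ 0)
    (h1 : ∀ t, ‖f t‖ ≤ 1) (hi : InjOn f (Icc 0 1)) (ha : ‖f 0‖ = 1) (hb : ‖f 1‖ = 1) :
    (dlog f 0 1).re = 0 ∧ |(dlog f 0 1).im| < 2 * Real.pi := by
  obtain ⟨Λ, hΛ, hE⟩ := exists_log_real hf h0
  have hre : ∀ t, Real.exp (Λ t).re = ‖f t‖ := fun t => by rw [← hE, norm_exp]
  have r0 : (Λ 0).re = 0 := by rw [← Real.exp_eq_one_iff, hre, ha]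
  have r1 : (Λ 1).re = 0 := by rw [← Real.exp_eq_one_iff, hre, hb]
  rw [dlog_eq hΛ hE]
  refine ⟨by simp [r0, r1], ?_⟩
  have := abs_sub_lt_of_lift (α := fun t => -I * Λ t) (x := (Λ 0).im) (y := (Λ 1).im)
    (c := 2 * Real.pi) (by fun_prop) (fun t => by
      have : (Λ t).re ≤ 0 := by rw [← Real.exp_le_one_iff, hre]; exact h1 t
      simpa using this) (by positivity)
    (by apply Complex.ext <;> simp [r0]) (by apply Complex.ext <;> simp [r1]) (by
      intro s hs t ht h
      have h2 : Λ s = Λ t + 2 * Real.pi * I := by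
        push_cast at h
        linear_combination I * h + (Λ s - Λ t) * I_mul_I
      have h3 : f s = f t := by rw [← hE, ← hE, h2, exp_periodic]
      have h4 := hi hs ht h3
      rw [h4] at h2
      exact two_pi_I_ne_zero (by linear_combination -h2))
  simpa using this

end HalfPlane

section Pair

/-- A continuous simple curve in the closed upper half-plane from the real point `x` to the real
point `y`, parametrised by `[0, 1]` and extended constantly to the real line. -/
structure IsHalfArc (α : ℝ → ℂ) (x y : ℝ) : Prop where
  cont : Continuous α
  im_nonneg : ∀ t, 0 ≤ (α t).im
  injOn : InjOn α (Icc 0 1)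
  zero : α 0 = x
  one : α 1 = y
  clamp : ∀ t, ∃ s ∈ Icc (0 : ℝ) 1, α t = α s

theorem IsHalfArc.add {α : ℝ → ℂ} {x y : ℝ} (h : IsHalfArc α x y) (c : ℝ) :
    IsHalfArc (fun t => α t + c) (x + c) (y + c) where
  cont := by have := h.cont; fun_prop
  im_nonneg t := by simpa using h.im_nonneg t
  injOn s hs t ht he := h.injOn hs ht (by simpa using he)
  zero := by simp [h.zero]
  one := by simp [h.one]
  clamp t := by
    obtain ⟨s, hs, e⟩ := h.clamp t
    exact ⟨s, hs, by simp [e]⟩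

theorem IsHalfArc.reverse {α : ℝ → ℂ} {x y : ℝ} (h : IsHalfArc α x y) :
    IsHalfArc (fun t => α (1 - t)) y x where
  cont := by have := h.cont; fun_prop
  im_nonneg t := h.im_nonneg _
  injOn s hs t ht he := by
    have := h.injOn (by constructor <;> linarith [hs.1, hs.2])
      (by constructor <;> linarith [ht.1, ht.2]) he
    linarith
  zero := by simp [h.one]
  one := by simp [h.zero]
  clamp t := by
    obtain ⟨s, hs, e⟩ := h.clamp (1 - t)
    exact ⟨1 - s, by constructor <;> linarith [hs.1, hs.2], by simp [e]⟩

/-- The smallest real point on a half-plane arc. -/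
theorem IsHalfArc.exists_min {α : ℝ → ℂ} {x y : ℝ} (h : IsHalfArc α x y) :
    ∃ w : ℝ, ∃ t ∈ Icc (0 : ℝ) 1, α t = w ∧
      ∀ s ∈ Icc (0 : ℝ) 1, (α s).im = 0 → w ≤ (α s).re := by
  have hc := h.cont
  obtain ⟨t, ht, hmin⟩ := (isCompact_Icc.inter_right
    (isClosed_eq (f := fun t => (α t).im) (g := fun _ => 0) (by fun_prop)
      (by fun_prop))).exists_isMinOn (s := Icc (0 : ℝ) 1 ∩ {t | (α t).im = 0})
    (f := fun t => (α t).re) ⟨0, by simp [h.zero]⟩ (by fun_prop)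
  exact ⟨(α t).re, t, ht.1, Complex.ext rfl ht.2, fun s hs h0 => hmin ⟨hs, h0⟩⟩

theorem IsHalfArc.exists_max {α : ℝ → ℂ} {x y : ℝ} (h : IsHalfArc α x y) :
    ∃ w : ℝ, ∃ t ∈ Icc (0 : ℝ) 1, α t = w ∧
      ∀ s ∈ Icc (0 : ℝ) 1, (α s).im = 0 → (α s).re ≤ w := by
  have hc := h.cont
  obtain ⟨t, ht, hmin⟩ := (isCompact_Icc.inter_right
    (isClosed_eq (f := fun t => (α t).im) (g := fun _ => 0) (by fun_prop)
      (by fun_prop))).exists_isMaxOn (s := Icc (0 : ℝ) 1 ∩ {t | (α t).im = 0})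
    (f := fun t => (α t).re) ⟨0, by simp [h.zero]⟩ (by fun_prop)
  exact ⟨(α t).re, t, ht.1, Complex.ext rfl ht.2, fun s hs h0 => hmin ⟨hs, h0⟩⟩

theorem IsHalfArc.cross {α β : ℝ → ℂ} {x y x' y' : ℝ} (hα : IsHalfArc α x y)
    (hβ : IsHalfArc β x' y') {x₁ x₂ x₃ x₄ : ℝ} {a b c d : ℝ}
    (ha : a ∈ Icc (0 : ℝ) 1) (hb : b ∈ Icc (0 : ℝ) 1) (hc : c ∈ Icc (0 : ℝ) 1)
    (hd : d ∈ Icc (0 : ℝ) 1) (h₁ : α a = x₁) (h₃ : α b = x₃) (h₂ : β c = x₂) (h₄ : β d = x₄)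
    (h12 : x₁ < x₂) (h23 : x₂ < x₃) (h34 : x₃ < x₄) :
    ∃ s ∈ uIcc a b, ∃ t ∈ uIcc c d, s ∈ Icc (0 : ℝ) 1 ∧ t ∈ Icc (0 : ℝ) 1 ∧ α s = β t := by
  obtain ⟨s, hs, t, ht, e⟩ := exists_eq_of_interlaced hα.cont hβ.cont hα.im_nonneg hβ.im_nonneg
    h₁ h₃ h₂ h₄ h12 h23 h34
  exact ⟨s, hs, t, ht, ordConnected_Icc.uIcc_subset ha hb hs,
    ordConnected_Icc.uIcc_subset hc hd ht, e⟩

/-- The common points of a half-plane arc and a translate to the left of another one. -/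
theorem IsHalfArc.eq_of_meet {α β : ℝ → ℂ} {x y c : ℝ} (hα : IsHalfArc α x y)
    (hβ : IsHalfArc β (x + c) (y + c)) (hxy : x < y) (hc : y + c < x)
    (hαc : ∀ s ∈ Icc (0 : ℝ) 1, ∀ t ∈ Icc (0 : ℝ) 1, α s ≠ α t + c)
    (hβc : ∀ s ∈ Icc (0 : ℝ) 1, ∀ t ∈ Icc (0 : ℝ) 1, β s ≠ β t + c)
    (hr : ∀ s ∈ Icc (0 : ℝ) 1, ∀ t ∈ Icc (0 : ℝ) 1, α s = β t → (α s).im = 0) :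
    ∃ w : ℝ, ∀ s ∈ Icc (0 : ℝ) 1, ∀ t ∈ Icc (0 : ℝ) 1, α s = β t → α s = w := by
  have h0 : (0 : ℝ) ∈ Icc (0 : ℝ) 1 := by simp
  have h1 : (1 : ℝ) ∈ Icc (0 : ℝ) 1 := by simp
  obtain ⟨w, tw, htw, hw, hmin⟩ := hα.exists_min
  obtain ⟨u, tu, htu, hu, hmax⟩ := hβ.exists_max
  have hwx : w ≤ x := by simpa [hα.zero] using hmin 0 h0 (by simp [hα.zero])
  have huy : y + c ≤ u := by
    simpa [hβ.one] using hmax 1 h1 (by rw [hβ.one, ofReal_im])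
  have hαz := hα.zero
  have hαo := hα.one
  have hβz := hβ.zero
  have hβo := hβ.one
  have w1 : y + c < w := by
    by_contra! h
    have e1 : w ≠ y + c := fun e => hαc tw htw 1 h1 (by rw [hw, hαo, e]; push_cast; ring)
    have e2 : w ≠ x + c := fun e => hαc tw htw 0 h0 (by rw [hw, hαz, e]; push_cast; ring)
    have h := lt_of_le_of_ne h e1
    rcases lt_or_gt_of_ne e2 with h' | h'
    · obtain ⟨s, -, t, -, hs, ht, e⟩ := (hα.add c).cross hα htw h0 htw h0 (x₁ := w + c)
        (x₃ := x + c) (by simp [hw]) (by simp [hαz]) hw hαz (by linarith) h' (by linarith)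
      exact hαc t ht s hs e.symm
    · obtain ⟨s, -, t, -, hs, ht, e⟩ := (hα.add c).cross hα h0 h1 htw h0 (x₁ := x + c)
        (x₃ := y + c) (by simp [hαz]) (by simp [hαo]) hw hαz h' h (by linarith)
      exact hαc t ht s hs e.symm
  have u1 : u < x := by
    by_contra! h
    have e1 : u ≠ x := fun e => hβc 0 h0 tu htu (by rw [hu, hβz, e]; push_cast; ring)
    have e2 : u ≠ y := fun e => hβc 1 h1 tu htu (by rw [hu, hβo, e]; push_cast; ring)
    have h := lt_of_le_of_ne h e1.symm
    rcases lt_or_gt_of_ne e2 with h' | h'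
    · obtain ⟨s, -, t, -, hs, ht, e⟩ := hβ.cross (hβ.add (-c)) h1 htu h0 h1 (x₁ := y + c)
        (x₂ := x) (x₄ := y) hβo hu (by simp [hβz]) (by simp [hβo]) (by linarith) h h'
      exact hβc t ht s hs (by rw [e]; push_cast; ring)
    · obtain ⟨s, -, t, -, hs, ht, e⟩ := hβ.cross (hβ.add (-c)) h1 htu h1 htu (x₁ := y + c)
        (x₂ := y) (x₄ := u + -c) hβo hu (by simp [hβo]) (by simp [hu]) (by linarith) h'
        (by linarith)
      exact hβc t ht s hs (by rw [e]; push_cast; ring)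
  have hle : ∀ s ∈ Icc (0 : ℝ) 1, ∀ t ∈ Icc (0 : ℝ) 1, α s = β t →
      ∃ z : ℝ, α s = z ∧ w ≤ z ∧ z ≤ u := by
    intro s hs t ht e
    have h := hr s hs t ht e
    exact ⟨(α s).re, Complex.ext rfl h, hmin s hs h, by rw [e]; exact hmax t ht (by rw [← e, h])⟩
  have uw : u ≤ w := by
    by_contra! h
    obtain ⟨s, hs', t, ht', hs, ht, e⟩ := hβ.cross hα h0 htu htw h1 (x₁ := x + c) (x₂ := w)
      (x₃ := u) (x₄ := y) hβz hu hw hαo (by linarith) h (by linarith)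
    rw [uIcc_of_le htu.1] at hs'
    rw [uIcc_of_le htw.2] at ht'
    obtain ⟨z, hz, hwz, hzu⟩ := hle t ht s hs e.symm
    have z1 : z = w := by
      by_contra hne
      have hlt : w < z := lt_of_le_of_ne hwz (Ne.symm hne)
      obtain ⟨a, ha', b, hb', ha, hb, e'⟩ := hα.cross hα htw h0 ht h1 hw hαz hz hαo hlt
        (by linarith) hxy
      rw [uIcc_of_ge htw.1] at ha'
      rw [uIcc_of_le ht.2] at hb'
      have := hα.injOn ha hb e'
      have e3 : tw = t := le_antisymm ht'.1 (by linarith [ha'.2, hb'.1])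
      rw [e3, hz] at hw
      exact hne (by exact_mod_cast hw)
    have z2 : z = u := by
      by_contra hne
      have hlt : z < u := lt_of_le_of_ne hzu hne
      have hz' : β s = z := by rw [e, hz]
      obtain ⟨a, ha', b, hb', ha, hb, e'⟩ := hβ.cross hβ h0 hs h1 htu hβz hz' hβo hu
        (by linarith) (by linarith) hlt
      rw [uIcc_of_le hs.1] at ha'
      rw [uIcc_of_ge htu.2] at hb'
      have := hβ.injOn ha hb e'
      have e3 : s = tu := le_antisymm hs'.2 (by linarith [ha'.2, hb'.1])
      rw [e3, hu] at hz'
      exact hne (by exact_mod_cast hz'.symm)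
    linarith
  refine ⟨w, fun s hs t ht e => ?_⟩
  obtain ⟨z, hz, hwz, hzu⟩ := hle s hs t ht e
  rw [hz, le_antisymm (by linarith) hwz]

theorem joinedIn_of_uIcc {f : ℝ → ℂ} (hf : Continuous f) {S : Set ℂ} {a b : ℝ}
    (h : ∀ s ∈ uIcc a b, f s ∈ S) : JoinedIn S (f a) (f b) := by
  have h1 : IsPathConnected (uIcc a b) :=
    (convex_uIcc a b).isPathConnected nonempty_uIcc
  refine ((h1.image hf).joinedIn _ ⟨a, left_mem_uIcc, rfl⟩ _ ⟨b, right_mem_uIcc, rfl⟩).mono ?_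
  rintro _ ⟨s, hs, rfl⟩
  exact h s hs

/-- From a point of `α` which is not a common point, follow `α` to one of its ends. -/
theorem IsHalfArc.joinedIn_end {α β : ℝ → ℂ} {x y x' y' w : ℝ} (hα : IsHalfArc α x y)
    (hβ : IsHalfArc β x' y')
    (hw : ∀ s ∈ Icc (0 : ℝ) 1, ∀ t ∈ Icc (0 : ℝ) 1, α s = β t → α s = w)
    {t : ℝ} (ht : t ∈ Icc (0 : ℝ) 1) (hne : ∀ s, β s ≠ α t) :
    JoinedIn {z | 0 ≤ z.im ∧ ∀ s, β s ≠ z} (α t) x ∨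
      JoinedIn {z | 0 ≤ z.im ∧ ∀ s, β s ≠ z} (α t) y := by
  have h0 : (0 : ℝ) ∈ Icc (0 : ℝ) 1 := by simp
  have h1 : (1 : ℝ) ∈ Icc (0 : ℝ) 1 := by simp
  have hc := hα.cont
  have key : ∀ e ∈ Icc (0 : ℝ) 1, (∀ s ∈ uIcc t e, ∀ r, β r ≠ α s) →
      JoinedIn {z | 0 ≤ z.im ∧ ∀ s, β s ≠ z} (α t) (α e) := by
    intro e he h
    exact joinedIn_of_uIcc hc fun s hs => ⟨hα.im_nonneg s, h s hs⟩
  by_cases h : ∃ r, r ∈ Icc 0 t ∧ ∃ s, β s = α r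
  · right
    rw [← hα.one]
    refine key 1 h1 fun s hs r hr => ?_
    rw [uIcc_of_le ht.2] at hs
    obtain ⟨r', hr', s', hs'⟩ := h
    obtain ⟨a, ha, ea⟩ := hβ.clamp r
    obtain ⟨b, hb, eb⟩ := hβ.clamp s'
    have i1 := hw s ⟨ht.1.trans hs.1, hs.2⟩ a ha (by rw [← hr, ea])
    have i2 := hw r' ⟨hr'.1, hr'.2.trans ht.2⟩ b hb (by rw [← hs', eb])
    have := hα.injOn ⟨ht.1.trans hs.1, hs.2⟩ ⟨hr'.1, hr'.2.trans ht.2⟩ (i1.trans i2.symm)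
    have : s = t := le_antisymm (by linarith [hr'.2]) hs.1
    rw [this] at hr
    exact hne r hr
  · left
    rw [← hα.zero]
    push Not at h
    refine key 0 h0 fun s hs r hr => ?_
    rw [uIcc_of_ge ht.1] at hs
    exact h s hs r hr

/-- For two simple arcs with disjoint shadows, the increment of the kernel at a given point is
the expected one for at least one of the arcs. -/
theorem IsHalfArc.dlog_or {α β : ℝ → ℂ} {x y c : ℝ} (hα : IsHalfArc α x y)
    (hβ : IsHalfArc β (x + c) (y + c)) (hxy : x < y) (hc : y + c < x)
    (hαc : ∀ s ∈ Icc (0 : ℝ) 1, ∀ t ∈ Icc (0 : ℝ) 1, α s ≠ α t + c)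
    (hβc : ∀ s ∈ Icc (0 : ℝ) 1, ∀ t ∈ Icc (0 : ℝ) 1, β s ≠ β t + c)
    (hr : ∀ s ∈ Icc (0 : ℝ) 1, ∀ t ∈ Icc (0 : ℝ) 1, α s = β t → (α s).im = 0)
    {q : ℂ} (hq : 0 < q.im) (hqα : ∀ t, α t ≠ q) (hqβ : ∀ t, β t ≠ q) :
    dlog (fun t => halfKernel (α t) q) 0 1 = angleLog x y q ∨
      dlog (fun t => halfKernel (β t) q) 0 1 = angleLog (x + c) (y + c) q := by
  have h0 : (0 : ℝ) ∈ Icc (0 : ℝ) 1 := by simp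
  have h1 : (1 : ℝ) ∈ Icc (0 : ℝ) 1 := by simp
  obtain ⟨w, hw⟩ := hα.eq_of_meet hβ hxy hc hαc hβc hr
  have hαcont := hα.cont
  have hβcont := hβ.cont
  set d : ℝ := w + 1 with hd
  set σ : ℝ → ℂ := fun τ => AffineMap.lineMap q (d : ℂ) τ with hσ
  have hσc : Continuous σ := AffineMap.lineMap_continuous
  have hσim : ∀ τ, (σ τ).im = (1 - τ) * q.im := by
    intro τ; simp [hσ, AffineMap.lineMap_apply]; ring
  have hσ0 : ∀ τ ∈ Icc (0 : ℝ) 1, 0 ≤ (σ τ).im := fun τ hτ => by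
    rw [hσim]; exact mul_nonneg (by linarith [hτ.2]) hq.le
  have hσw : ∀ τ ∈ Icc (0 : ℝ) 1, σ τ ≠ w := by
    intro τ hτ h
    have h2 := hσim τ
    rw [h, ofReal_im] at h2
    have : τ = 1 := by
      rcases mul_eq_zero.1 h2.symm with h3 | h3 <;> linarith
    rw [this] at h
    simp only [hσ, AffineMap.lineMap_apply_one] at h
    have : d = w := by exact_mod_cast h
    linarith
  have closedim : ∀ {γ : ℝ → ℂ}, Continuous γ → IsClosed (γ '' Icc 0 1) := fun hγ =>
    (isCompact_Icc.image hγ).isClosed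
  -- the first parameter at which the segment meets one of the arcs
  by_cases hhit : ∃ τ ∈ Icc (0 : ℝ) 1, σ τ ∈ α '' Icc 0 1 ∪ β '' Icc 0 1
  · obtain ⟨τ, ⟨hτ, hτm⟩, hmin⟩ := (isCompact_Icc.inter_right
      (((closedim hαcont).union (closedim hβcont)).preimage hσc)).exists_isLeast
      (s := Icc (0 : ℝ) 1 ∩ σ ⁻¹' (α '' Icc 0 1 ∪ β '' Icc 0 1)) (by
        obtain ⟨τ, h1, h2⟩ := hhit; exact ⟨τ, h1, h2⟩)
    have hseg : ∀ (γ : ℝ → ℂ), (∀ t, ∃ s ∈ Icc (0 : ℝ) 1, γ t = γ s) →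
        (γ = α ∨ γ = β) → (∀ s, γ s ≠ σ τ) →
        JoinedIn {z | 0 ≤ z.im ∧ ∀ s, γ s ≠ z} q (σ τ) := by
      intro γ hγ hγ' hne
      have h3 : σ 0 = q := by simp [hσ]
      rw [← h3]
      refine joinedIn_of_uIcc hσc fun s hs => ?_
      rw [uIcc_of_le hτ.1] at hs
      refine ⟨hσ0 s ⟨hs.1, hs.2.trans hτ.2⟩, fun r hr' => ?_⟩
      obtain ⟨r', hr1, hr2⟩ := hγ r
      have h4 : τ ≤ s := hmin ⟨⟨hs.1, hs.2.trans hτ.2⟩, by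
        rcases hγ' with rfl | rfl
        · left; exact ⟨r', hr1, by rw [← hr2, hr']⟩
        · right; exact ⟨r', hr1, by rw [← hr2, hr']⟩⟩
      have : s = τ := le_antisymm hs.2 h4
      rw [this] at hr'
      exact hne r hr'
    rcases hτm with ⟨t, ht, e⟩ | ⟨t, ht, e⟩
    · right
      have hne : ∀ s, β s ≠ α t := by
        intro s hs
        obtain ⟨a, ha, ea⟩ := hβ.clamp s
        exact hσw τ hτ (by rw [← e]; exact hw t ht a ha (by rw [← hs, ea]))
      have hj := hseg β hβ.clamp (Or.inr rfl) (by rwa [← e])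
      rw [← e] at hj
      rcases hα.joinedIn_end hβ hw ht hne with h | h
      · exact dlog_halfKernel_of_joinedIn hβcont hβ.im_nonneg hβ.zero hβ.one (by linarith)
          (d := x) (fun h => by linarith [h.2]) (hj.trans h)
      · exact dlog_halfKernel_of_joinedIn hβcont hβ.im_nonneg hβ.zero hβ.one (by linarith)
          (d := y) (fun h => by linarith [h.2]) (hj.trans h)
    · left
      have hne : ∀ s, α s ≠ β t := by
        intro s hs
        obtain ⟨a, ha, ea⟩ := hα.clamp s
        exact hσw τ hτ (by rw [← e, ← hs, ea]; exact hw a ha t ht (by rw [← hs, ea]))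
      have hj := hseg α hα.clamp (Or.inl rfl) (by rwa [← e])
      rw [← e] at hj
      rcases hβ.joinedIn_end hα (w := w)
        (fun s hs t ht e => by rw [e]; exact hw t ht s hs e.symm) ht hne with h | h
      · exact dlog_halfKernel_of_joinedIn hαcont hα.im_nonneg hα.zero hα.one hxy
          (fun h => by linarith [h.1]) (hj.trans h)
      · exact dlog_halfKernel_of_joinedIn hαcont hα.im_nonneg hα.zero hα.one hxy
          (fun h => by linarith [h.1]) (hj.trans h)
  · push Not at hhit
    have hseg : ∀ (γ : ℝ → ℂ), (∀ t, ∃ s ∈ Icc (0 : ℝ) 1, γ t = γ s) →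
        (γ = α ∨ γ = β) → JoinedIn {z | 0 ≤ z.im ∧ ∀ s, γ s ≠ z} q d := by
      intro γ hγ hγ'
      have h3 : σ 0 = q := by simp [hσ]
      have h4 : σ 1 = d := by simp [hσ]
      rw [← h3, ← h4]
      refine joinedIn_of_uIcc hσc fun s hs => ?_
      rw [uIcc_of_le zero_le_one] at hs
      refine ⟨hσ0 s hs, fun r hr' => hhit s hs ?_⟩
      obtain ⟨r', hr1, hr2⟩ := hγ r
      rcases hγ' with rfl | rfl
      · left; exact ⟨r', hr1, by rw [← hr2, hr']⟩
      · right; exact ⟨r', hr1, by rw [← hr2, hr']⟩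
    by_cases hdx : d ∈ Icc x y
    · right
      exact dlog_halfKernel_of_joinedIn hβcont hβ.im_nonneg hβ.zero hβ.one (by linarith)
        (fun h => by linarith [h.2, hdx.1]) (hseg β hβ.clamp (Or.inr rfl))
    · left
      exact dlog_halfKernel_of_joinedIn hαcont hα.im_nonneg hα.zero hα.one hxy hdx
        (hseg α hα.clamp (Or.inl rfl))

end Pair

section Opposite

theorem halfKernel_add (z q : ℂ) (c : ℝ) : halfKernel (z + c) (q + c) = halfKernel z q := by
  simp [halfKernel]

theorem angleLog_add (x y : ℝ) (q : ℂ) (c : ℝ) :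
    angleLog (x + c) (y + c) (q + c) = angleLog x y q := by
  simp [angleLog]

theorem halfKernel_ne_zero {z q : ℂ} (hz : 0 ≤ z.im) (hq : 0 < q.im) (h : z ≠ q) :
    halfKernel z q ≠ 0 := by
  refine div_ne_zero (sub_ne_zero.2 h) fun h => ?_
  have := congrArg Complex.im h
  simp at this
  linarith

theorem sub_conj_ne_zero {z q : ℂ} (hz : 0 ≤ z.im) (hq : 0 < q.im) : z - conj q ≠ 0 := fun h => by
  have := congrArg Complex.im h
  simp at this
  linarith

theorem norm_halfKernel_le {z q : ℂ} (hz : 0 ≤ z.im) (hq : 0 < q.im) : ‖halfKernel z q‖ ≤ 1 := by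
  rw [halfKernel, norm_div]
  refine div_le_one_of_le₀ ?_ (norm_nonneg _)
  rw [← sq_le_sq₀ (norm_nonneg _) (norm_nonneg _), Complex.sq_norm, Complex.sq_norm,
    normSq_apply, normSq_apply]
  simp
  nlinarith

theorem norm_halfKernel_real {x : ℝ} {q : ℂ} (hq : 0 < q.im) : ‖halfKernel x q‖ = 1 := by
  have h := sub_conj_ne_zero (z := x) (by simp) hq
  rw [halfKernel, norm_div, div_eq_one_iff_eq (norm_ne_zero_iff.2 h)]
  rw [← norm_conj]
  simp

theorem halfKernel_injective {z z' q : ℂ} (hz : 0 ≤ z.im) (hz' : 0 ≤ z'.im) (hq : 0 < q.im)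
    (h : halfKernel z q = halfKernel z' q) : z = z' := by
  rw [halfKernel, halfKernel, div_eq_div_iff (sub_conj_ne_zero hz hq)
    (sub_conj_ne_zero hz' hq)] at h
  have h1 : (z - z') * (q - conj q) = 0 := by linear_combination h
  rcases mul_eq_zero.1 h1 with h2 | h2
  · exact sub_eq_zero.1 h2
  · have := congrArg Complex.im h2
    simp at this
    linarith

theorem continuous_halfKernel {α : ℝ → ℂ} (hα : Continuous α) (h0 : ∀ t, 0 ≤ (α t).im) {q : ℂ}
    (hq : 0 < q.im) : Continuous fun t => halfKernel (α t) q := by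
  unfold halfKernel
  exact Continuous.div (by fun_prop) (by fun_prop) fun t => sub_conj_ne_zero (h0 t) hq

theorem IsHalfArc.dlog_halfKernel {α : ℝ → ℂ} {x y : ℝ} (hα : IsHalfArc α x y) (hxy : x < y)
    {q : ℂ} (hq : 0 < q.im) (hqα : ∀ t, α t ≠ q) :
    dlog (fun t => halfKernel (α t) q) 0 1 = angleLog x y q ∨
      dlog (fun t => halfKernel (α t) q) 0 1 = angleLog x y q - 2 * Real.pi * I := by
  have hc := continuous_halfKernel hα.cont hα.im_nonneg hq
  have hn : ∀ t, halfKernel (α t) q ≠ 0 := fun t =>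
    halfKernel_ne_zero (hα.im_nonneg t) hq (hqα t)
  obtain ⟨h1, h2⟩ := dlog_of_injOn hc hn (fun t => norm_halfKernel_le (hα.im_nonneg t) hq)
    (fun s hs t ht h => hα.injOn hs ht
      (halfKernel_injective (hα.im_nonneg s) (hα.im_nonneg t) hq h))
    (by rw [hα.zero]; exact norm_halfKernel_real hq)
    (by rw [hα.one]; exact norm_halfKernel_real hq)
  have h3 := exp_dlog hc hn 0 1
  rw [hα.zero, hα.one, ← exp_angleLog (by rw [← hα.zero]; exact hqα 0)
    (by rw [← hα.one]; exact hqα 1), exp_eq_exp_iff_exists_int] at h3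
  obtain ⟨n, hn⟩ := h3
  obtain ⟨h4, h5⟩ := angleLog_im hxy hq
  have h6 : (dlog (fun t => halfKernel (α t) q) 0 1).im = (angleLog x y q).im
      + n * (2 * Real.pi) := by rw [hn]; simp
  have h7 := abs_lt.1 h2
  have hpi := Real.pi_pos
  have n1 : n < 1 := by
    have : (n : ℝ) < 1 := by nlinarith
    exact_mod_cast this
  have n2 : -2 < n := by
    have : (-2 : ℝ) < n := by nlinarith
    exact_mod_cast this
  have : n = 0 ∨ n = -1 := by omega
  rcases this with rfl | rfl
  · left; rw [hn]; simp
  · right; rw [hn]; push_cast; ring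

/-- The hypotheses on a lift to the half-plane of a pair of arcs of the disk. -/
structure IsHalfPair (α β : ℝ → ℂ) (x y : ℝ) : Prop where
  left : IsHalfArc α x y
  right : IsHalfArc β x y
  left_ne : ∀ s ∈ Icc (0 : ℝ) 1, ∀ t ∈ Icc (0 : ℝ) 1, ∀ k : ℤ, k ≠ 0 →
    α s ≠ α t + (2 * Real.pi * k : ℝ)
  right_ne : ∀ s ∈ Icc (0 : ℝ) 1, ∀ t ∈ Icc (0 : ℝ) 1, ∀ k : ℤ, k ≠ 0 →
    β s ≠ β t + (2 * Real.pi * k : ℝ)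
  meet : ∀ s ∈ Icc (0 : ℝ) 1, ∀ t ∈ Icc (0 : ℝ) 1, ∀ k : ℤ,
    α s = β t + (2 * Real.pi * k : ℝ) → (α s).im = 0

theorem IsHalfPair.symm {α β : ℝ → ℂ} {x y : ℝ} (h : IsHalfPair α β x y) :
    IsHalfPair β α x y where
  left := h.right
  right := h.left
  left_ne := h.right_ne
  right_ne := h.left_ne
  meet s hs t ht k e := by
    have := h.meet t ht s hs (-k) (by rw [e]; push_cast; ring)
    rw [e]; simpa using this

theorem IsHalfPair.reverse {α β : ℝ → ℂ} {x y : ℝ} (h : IsHalfPair α β x y) :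
    IsHalfPair (fun t => α (1 - t)) (fun t => β (1 - t)) y x where
  left := h.left.reverse
  right := h.right.reverse
  left_ne s hs t ht := h.left_ne _ (by constructor <;> linarith [hs.1, hs.2]) _
    (by constructor <;> linarith [ht.1, ht.2])
  right_ne s hs t ht := h.right_ne _ (by constructor <;> linarith [hs.1, hs.2]) _
    (by constructor <;> linarith [ht.1, ht.2])
  meet s hs t ht := h.meet _ (by constructor <;> linarith [hs.1, hs.2]) _
    (by constructor <;> linarith [ht.1, ht.2])

theorem IsHalfPair.dlog_or {α β : ℝ → ℂ} {x y : ℝ} (h : IsHalfPair α β x y) (hxy : x < y)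
    {q : ℂ} (hq : 0 < q.im) (hqα : ∀ t, ∀ k : ℤ, α t ≠ q + (2 * Real.pi * k : ℝ))
    (hqβ : ∀ t, ∀ k : ℤ, β t ≠ q + (2 * Real.pi * k : ℝ)) {k : ℤ} (hk : k ≠ 0) :
    dlog (fun t => halfKernel (α t) (q + (2 * Real.pi * k : ℝ))) 0 1 =
        angleLog x y (q + (2 * Real.pi * k : ℝ)) ∨
      dlog (fun t => halfKernel (β t) q) 0 1 = angleLog x y q := by
  have hpi := Real.pi_pos
  have hlt : y - x < 2 * Real.pi := by
    have := abs_sub_lt_of_lift h.left.cont h.left.im_nonneg (c := 2 * Real.pi) (by positivity)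
      h.left.zero h.left.one (fun s hs t ht => by simpa using h.left_ne s hs t ht 1 one_ne_zero)
    exact (abs_lt.1 this).2
  rcases lt_or_gt_of_ne hk with hk' | hk'
  · have hk1 : (k : ℝ) ≤ -1 := by exact_mod_cast Int.le_sub_one_of_lt hk'
    have := h.left.dlog_or (h.right.add (2 * Real.pi * k)) hxy (by nlinarith)
      (fun s hs t ht => h.left_ne s hs t ht k hk)
      (fun s hs t ht e => h.right_ne s hs t ht k hk (by simpa using e))
      (fun s hs t ht e => h.meet s hs t ht k e)
      (q := q + (2 * Real.pi * k : ℝ)) (by simpa using hq) (fun t => hqα t k)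
      (fun t e => hqβ t 0 (by simpa using e))
    simpa only [halfKernel_add, angleLog_add] using this
  · have hk1 : (1 : ℝ) ≤ k := by exact_mod_cast hk'
    have := h.right.dlog_or (h.left.add (-(2 * Real.pi * k))) hxy (by nlinarith)
      (fun s hs t ht e => h.right_ne s hs t ht (-k) (by omega) (by rw [e]; push_cast; ring))
      (fun s hs t ht e => h.left_ne s hs t ht (-k) (by omega) (by
        push_cast at e ⊢
        linear_combination e))
      (fun s hs t ht e => by
        have := h.meet t ht s hs k (by rw [e]; push_cast; ring)
        rw [e]; simpa using this)
      hq (fun t e => hqβ t 0 (by simpa using e))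
      (fun t e => hqα t k (by rw [← e]; push_cast; ring))
    have e1 : ∀ z, halfKernel (z + (-(2 * Real.pi * k) : ℝ)) q =
        halfKernel z (q + (2 * Real.pi * k : ℝ)) := fun z => by
      rw [← halfKernel_add _ _ (2 * Real.pi * k)]; congr 1; push_cast; ring
    have e2 : angleLog (x + -(2 * Real.pi * k)) (y + -(2 * Real.pi * k)) q =
        angleLog x y (q + (2 * Real.pi * k : ℝ)) := by
      rw [← angleLog_add _ _ _ (2 * Real.pi * k)]; congr 1 <;> ring
    rw [e2] at this
    simp only [e1] at this
    exact this.symm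

/-- The difference of the increments of the kernels of two arcs cannot take opposite nonzero
values at two points differing by a translation by a multiple of `2π`. -/
theorem IsHalfPair.dlog_sub_eq {α β : ℝ → ℂ} {x y : ℝ} (h : IsHalfPair α β x y) (hxy : x ≠ y)
    {q : ℂ} (hq : 0 < q.im) (hqα : ∀ t, ∀ k : ℤ, α t ≠ q + (2 * Real.pi * k : ℝ))
    (hqβ : ∀ t, ∀ k : ℤ, β t ≠ q + (2 * Real.pi * k : ℝ)) {k : ℤ} (hk : k ≠ 0)
    (h1 : dlog (fun t => halfKernel (α t) q) 0 1 ≠ dlog (fun t => halfKernel (β t) q) 0 1)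
    (h2 : dlog (fun t => halfKernel (α t) (q + (2 * Real.pi * k : ℝ))) 0 1 ≠
      dlog (fun t => halfKernel (β t) (q + (2 * Real.pi * k : ℝ))) 0 1) :
    dlog (fun t => halfKernel (α t) q) 0 1 - dlog (fun t => halfKernel (β t) q) 0 1 =
    dlog (fun t => halfKernel (α t) (q + (2 * Real.pi * k : ℝ))) 0 1 -
      dlog (fun t => halfKernel (β t) (q + (2 * Real.pi * k : ℝ))) 0 1 := by
  wlog hlt : x < y generalizing x y α β
  · have hq' : 0 < (q + (2 * Real.pi * k : ℝ)).im := by simpa using hq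
    have r : ∀ {γ : ℝ → ℂ}, (∀ t, ∀ k : ℤ, γ t ≠ q + (2 * Real.pi * k : ℝ)) → Continuous γ →
        (∀ t, 0 ≤ (γ t).im) → dlog (fun t => halfKernel (γ (1 - t)) q) 0 1 =
          - dlog (fun t => halfKernel (γ t) q) 0 1 ∧
        dlog (fun t => halfKernel (γ (1 - t)) (q + (2 * Real.pi * k : ℝ))) 0 1 =
          - dlog (fun t => halfKernel (γ t) (q + (2 * Real.pi * k : ℝ))) 0 1 := by
      intro γ hγ hc him
      exact ⟨dlog_reverse (continuous_halfKernel hc him hq)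
        (fun t => halfKernel_ne_zero (him t) hq (by simpa using hγ t 0)),
        dlog_reverse (continuous_halfKernel hc him hq')
        (fun t => halfKernel_ne_zero (him t) hq' (hγ t k))⟩
    obtain ⟨a1, a2⟩ := r hqα h.left.cont h.left.im_nonneg
    obtain ⟨b1, b2⟩ := r hqβ h.right.cont h.right.im_nonneg
    have := this h.reverse hxy.symm (fun t => hqα _) (fun t => hqβ _)
      (by rw [a1, b1]; simpa using h1) (by rw [a2, b2]; simpa using h2)
      (lt_of_le_of_ne (not_lt.1 hlt) hxy.symm)
    rw [a1, a2, b1, b2] at this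
    linear_combination -this
  have hq' : 0 < (q + (2 * Real.pi * k : ℝ)).im := by simpa using hq
  rcases h.dlog_or hlt hq hqα hqβ hk with a | a <;>
  rcases h.symm.dlog_or hlt hq hqβ hqα hk with b | b
  · exact absurd (a.trans b.symm) h2
  · rcases h.right.dlog_halfKernel hlt hq (by simpa using fun t => hqβ t 0) with c | c
    · exact absurd (b.trans c.symm) h1
    rcases h.right.dlog_halfKernel hlt hq' (fun t => hqβ t k) with d | d
    · exact absurd (a.trans d.symm) h2
    rw [a, b, c, d]; ring
  · rcases h.left.dlog_halfKernel hlt hq (by simpa using fun t => hqα t 0) with c | c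
    · exact absurd (c.trans a.symm) h1
    rcases h.left.dlog_halfKernel hlt hq' (fun t => hqα t k) with d | d
    · exact absurd (d.trans b.symm) h2
    rw [a, b, c, d]; ring
  · exact absurd (b.trans a.symm) h1

end Opposite

section Kernel

/-- The Blaschke factor of the unit disk at `q`. -/
noncomputable def diskKernel (q z : ℂ) : ℂ := (z - q) / (1 - conj q * z)

theorem one_sub_conj_mul_ne_zero {q z : ℂ} (hq : ‖q‖ < 1) (hz : ‖z‖ ≤ 1) :
    1 - conj q * z ≠ 0 := by
  intro h
  have h1 : conj q * z = 1 := (sub_eq_zero.1 h).symm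
  have h2 : ‖q‖ * ‖z‖ = 1 := by rw [← norm_conj q, ← norm_mul, h1, norm_one]
  nlinarith [norm_nonneg q, norm_nonneg z]

theorem normSq_diskKernel_identity (q z : ℂ) :
    normSq (1 - conj q * z) - normSq (z - q) = (1 - normSq z) * (1 - normSq q) := by
  simp only [normSq_apply, sub_re, sub_im, one_re, one_im, mul_re, mul_im, conj_re, conj_im]
  ring

theorem diskKernel_norm_le {q z : ℂ} (hq : ‖q‖ < 1) (hz : ‖z‖ ≤ 1) : ‖diskKernel q z‖ ≤ 1 := by
  rw [diskKernel, norm_div]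
  refine div_le_one_of_le₀ ?_ (norm_nonneg _)
  rw [← sq_le_sq₀ (norm_nonneg _) (norm_nonneg _), Complex.sq_norm, Complex.sq_norm]
  have h := normSq_diskKernel_identity q z
  have h1 : normSq z ≤ 1 := by rw [normSq_eq_norm_sq]; exact pow_le_one₀ (norm_nonneg _) hz
  have h2 : normSq q ≤ 1 := by rw [normSq_eq_norm_sq]; exact pow_le_one₀ (norm_nonneg _) hq.le
  nlinarith

theorem diskKernel_norm_eq_one_iff {q z : ℂ} (hq : ‖q‖ < 1) (hz : ‖z‖ ≤ 1) :
    ‖diskKernel q z‖ = 1 ↔ ‖z‖ = 1 := by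
  have hn := one_sub_conj_mul_ne_zero hq hz
  rw [diskKernel, norm_div, div_eq_one_iff_eq (norm_ne_zero_iff.2 hn),
    ← sq_eq_sq₀ (norm_nonneg _) (norm_nonneg _), Complex.sq_norm, Complex.sq_norm,
    ← sq_eq_sq₀ (norm_nonneg z) zero_le_one, Complex.sq_norm]
  have h := normSq_diskKernel_identity q z
  have h2 : normSq q < 1 := by
    rw [normSq_eq_norm_sq]; exact pow_lt_one₀ (norm_nonneg _) hq two_ne_zero
  constructor
  · intro h3
    rw [h3, sub_self] at h
    rcases mul_eq_zero.1 h.symm with h4 | h4 <;> linarith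
  · intro h3
    rw [h3] at h
    linarith

theorem diskKernel_ne_zero {q z : ℂ} (hq : ‖q‖ < 1) (hz : ‖z‖ ≤ 1) (h : z ≠ q) :
    diskKernel q z ≠ 0 := div_ne_zero (sub_ne_zero.2 h) (one_sub_conj_mul_ne_zero hq hz)

theorem diskKernel_neg {q z : ℂ} (hq : ‖q‖ < 1) (hz : ‖z‖ ≤ 1) :
    diskKernel (-q) (diskKernel q z) = z := by
  have hn := one_sub_conj_mul_ne_zero hq hz
  have h2 := one_sub_conj_mul_ne_zero hq hq.le
  simp only [diskKernel, map_neg]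
  generalize conj q = c at hn h2
  have h3 : 1 - -c * ((z - q) / (1 - c * z)) = (1 - c * q) / (1 - c * z) := by
    rw [eq_div_iff hn, sub_mul, mul_assoc, div_mul_cancel₀ _ hn]; ring
  have h4 : (z - q) / (1 - c * z) - -q = z * (1 - c * q) / (1 - c * z) := by
    rw [eq_div_iff hn, sub_mul, div_mul_cancel₀ _ hn]; ring
  rw [h3, h4, div_div_div_cancel_right₀ hn, mul_div_cancel_right₀ _ h2]

theorem diskKernel_neg' {q z : ℂ} (hq : ‖q‖ < 1) (hz : ‖z‖ ≤ 1) :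
    diskKernel q (diskKernel (-q) z) = z := by
  simpa using diskKernel_neg (q := -q) (by simpa using hq) hz

theorem diskKernel_self (q : ℂ) : diskKernel q q = 0 := by simp [diskKernel]

theorem continuous_diskKernel {X : Type*} [TopologicalSpace X] {f : X → ℂ} (hf : Continuous f)
    {q : ℂ} (hq : ‖q‖ < 1) (h : ∀ x, ‖f x‖ ≤ 1) : Continuous fun x => diskKernel q (f x) := by
  unfold diskKernel
  exact Continuous.div (by fun_prop) (by fun_prop) fun x => one_sub_conj_mul_ne_zero hq (h x)

/-- The involution exchanging the closed left half-plane and the closed disk minus `1`. -/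
noncomputable def cayley (u : ℂ) : ℂ := (u + 1) / (u - 1)

theorem cayley_cayley {u : ℂ} (hu : u ≠ 1) : cayley (cayley u) = u := by
  have h : u - 1 ≠ 0 := sub_ne_zero.2 hu
  have h1 : cayley u + 1 = 2 * u / (u - 1) := by rw [cayley]; field_simp; ring
  have h2 : cayley u - 1 = 2 / (u - 1) := by rw [cayley]; field_simp; ring
  rw [cayley, h1, h2]
  field_simp

theorem cayley_ne_one {u : ℂ} (hu : u ≠ 1) : cayley u ≠ 1 := by
  have h : u - 1 ≠ 0 := sub_ne_zero.2 hu
  rw [cayley, Ne, div_eq_one_iff_eq h]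
  intro h2
  have : (2 : ℂ) = 0 := by linear_combination h2
  norm_num at this

theorem normSq_cayley_identity (u : ℂ) : normSq (u - 1) - normSq (u + 1) = -4 * u.re := by
  simp only [normSq_apply, sub_re, sub_im, add_re, add_im, one_re, one_im]
  ring

theorem norm_cayley_le_iff {u : ℂ} (hu : u ≠ 1) : ‖cayley u‖ ≤ 1 ↔ u.re ≤ 0 := by
  have h : 0 < ‖u - 1‖ := norm_pos_iff.2 (sub_ne_zero.2 hu)
  rw [cayley, norm_div, div_le_one h, ← sq_le_sq₀ (norm_nonneg _) (norm_nonneg _),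
    Complex.sq_norm, Complex.sq_norm]
  have := normSq_cayley_identity u
  constructor <;> intro <;> linarith

theorem norm_cayley_lt_iff {u : ℂ} (hu : u ≠ 1) : ‖cayley u‖ < 1 ↔ u.re < 0 := by
  have h : 0 < ‖u - 1‖ := norm_pos_iff.2 (sub_ne_zero.2 hu)
  rw [cayley, norm_div, div_lt_one h, ← sq_lt_sq₀ (norm_nonneg _) (norm_nonneg _),
    Complex.sq_norm, Complex.sq_norm]
  have := normSq_cayley_identity u
  constructor <;> intro <;> linarith

theorem ne_one_of_re {u : ℂ} (hu : u.re ≤ 0) : u ≠ 1 := by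
  rintro rfl; simp at hu; linarith

theorem cayley_re_le {z : ℂ} (hz : ‖z‖ ≤ 1) (h1 : z ≠ 1) : (cayley z).re ≤ 0 := by
  rw [← norm_cayley_le_iff (cayley_ne_one h1), cayley_cayley h1]; exact hz

theorem norm_cayley_eq {u : ℂ} (hu : u.re = 0) : ‖cayley u‖ = 1 := by
  have h1 := ne_one_of_re hu.le
  refine le_antisymm ((norm_cayley_le_iff h1).2 hu.le) (not_lt.1 fun h => ?_)
  rw [norm_cayley_lt_iff h1] at h
  linarith

theorem continuous_cayley {X : Type*} [TopologicalSpace X] {f : X → ℂ} (hf : Continuous f)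
    (h : ∀ x, f x ≠ 1) : Continuous fun x => cayley (f x) := by
  unfold cayley
  exact Continuous.div (by fun_prop) (by fun_prop) fun x => sub_ne_zero.2 (h x)

theorem diskKernel_cayley {l u : ℂ} (hl : l.re < 0) (hu : u.re ≤ 0) :
    diskKernel (cayley l) (cayley u) =
      halfKernel (-I * u) (-I * l) * ((conj l - 1) / (l - 1)) := by
  have h1 : u - 1 ≠ 0 := sub_ne_zero.2 (ne_one_of_re hu)
  have h2 : l - 1 ≠ 0 := sub_ne_zero.2 (ne_one_of_re hl.le)
  have h3 : conj l - 1 ≠ 0 := by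
    have := (map_ne_zero (starRingEnd ℂ)).2 h2; simpa using this
  have h4 : u + conj l ≠ 0 := by
    intro h; have := congrArg Complex.re h; simp at this; linarith
  have e1 : cayley u - cayley l = -2 * (u - l) / ((u - 1) * (l - 1)) := by
    rw [cayley, cayley]; field_simp; ring
  have e2 : 1 - conj (cayley l) * cayley u = -2 * (u + conj l) / ((u - 1) * (conj l - 1)) := by
    rw [cayley, cayley]
    simp only [map_div₀, map_add, map_sub, map_one]
    field_simp; ring
  have e3 : halfKernel (-I * u) (-I * l) = (u - l) / (u + conj l) := by
    rw [halfKernel]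
    have : -I * u - conj (-I * l) = -I * (u + conj l) := by simp; ring
    rw [this, ← mul_sub, mul_div_mul_left _ _ (by simp)]
  rw [diskKernel, e1, e2, e3]
  field_simp

theorem dlog_diskKernel_cayley {l : ℂ} (hl : l.re < 0) {u : ℝ → ℂ} (hu : Continuous u)
    (h0 : ∀ t, (u t).re ≤ 0) (hne : ∀ t, u t ≠ l) :
    dlog (fun t => diskKernel (cayley l) (cayley (u t))) 0 1 =
      dlog (fun t => halfKernel (-I * u t) (-I * l)) 0 1 := by
  have him : ∀ t, 0 ≤ (-I * u t).im := fun t => by simpa using h0 t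
  have hq : 0 < (-I * l).im := by simpa using hl
  have h2 : l - 1 ≠ 0 := sub_ne_zero.2 (ne_one_of_re hl.le)
  have h3 : conj l - 1 ≠ 0 := by
    have := (map_ne_zero (starRingEnd ℂ)).2 h2; simpa using this
  simp only [fun t => diskKernel_cayley hl (h0 t)]
  rw [dlog_mul (continuous_halfKernel (α := fun t => -I * u t) (by fun_prop) him hq)
    (fun t => halfKernel_ne_zero (him t) hq fun h => hne t (mul_left_cancel₀ (by simp) h))
    continuous_const (fun _ => div_ne_zero h3 h2), dlog_const, add_zero]

end Kernel

section ClassLog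

variable {X : Type*} [TopologicalSpace X]

theorem dlog_extend_of_log {a b : X} (p : Path a b) {f Λ : X → ℂ} (hΛ : Continuous Λ)
    (h : ∀ x, exp (Λ x) = f x) : dlog (fun t => f (p.extend t)) 0 1 = Λ b - Λ a := by
  rw [dlog_eq (Λ := fun t => Λ (p.extend t)) (hΛ.comp p.extend.continuous) (fun t => h _)]
  simp

/-- The increment of the logarithm along a path is a homotopy invariant. -/
theorem dlog_extend_of_homotopic {f : X → ℂ} (hf : Continuous f) (h0 : ∀ x, f x ≠ 0) {a b : X}
    {p q : Path a b} (h : p.Homotopic q) :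
    dlog (fun t => f (p.extend t)) 0 1 = dlog (fun t => f (q.extend t)) 0 1 := by
  obtain ⟨F⟩ := h
  set P : ℝ → unitInterval := projIcc 0 1 zero_le_one with hP
  have hPc : Continuous P := continuous_projIcc
  have hP0 : P 0 = 0 := projIcc_left _
  have hP1 : P 1 = 1 := projIcc_right _
  obtain ⟨Λ, hΛ, -, hE⟩ := exists_continuous_log (A := ℝ × ℝ)
    (f := fun x => f (F (P x.1, P x.2)))
    (hf.comp (F.continuous.comp (by fun_prop))) (fun _ => h0 _) (0, 0) _ (exp_log (h0 _))
  have key := continuous_log_sub_eq (Λ := fun s => Λ (s, 1) - Λ (s, 0))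
    (M := fun _ => Λ (0, 1) - Λ (0, 0)) (by fun_prop) continuous_const (by
      intro s
      rw [exp_sub, exp_sub, hE, hE, hE, hE]
      simp [hP0, hP1]) 0 1
  have e : ∀ s (r : Path a b), (∀ t, F (P s, t) = r t) →
      dlog (fun t => f (r.extend t)) 0 1 = Λ (s, 1) - Λ (s, 0) := by
    intro s r hr
    refine dlog_eq (Λ := fun t => Λ (s, t)) (by fun_prop) (fun t => ?_) 0 1
    rw [hE]
    change f (F (P s, P t)) = f (r (P t))
    rw [hr]
  rw [e 0 p (by simp [hP0]), e 1 q (by simp [hP1])]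
  linear_combination -key

/-- The increment of the logarithm of `f` along a homotopy class of paths. -/
noncomputable def classLog (f : X → ℂ) {a b : X} (P : Path.Homotopic.Quotient a b) : ℂ :=
  dlog (fun t => f (Path.extend (Path.Homotopic.Quotient.mk_surjective P).choose t)) 0 1

theorem classLog_mk {f : X → ℂ} (hf : Continuous f) (h0 : ∀ x, f x ≠ 0) {a b : X}
    (p : Path a b) :
    classLog f (Path.Homotopic.Quotient.mk p) = dlog (fun t => f (p.extend t)) 0 1 :=
  dlog_extend_of_homotopic hf h0
    (Path.Homotopic.Quotient.exact (Path.Homotopic.Quotient.mk_surjective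
      (Path.Homotopic.Quotient.mk p)).choose_spec)

theorem classLog_trans {f : X → ℂ} (hf : Continuous f) (h0 : ∀ x, f x ≠ 0) {a b c : X}
    (P : Path.Homotopic.Quotient a b) (Q : Path.Homotopic.Quotient b c) :
    classLog f (P.trans Q) = classLog f P + classLog f Q := by
  obtain ⟨p, rfl⟩ := Path.Homotopic.Quotient.mk_surjective P
  obtain ⟨q, rfl⟩ := Path.Homotopic.Quotient.mk_surjective Q
  rw [← Path.Homotopic.Quotient.mk_trans, classLog_mk hf h0, classLog_mk hf h0, classLog_mk hf h0]
  obtain ⟨Λ, hΛ, hE⟩ := exists_log_real (f := fun t => f ((p.trans q).extend t))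
    (hf.comp (p.trans q).extend.continuous) (fun _ => h0 _)
  have hp : ∀ t : ℝ, (p.trans q).extend ((projIcc 0 1 zero_le_one t : ℝ) / 2) = p.extend t := by
    intro t
    have h1 := (projIcc (0 : ℝ) 1 zero_le_one t).2
    rw [Path.extend_trans_of_le_half]
    · rw [mul_div_cancel₀ _ (two_ne_zero)]
      simp [Path.extend, IccExtend]
    · linarith [h1.2]
  have hq : ∀ t : ℝ, (p.trans q).extend ((1 + (projIcc 0 1 zero_le_one t : ℝ)) / 2)
      = q.extend t := by
    intro t
    have h1 := (projIcc (0 : ℝ) 1 zero_le_one t).2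
    rw [Path.extend_trans_of_half_le]
    · rw [mul_div_cancel₀ _ (two_ne_zero), add_sub_cancel_left]
      simp [Path.extend, IccExtend]
    · linarith [h1.1]
  have hc : Continuous fun t : ℝ => ((projIcc 0 1 zero_le_one t : unitInterval) : ℝ) :=
    continuous_subtype_val.comp continuous_projIcc
  rw [dlog_eq hΛ hE, dlog_eq (f := fun t => f (p.extend t))
    (Λ := fun t => Λ ((projIcc 0 1 zero_le_one t : ℝ) / 2)) (by fun_prop)
    (fun t => by rw [hE, hp]), dlog_eq (f := fun t => f (q.extend t))
    (Λ := fun t => Λ ((1 + (projIcc 0 1 zero_le_one t : ℝ)) / 2)) (by fun_prop)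
    (fun t => by rw [hE, hq])]
  simp only [projIcc_left, projIcc_right]
  norm_num

theorem classLog_refl {f : X → ℂ} (hf : Continuous f) (h0 : ∀ x, f x ≠ 0) (a : X) :
    classLog f (Path.Homotopic.Quotient.refl a) = 0 := by
  rw [← Path.Homotopic.Quotient.mk_refl, classLog_mk hf h0]
  exact dlog_const (f a) 0 1

theorem classLog_symm {f : X → ℂ} (hf : Continuous f) (h0 : ∀ x, f x ≠ 0) {a b : X}
    (P : Path.Homotopic.Quotient a b) : classLog f P.symm = -classLog f P := by
  obtain ⟨p, rfl⟩ := Path.Homotopic.Quotient.mk_surjective P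
  rw [← Path.Homotopic.Quotient.mk_symm, classLog_mk hf h0, classLog_mk hf h0,
    ← dlog_reverse (f := fun t => f (p.extend t)) (hf.comp p.extend.continuous) (fun _ => h0 _)]
  congr 1
  funext t
  simp [Path.extend_symm]

/-- `classLog` as a homomorphism on the fundamental group. -/
noncomputable def logHom {f : X → ℂ} (hf : Continuous f) (h0 : ∀ x, f x ≠ 0) (a : X) :
    FundamentalGroup X a →* Multiplicative ℂ where
  toFun P := Multiplicative.ofAdd (classLog f P.toPath)
  map_one' := by
    rw [FundamentalGroup.one_def, classLog_refl hf h0]; rfl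
  map_mul' P Q := by
    rw [FundamentalGroup.mul_def, classLog_trans hf h0, add_comm]; rfl

end ClassLog

section Lasso

/-- The closed disk punctured along `T`. -/
abbrev PDisk (T : Set ℂ) : Type := ↥(ClosedDisk \ T)

theorem PDisk.norm_le {T : Set ℂ} (z : PDisk T) : ‖(z : ℂ)‖ ≤ 1 := by
  simpa using z.2.1

theorem PDisk.ne {T : Set ℂ} (z : PDisk T) {q : ℂ} (hq : q ∈ T) : (z : ℂ) ≠ q :=
  fun h => z.2.2 (h ▸ hq)

theorem PDisk.continuous_kernel (T : Set ℂ) {q : ℂ} (hq : ‖q‖ < 1) :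
    Continuous fun z : PDisk T => diskKernel q z :=
  continuous_diskKernel continuous_subtype_val hq PDisk.norm_le

theorem PDisk.kernel_ne_zero {T : Set ℂ} {q : ℂ} (hq : ‖q‖ < 1) (hT : q ∈ T) (z : PDisk T) :
    diskKernel q z ≠ 0 := diskKernel_ne_zero hq z.norm_le (z.ne hT)

/-- The winding of a homotopy class of paths about the puncture `q`. -/
noncomputable def winding {T : Set ℂ} (q : ℂ) {a b : PDisk T}
    (P : Path.Homotopic.Quotient a b) : ℂ :=
  classLog (fun z : PDisk T => diskKernel q z) P

theorem winding_mk {T : Set ℂ} {q : ℂ} (hq : ‖q‖ < 1) (hT : q ∈ T) {a b : PDisk T}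
    (p : Path a b) :
    winding q (Path.Homotopic.Quotient.mk p) = dlog (fun t => diskKernel q (p.extend t)) 0 1 :=
  classLog_mk (PDisk.continuous_kernel T hq) (PDisk.kernel_ne_zero hq hT) p

theorem winding_trans {T : Set ℂ} {q : ℂ} (hq : ‖q‖ < 1) (hT : q ∈ T) {a b c : PDisk T}
    (P : Path.Homotopic.Quotient a b) (Q : Path.Homotopic.Quotient b c) :
    winding q (P.trans Q) = winding q P + winding q Q :=
  classLog_trans (PDisk.continuous_kernel T hq) (PDisk.kernel_ne_zero hq hT) P Q

theorem winding_symm {T : Set ℂ} {q : ℂ} (hq : ‖q‖ < 1) (hT : q ∈ T) {a b : PDisk T}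
    (P : Path.Homotopic.Quotient a b) : winding q P.symm = -winding q P :=
  classLog_symm (PDisk.continuous_kernel T hq) (PDisk.kernel_ne_zero hq hT) P

/-- The parametrisation of the unit circle by `ℝ / ℤ`. -/
noncomputable def circ (t : ℝ) : ℂ := exp (2 * Real.pi * t * I)

theorem continuous_circ : Continuous circ := by unfold circ; fun_prop

theorem circ_zero : circ 0 = 1 := by simp [circ]

theorem circ_one : circ 1 = 1 := by simp [circ, exp_two_pi_mul_I]

theorem circ_half (t : ℝ) : circ (t + 1 / 2) = -circ t := by
  rw [circ, circ, show (2 * Real.pi * ((t + 1 / 2 : ℝ) : ℂ) * I) =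
    2 * Real.pi * t * I + Real.pi * I by push_cast; ring, exp_add, exp_pi_mul_I]
  ring

theorem norm_circ (t : ℝ) : ‖circ t‖ = 1 := by
  rw [circ, show (2 * Real.pi * (t : ℂ) * I) = ((2 * Real.pi * t : ℝ) : ℂ) * I by push_cast; ring,
    norm_exp_ofReal_mul_I]

theorem circ_ne_zero (t : ℝ) : circ t ≠ 0 := exp_ne_zero _

/-- `x` is represented by a path, followed by the boundary of an embedded disk which contains no
puncture but its centre `q`, followed by the reversed path. -/
def IsLasso (T : Set ℂ) (a : PDisk T) (q : ℂ) (x : FundamentalGroup (PDisk T) a) : Prop :=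
  ∃ ψ : ℂ → ℂ, Continuous ψ ∧ (∀ z, ψ z ∈ ClosedDisk) ∧ (∀ z, z ≠ 0 → ψ z ∉ T) ∧
    InjOn ψ (Metric.closedBall 0 1) ∧ ψ 0 = q ∧
    ∃ (v : PDisk T) (ω : Path v v), (∀ t : unitInterval, (ω t : ℂ) = ψ (circ t)) ∧
      ∃ C : Path.Homotopic.Quotient a v,
        x = FundamentalGroup.fromPath ((C.trans (Path.Homotopic.Quotient.mk ω)).trans C.symm)

theorem diskKernel_injOn {q : ℂ} (hq : ‖q‖ < 1) {z w : ℂ} (hz : ‖z‖ ≤ 1) (hw : ‖w‖ ≤ 1)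
    (h : diskKernel q z = diskKernel q w) : z = w := by
  rw [← diskKernel_neg hq hz, h, diskKernel_neg hq hw]

theorem winding_conj {T : Set ℂ} {q : ℂ} (hq : ‖q‖ < 1) (hT : q ∈ T) {a v : PDisk T}
    (C : Path.Homotopic.Quotient a v) (ω : Path.Homotopic.Quotient v v) :
    winding q ((C.trans ω).trans C.symm) = winding q ω := by
  rw [winding_trans hq hT, winding_trans hq hT, winding_symm hq hT]; ring

theorem dlog_comp_projIcc {f : ℝ → ℂ} (hf : Continuous f) (h0 : ∀ t, f t ≠ 0) :
    dlog (fun t => f (projIcc (0 : ℝ) 1 zero_le_one t : unitInterval)) 0 1 = dlog f 0 1 := by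
  obtain ⟨Λ, h1, h2⟩ := exists_log_real hf h0
  rw [dlog_eq h1 h2, dlog_eq (Λ := fun t => Λ (projIcc (0 : ℝ) 1 zero_le_one t : unitInterval))
    (h1.comp (continuous_subtype_val.comp continuous_projIcc)) (fun t => h2 _)]
  simp [projIcc_left, projIcc_right]

theorem winding_loop {T : Set ℂ} {q : ℂ} (hq : ‖q‖ < 1) (hT : q ∈ T) {ψ : ℂ → ℂ}
    (hψ : Continuous ψ) (hD : ∀ z, ψ z ∈ ClosedDisk) (hψT : ∀ z, z ≠ 0 → ψ z ∉ T)
    {v : PDisk T} {ω : Path v v} (hω : ∀ t : unitInterval, (ω t : ℂ) = ψ (circ t)) :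
    winding q (Path.Homotopic.Quotient.mk ω) = dlog (fun t => diskKernel q (ψ (circ t))) 0 1 := by
  have hD' : ∀ z, ‖ψ z‖ ≤ 1 := fun z => by simpa using hD z
  rw [winding_mk hq hT, ← dlog_comp_projIcc (f := fun t => diskKernel q (ψ (circ t)))
    (continuous_diskKernel (hψ.comp continuous_circ) hq fun t => hD' _)
    (fun t => diskKernel_ne_zero hq (hD' _) fun h => hψT _ (circ_ne_zero t) (h ▸ hT))]
  congr 1
  funext t
  rw [← hω]
  rfl

theorem dlog_circ_ne_zero {h : ℂ → ℂ} (hc : Continuous h) (hi : InjOn h (Metric.closedBall 0 1))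
    (h0 : h 0 = 0) : dlog (fun t => h (circ t)) 0 1 ≠ 0 := by
  let P : ℝ → ℝ := fun t => (projIcc (0 : ℝ) 1 zero_le_one t : unitInterval)
  have hPc : Continuous P := continuous_subtype_val.comp continuous_projIcc
  have hP : ∀ t, P t ∈ Icc (0 : ℝ) 1 := fun t => (projIcc (0 : ℝ) 1 zero_le_one t).2
  have hP0 : P 0 = 0 := by simp [P]
  have hP1 : P 1 = 1 := by simp [P]
  obtain ⟨Λ, hΛ, -, hE⟩ := exists_continuous_log (A := ℝ × ℝ)
    (f := fun x => h (circ x.2) - h (-(P x.1 : ℂ) * circ x.2))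
    (by have := continuous_circ; fun_prop)
    (fun x => by
      rw [sub_ne_zero]
      intro h1
      have h2 := hi (by simp [norm_circ]) (by
        have h3 := hP x.1
        simp only [mem_closedBall_zero_iff, norm_mul, norm_circ, norm_neg, mul_one, norm_real,
          Real.norm_eq_abs]
        exact abs_le.2 ⟨by linarith [h3.1], h3.2⟩) h1
      have h3 : (1 + (P x.1 : ℂ)) * circ x.2 = 0 := by linear_combination h2
      rcases mul_eq_zero.1 h3 with h4 | h4
      · have h5 : 1 + P x.1 = 0 := by exact_mod_cast h4
        linarith [(hP x.1).1]
      · exact circ_ne_zero _ h4) (0, 0) _ (exp_log (by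
      simp only [hP0]
      rw [sub_ne_zero]
      intro h1
      have h2 := hi (by simp [norm_circ]) (by simp) h1
      simp [circ_ne_zero] at h2))
  have hD := continuous_log_sub_eq (Λ := fun s => Λ (s, 1) - Λ (s, 0)) (M := fun _ => 0)
    (by fun_prop) continuous_const (by
      intro s
      rw [exp_sub, hE, hE]
      simp only [circ_zero, circ_one, exp_zero]
      rw [div_self]
      have := exp_ne_zero (Λ (s, 1))
      rw [hE] at this
      simpa [circ_one] using this) 0 1
  have h1 : dlog (fun t => h (circ t)) 0 1 = Λ (0, 1) - Λ (0, 0) := by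
    refine dlog_eq (Λ := fun t => Λ (0, t)) (by fun_prop) (fun t => ?_) 0 1
    rw [hE]
    simp [hP0, h0]
  have hneg : ∀ t : ℝ, exp (Λ (1, t + 1 / 2) - Λ (1, t)) = -1 := by
    intro t
    rw [exp_sub, div_eq_iff (exp_ne_zero _), hE, hE]
    simp only [hP1, circ_half]
    simp
  have hc2 := continuous_log_sub_eq (Λ := fun t : ℝ => Λ (1, t + 1 / 2) - Λ (1, t))
    (M := fun _ => Real.pi * I)
    (by fun_prop) continuous_const (by
      intro s
      rw [hneg, exp_pi_mul_I]) 0 (1 / 2)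
  intro h2
  rw [h1] at h2
  have h3 := hneg 0
  norm_num at hc2 h3
  have h4 : Λ (1, 1 / 2) - Λ (1, 0) = 0 := by
    linear_combination (1 / 2) * h2 + (1 / 2) * hD - (1 / 2) * hc2
  rw [h4] at h3
  norm_num at h3

/-- A lasso winds non-trivially about its centre. -/
theorem IsLasso.winding_ne_zero {T : Set ℂ} {a : PDisk T} {q : ℂ}
    {x : FundamentalGroup (PDisk T) a} (hx : IsLasso T a q x) (hq : ‖q‖ < 1) (hT : q ∈ T) :
    winding q x.toPath ≠ 0 := by
  obtain ⟨ψ, hψ, hD, hψT, hi, h0, v, ω, hω, C, rfl⟩ := hx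
  change winding q ((C.trans (Path.Homotopic.Quotient.mk ω)).trans C.symm) ≠ 0
  rw [winding_conj hq hT, winding_loop hq hT hψ hD hψT hω]
  have hD' : ∀ z, ‖ψ z‖ ≤ 1 := fun z => by simpa using hD z
  refine dlog_circ_ne_zero (h := fun z => diskKernel q (ψ z)) (continuous_diskKernel hψ hq hD')
    (fun z hz w hw h => hi hz hw (diskKernel_injOn hq (hD' _) (hD' _) h)) ?_
  simp only [h0, diskKernel_self]

/-- A lasso does not wind about punctures other than its centre. -/
theorem IsLasso.winding_eq_zero {T : Set ℂ} {a : PDisk T} {q q' : ℂ}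
    {x : FundamentalGroup (PDisk T) a} (hx : IsLasso T a q x) (hq : ‖q'‖ < 1) (hT : q' ∈ T)
    (hne : q ≠ q') : winding q' x.toPath = 0 := by
  obtain ⟨ψ, hψ, hD, hψT, hi, h0, v, ω, hω, C, rfl⟩ := hx
  change winding q' ((C.trans (Path.Homotopic.Quotient.mk ω)).trans C.symm) = 0
  rw [winding_conj hq hT, winding_loop hq hT hψ hD hψT hω]
  have hD' : ∀ z, ‖ψ z‖ ≤ 1 := fun z => by simpa using hD z
  have hn : ∀ z, ψ z ≠ q' := by
    intro z h
    by_cases hz : z = 0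
    · exact hne (by rw [← h0, ← h, hz])
    · exact hψT z hz (h ▸ hT)
  obtain ⟨Λ, hΛ, -, hE⟩ := exists_continuous_log (A := ℂ)
    (f := fun z => diskKernel q' (ψ z)) (continuous_diskKernel hψ hq hD')
    (fun z => diskKernel_ne_zero hq (hD' z) (hn z)) 0 _
    (exp_log (diskKernel_ne_zero hq (hD' 0) (hn 0)))
  rw [dlog_eq (Λ := fun t => Λ (circ t)) (hΛ.comp continuous_circ) (fun t => hE _), circ_zero,
    circ_one, sub_self]

end Lasso

section Cover

variable {T : Set ℂ} {s : ℂ}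

/-- The infinite cyclic branched cover of the disk, unwinding about `s`. -/
noncomputable def unwind (s z : ℂ) : ℂ := diskKernel (-s) (exp (cayley z))

/-- The points to be removed from the disk so that `unwind s` becomes a covering. -/
def coverSet (s : ℂ) (T : Set ℂ) : Set ℂ := {z | z = 1 ∨ unwind s z ∈ T}

theorem norm_exp_le_one {u : ℂ} (hu : u.re ≤ 0) : ‖exp u‖ ≤ 1 := by
  rw [norm_exp]; exact Real.exp_le_one_iff.2 hu

theorem PDisk.ne_one (z : PDisk (coverSet s T)) : (z : ℂ) ≠ 1 := z.ne (Or.inl rfl)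

theorem PDisk.cayley_re_le (z : PDisk (coverSet s T)) : (cayley z).re ≤ 0 :=
  _root_.cayley_re_le z.norm_le z.ne_one

theorem diskKernel_unwind (hs : ‖s‖ < 1) {z : ℂ} (hz : (cayley z).re ≤ 0) :
    diskKernel s (unwind s z) = exp (cayley z) :=
  diskKernel_neg' hs (norm_exp_le_one hz)

/-- The image of the punctured disk under the Blaschke factor at the puncture `s`. -/
def kernelImage (s : ℂ) (T : Set ℂ) : Set ℂ := {w | ‖w‖ ≤ 1 ∧ diskKernel (-s) w ∉ T}

theorem kernelImage_subset (hsT : s ∈ T) : kernelImage s T ⊆ {0}ᶜ := by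
  rintro w ⟨-, h⟩ rfl
  exact h (by simpa [diskKernel] using hsT)

/-- The Cayley transform, identifying the punctured disk with a subset of a half-plane. -/
noncomputable def coverHomeo (s : ℂ) (T : Set ℂ) :
    PDisk (coverSet s T) ≃ₜ exp ⁻¹' kernelImage s T where
  toFun z := ⟨cayley z, norm_exp_le_one z.cayley_re_le, fun h => z.2.2 (Or.inr h)⟩
  invFun u := ⟨cayley u, by
    have hu : (u : ℂ).re ≤ 0 := by
      have := u.2.1; rwa [norm_exp, Real.exp_le_one_iff] at this
    have h1 := ne_one_of_re hu
    refine ⟨by simpa using (norm_cayley_le_iff h1).2 hu, ?_⟩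
    rintro (h | h)
    · exact cayley_ne_one h1 h
    · rw [unwind, cayley_cayley h1] at h
      exact u.2.2 h⟩
  left_inv z := Subtype.ext (cayley_cayley z.ne_one)
  right_inv u := Subtype.ext (cayley_cayley (by
    have := u.2.1; rw [norm_exp, Real.exp_le_one_iff] at this; exact ne_one_of_re this))
  continuous_toFun := (continuous_cayley continuous_subtype_val PDisk.ne_one).subtype_mk _
  continuous_invFun := (continuous_cayley continuous_subtype_val fun u => by
    have := u.2.1; rw [norm_exp, Real.exp_le_one_iff] at this; exact ne_one_of_re this).subtype_mk _

/-- The Blaschke factor as a homeomorphism onto the punctured disk. -/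
noncomputable def kernelHomeo (hs : ‖s‖ < 1) (T : Set ℂ) : kernelImage s T ≃ₜ PDisk T where
  toFun w := ⟨diskKernel (-s) w, by
    simpa using diskKernel_norm_le (q := -s) (by simpa using hs) w.2.1, w.2.2⟩
  invFun z := ⟨diskKernel s z, diskKernel_norm_le hs z.norm_le, by
    rw [diskKernel_neg hs z.norm_le]; exact z.2.2⟩
  left_inv w := Subtype.ext (diskKernel_neg' hs w.2.1)
  right_inv z := Subtype.ext (diskKernel_neg hs z.norm_le)
  continuous_toFun := (continuous_diskKernel continuous_subtype_val (by simpa using hs)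
    fun w => w.2.1).subtype_mk _
  continuous_invFun := (continuous_diskKernel continuous_subtype_val hs
    PDisk.norm_le).subtype_mk _

/-- `unwind s` as a map between punctured disks. -/
noncomputable def coverMap (hs : ‖s‖ < 1) (T : Set ℂ) : C(PDisk (coverSet s T), PDisk T) where
  toFun := kernelHomeo hs T ∘ (kernelImage s T).restrictPreimage exp ∘ coverHomeo s T
  continuous_toFun := (kernelHomeo hs T).continuous.comp
    ((Complex.continuous_exp.restrictPreimage).comp (coverHomeo s T).continuous)

theorem coverMap_coe (hs : ‖s‖ < 1) (z : PDisk (coverSet s T)) :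
    (coverMap hs T z : ℂ) = unwind s z := rfl

theorem isCoveringMap_coverMap (hs : ‖s‖ < 1) (hsT : s ∈ T) :
    IsCoveringMap (coverMap hs T) := by
  have h := (isCoveringMapOn_exp.mono (kernelImage_subset hsT)).isCoveringMap_restrictPreimage
  exact (h.comp_homeomorph (coverHomeo s T)).homeomorph_comp (kernelHomeo hs T)

theorem diskKernel_coverMap (hs : ‖s‖ < 1) (z : PDisk (coverSet s T)) :
    diskKernel s (coverMap hs T z) = exp (cayley z) :=
  diskKernel_unwind hs z.cayley_re_le

theorem exists_lift_path (hs : ‖s‖ < 1) (hsT : s ∈ T) (a : PDisk (coverSet s T)) {b : PDisk T}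
    (p : Path (coverMap hs T a) b) :
    ∃ b', coverMap hs T b' = b ∧ ∃ p' : Path a b', ∀ t, coverMap hs T (p' t) = p t := by
  have cov := isCoveringMap_coverMap hs hsT
  obtain ⟨Γ, h1, h0⟩ := cov.exists_path_lifts (p : C(unitInterval, PDisk T)) a (by simp)
  have h2 : ∀ t, coverMap hs T (Γ t) = p t := fun t => congrFun h1 t
  exact ⟨Γ 1, by rw [h2, p.target], ⟨Γ, h0, rfl⟩, h2⟩

theorem winding_map_coverMap (hs : ‖s‖ < 1) (hsT : s ∈ T) {a b : PDisk (coverSet s T)}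
    (P : Path.Homotopic.Quotient a b) :
    winding s (P.map (coverMap hs T)) = cayley b - cayley a := by
  obtain ⟨p, rfl⟩ := Path.Homotopic.Quotient.mk_surjective P
  rw [← Path.Homotopic.Quotient.mk_map, winding_mk hs hsT]
  refine Eq.trans ?_ (dlog_extend_of_log p (f := fun z => diskKernel s (coverMap hs T z))
    (Λ := fun z => cayley z)
    (continuous_cayley continuous_subtype_val fun z => z.ne_one)
    fun z => (diskKernel_coverMap hs z).symm)
  rfl

end Cover

section LiftLasso

theorem quotient_trans_symm {X : Type*} [TopologicalSpace X] {a b c : X}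
    (P : Path.Homotopic.Quotient a b) (Q : Path.Homotopic.Quotient b c) :
    (P.trans Q).symm = Q.symm.trans P.symm := by
  obtain ⟨p, rfl⟩ := Path.Homotopic.Quotient.mk_surjective P
  obtain ⟨q, rfl⟩ := Path.Homotopic.Quotient.mk_surjective Q
  simp only [← Path.Homotopic.Quotient.mk_trans, ← Path.Homotopic.Quotient.mk_symm,
    Path.trans_symm]

theorem quotient_map_trans {X Y : Type*} [TopologicalSpace X] [TopologicalSpace Y] (f : C(X, Y))
    {a b c : X} (P : Path.Homotopic.Quotient a b) (Q : Path.Homotopic.Quotient b c) :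
    (P.trans Q).map f = (P.map f).trans (Q.map f) := by
  obtain ⟨p, rfl⟩ := Path.Homotopic.Quotient.mk_surjective P
  obtain ⟨q, rfl⟩ := Path.Homotopic.Quotient.mk_surjective Q
  simp only [← Path.Homotopic.Quotient.mk_trans, ← Path.Homotopic.Quotient.mk_map,
    Path.map_trans]

theorem quotient_map_symm {X Y : Type*} [TopologicalSpace X] [TopologicalSpace Y] (f : C(X, Y))
    {a b : X} (P : Path.Homotopic.Quotient a b) : P.symm.map f = (P.map f).symm := by
  obtain ⟨p, rfl⟩ := Path.Homotopic.Quotient.mk_surjective P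
  simp only [← Path.Homotopic.Quotient.mk_symm, ← Path.Homotopic.Quotient.mk_map, Path.map_symm]

variable {T : Set ℂ} {s : ℂ}

/-- All conjugates of a lasso by elements `g` of the fundamental group lift to the covering, and
the centre of the lifted lasso only depends on the winding of `g`. -/
theorem IsLasso.exists_lift (hs : ‖s‖ < 1) (hsT : s ∈ T) {a : PDisk (coverSet s T)} {q : ℂ}
    (hq : ‖q‖ < 1) (hqT : q ∈ T) (hne : q ≠ s)
    {x : FundamentalGroup (PDisk T) (coverMap hs T a)}
    (hx : IsLasso T (coverMap hs T a) q x) :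
    ∃ μ κ : ℂ, ∀ g : FundamentalGroup (PDisk T) (coverMap hs T a),
      exp (μ + winding s g.toPath) = diskKernel s q ∧
      ∃ y : FundamentalGroup (PDisk (coverSet s T)) a,
        IsLasso (coverSet s T) a (cayley (μ + winding s g.toPath)) y ∧
        FundamentalGroup.map (coverMap hs T) a y = g⁻¹ * x * g ∧
        winding (cayley (μ + winding s g.toPath)) y.toPath = κ := by
  obtain ⟨ψ, hψ, hD, hψT, hi, h0, v, ω, hω, C, rfl⟩ := hx
  have hD' : ∀ z, ‖ψ z‖ ≤ 1 := fun z => by simpa using hD z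
  have hns : ∀ z, ψ z ≠ s := by
    intro z h
    by_cases hz : z = 0
    · exact hne (by rw [← h0, ← h, hz])
    · exact hψT z hz (h ▸ hsT)
  obtain ⟨Λ, hΛ, -, hE⟩ := exists_continuous_log (A := ℂ)
    (f := fun z => diskKernel s (ψ z)) (continuous_diskKernel hψ hs hD')
    (fun z => diskKernel_ne_zero hs (hD' z) (hns z)) 0 _
    (exp_log (diskKernel_ne_zero hs (hD' 0) (hns 0)))
  have hre : ∀ z, (Λ z).re ≤ 0 := fun z => by
    have := diskKernel_norm_le hs (hD' z)
    rwa [← hE, norm_exp, Real.exp_le_one_iff] at this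
  refine ⟨cayley a + winding s C + Λ 0 - Λ 1,
    dlog (fun t => halfKernel (-I * Λ (circ t)) (-I * Λ 0)) 0 1, fun g => ?_⟩
  obtain ⟨c, hc⟩ := Path.Homotopic.Quotient.mk_surjective (g.toPath.trans C)
  obtain ⟨v', rfl, c', hc'⟩ := exists_lift_path hs hsT a c
  have hcc : c'.map (coverMap hs T).continuous = c := Path.ext (funext hc')
  have hmap : (Path.Homotopic.Quotient.mk c').map (coverMap hs T) = g.toPath.trans C := by
    rw [← Path.Homotopic.Quotient.mk_map, hcc, hc]
  have hw : winding s g.toPath + winding s C = cayley v' - cayley a := by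
    rw [← winding_trans hs hsT, ← hmap, winding_map_coverMap hs hsT]
  have hψ1 : ψ 1 = coverMap hs T v' := by
    have := hω 0
    rw [ω.source] at this
    simpa [circ_zero] using this.symm
  obtain ⟨n, hn⟩ : ∃ n : ℤ, cayley v' = Λ 1 + n * (2 * Real.pi * I) := by
    rw [← exp_eq_exp_iff_exists_int, hE, hψ1, diskKernel_coverMap]
  set τ : ℂ := n * (2 * Real.pi * I) with hτ
  have hτre : τ.re = 0 := by simp [hτ]
  have hτe : exp τ = 1 := by rw [hτ]; exact exp_int_mul_two_pi_mul_I n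
  have hcen : cayley a + winding s C + Λ 0 - Λ 1 + winding s g.toPath = Λ 0 + τ := by
    linear_combination hw + hn
  rw [hcen]
  have hE' : ∀ z, exp (Λ z + τ) = diskKernel s (ψ z) := fun z => by
    rw [exp_add, hτe, mul_one, hE]
  have hre' : ∀ z, (Λ z + τ).re ≤ 0 := fun z => by rw [add_re, hτre, add_zero]; exact hre z
  have hun : ∀ z, unwind s (cayley (Λ z + τ)) = ψ z := fun z => by
    rw [unwind, cayley_cayley (ne_one_of_re (hre' z)), hE', diskKernel_neg hs (hD' z)]
  have hΨ : Continuous fun z => cayley (Λ z + τ) :=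
    continuous_cayley (by fun_prop) fun z => ne_one_of_re (hre' z)
  have hΨD : ∀ z, cayley (Λ z + τ) ∈ ClosedDisk := fun z => by
    simpa using (norm_cayley_le_iff (ne_one_of_re (hre' z))).2 (hre' z)
  have hΨT : ∀ z, z ≠ 0 → cayley (Λ z + τ) ∉ coverSet s T := by
    rintro z hz (h | h)
    · exact cayley_ne_one (ne_one_of_re (hre' z)) h
    · rw [hun] at h
      exact hψT z hz h
  have hv' : cayley (Λ 1 + τ) = v' := by rw [← hn, cayley_cayley v'.ne_one]
  let ω' : Path v' v' :=
    { toFun := fun t => ⟨cayley (Λ (circ t) + τ), hΨD _, hΨT _ (circ_ne_zero _)⟩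
      continuous_toFun := (hΨ.comp (continuous_circ.comp continuous_subtype_val)).subtype_mk _
      source' := Subtype.ext (by simp [circ_zero, hv'])
      target' := Subtype.ext (by simp [circ_one, hv']) }
  have hω' : ∀ t : unitInterval, (ω' t : ℂ) = cayley (Λ (circ t) + τ) := fun t => rfl
  have hωω : ω'.map (coverMap hs T).continuous = ω := by
    refine Path.ext (funext fun t => Subtype.ext ?_)
    change unwind s (ω' t) = ω t
    rw [hω', hun, hω]
  have hΛ0 : (Λ 0).re < 0 := by
    have h1 : ‖exp (Λ 0)‖ < 1 := by
      rw [hE, h0]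
      exact lt_of_le_of_ne (diskKernel_norm_le hs hq.le) fun h =>
        hq.ne ((diskKernel_norm_eq_one_iff hs hq.le).1 h)
    rwa [norm_exp, Real.exp_lt_one_iff] at h1
  have hΛ0' : (Λ 0 + τ).re < 0 := by rw [add_re, hτre, add_zero]; exact hΛ0
  refine ⟨by rw [hE', h0], FundamentalGroup.fromPath
    (((Path.Homotopic.Quotient.mk c').trans (Path.Homotopic.Quotient.mk ω')).trans
      (Path.Homotopic.Quotient.mk c').symm), ⟨_, hΨ, hΨD, hΨT, ?_, rfl, v', ω', hω', _, rfl⟩,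
      ?_, ?_⟩
  · intro z hz w hw h
    exact hi hz hw (by rw [← hun z, ← hun w]; exact congrArg (unwind s) h)
  · change (((Path.Homotopic.Quotient.mk c').trans (Path.Homotopic.Quotient.mk ω')).trans
      (Path.Homotopic.Quotient.mk c').symm).map (coverMap hs T) =
      g.toPath.trans (((C.trans (Path.Homotopic.Quotient.mk ω)).trans C.symm).trans g.toPath.symm)
    rw [quotient_map_trans, quotient_map_trans, quotient_map_symm, hmap,
      ← Path.Homotopic.Quotient.mk_map, hωω]
    simp only [Path.Homotopic.Quotient.trans_assoc, quotient_trans_symm]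
  · have hcT : cayley (Λ 0 + τ) ∈ coverSet s T := Or.inr (by rw [hun, h0]; exact hqT)
    have hc1 : ‖cayley (Λ 0 + τ)‖ < 1 := (norm_cayley_lt_iff (ne_one_of_re hΛ0'.le)).2 hΛ0'
    change winding _ (((Path.Homotopic.Quotient.mk c').trans (Path.Homotopic.Quotient.mk ω')).trans
      (Path.Homotopic.Quotient.mk c').symm) = _
    rw [winding_conj hc1 hcT, winding_loop hc1 hcT hΨ hΨD hΨT hω']
    rw [dlog_diskKernel_cayley hΛ0' (u := fun t => Λ (circ t) + τ)
      (by have := continuous_circ; fun_prop) (fun t => hre' _) (fun t h => by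
        have h1 := hi (by simp [norm_circ]) (by simp)
          ((hun (circ t)).symm.trans ((congrArg (fun u => unwind s (cayley u)) h).trans (hun 0)))
        exact circ_ne_zero t h1)]
    congr 1
    funext t
    have := halfKernel_add (-I * Λ (circ t)) (-I * Λ 0) (2 * Real.pi * n)
    rw [← this]
    congr 1 <;> · rw [hτ]; push_cast; ring_nf; simp

end LiftLasso

section Words

variable {G ι : Type*} [Group G]

/-- The value of the word `W` in the letters `x`. -/
def evalWord (x : ι → G) (W : List (ι × ℤ)) : G := (W.map fun p => x p.1 ^ p.2).prod

theorem evalWord_cons (x : ι → G) (p : ι × ℤ) (W : List (ι × ℤ)) :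
    evalWord x (p :: W) = x p.1 ^ p.2 * evalWord x W := by simp [evalWord]

open Classical in
/-- The exponent sum of the letter `i` in a word. -/
noncomputable def expSum (i : ι) (W : List (ι × ℤ)) : ℤ :=
  (W.map fun p => if p.1 = i then p.2 else 0).sum

open Classical in
theorem expSum_cons (i : ι) (p : ι × ℤ) (W : List (ι × ℤ)) :
    expSum i (p :: W) = (if p.1 = i then p.2 else 0) + expSum i W := by simp [expSum]

open Classical in
/-- Rewriting `x i₀ ^ n * W` in terms of conjugates of the other letters by powers of `x i₀`. -/
noncomputable def conjWord (i₀ : ι) :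
    ℤ → List (ι × ℤ) → List (({i : ι // i ≠ i₀} × ℤ) × ℤ)
  | _, [] => []
  | n, p :: W => if h : p.1 = i₀ then conjWord i₀ (n + p.2) W
      else ((⟨p.1, h⟩, n), p.2) :: conjWord i₀ n W

theorem evalWord_conjWord (x : ι → G) (i₀ : ι) (n : ℤ) (W : List (ι × ℤ)) :
    x i₀ ^ n * evalWord x W =
      evalWord (fun p : {i : ι // i ≠ i₀} × ℤ => x i₀ ^ p.2 * x p.1 * (x i₀ ^ p.2)⁻¹)
        (conjWord i₀ n W) * x i₀ ^ (n + expSum i₀ W) := by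
  induction W generalizing n with
  | nil => simp [evalWord, conjWord, expSum]
  | cons p W ih =>
    rw [conjWord, evalWord_cons, expSum_cons]
    split_ifs with h
    · rw [h, ← mul_assoc, ← zpow_add, ih, add_assoc]
    · rw [evalWord_cons, mul_assoc, zero_add, ← ih, conj_zpow]
      simp only [mul_assoc, inv_mul_cancel_left]

theorem length_conjWord_le (i₀ : ι) (n : ℤ) (W : List (ι × ℤ)) :
    (conjWord i₀ n W).length ≤ W.length := by
  induction W generalizing n with
  | nil => simp [conjWord]
  | cons p W ih =>
    rw [conjWord]
    split_ifs
    · exact (ih _).trans (by simp)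
    · simpa using ih _

theorem length_conjWord_cons_le (i₀ : ι) (n e : ℤ) (W : List (ι × ℤ)) :
    (conjWord i₀ n ((i₀, e) :: W)).length ≤ W.length := by
  rw [conjWord, dif_pos rfl]
  exact length_conjWord_le _ _ _

open Classical in
theorem sum_conjWord (i₀ : ι) (i : {i : ι // i ≠ i₀}) (n : ℤ) (W : List (ι × ℤ)) :
    ((conjWord i₀ n W).map fun p => if p.1.1 = i then p.2 else 0).sum = expSum i.1 W := by
  induction W generalizing n with
  | nil => simp [conjWord, expSum]
  | cons p W ih =>
    rw [conjWord, expSum_cons]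
    split_ifs with h h1 h1
    · exact absurd (h1.symm.trans h) i.2
    · rw [ih, zero_add]
    · rw [List.map_cons, List.sum_cons, ih, if_pos (Subtype.ext h1)]
    · rw [List.map_cons, List.sum_cons, ih, if_neg fun h2 => h1 (congrArg Subtype.val h2)]

open Classical in
theorem sum_expSum {J : Type*} (i : J) (V : List ((J × ℤ) × ℤ)) (K : Finset ℤ)
    (hK : ∀ p ∈ V, p.1.2 ∈ K) :
    ∑ k ∈ K, expSum (i, k) V = (V.map fun p => if p.1.1 = i then p.2 else 0).sum := by
  induction V with
  | nil => simp [expSum]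
  | cons p V ih =>
    simp only [expSum_cons, Finset.sum_add_distrib, List.map_cons, List.sum_cons]
    rw [ih fun p hp => hK p (List.mem_cons_of_mem _ hp)]
    congr 1
    obtain ⟨⟨j, k⟩, e⟩ := p
    have hk : k ∈ K := hK _ List.mem_cons_self
    by_cases h : j = i
    · simp [h, hk]
    · simp [h]

/-- If the exponent sums of the letters `(i, k)` take a single non-zero value and add up to `0`,
they vanish. -/
theorem expSum_eq_zero {J : Type*} (i : J) (V : List ((J × ℤ) × ℤ))
    (h0 : ∑ k ∈ (V.map fun p => p.1.2).toFinset, expSum (i, k) V = 0)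
    (h : ∀ k k' : ℤ, expSum (i, k) V ≠ 0 → expSum (i, k') V ≠ 0 →
      expSum (i, k) V = expSum (i, k') V) (k : ℤ) : expSum (i, k) V = 0 := by
  classical
  by_contra hk
  set K := (V.map fun p => p.1.2).toFinset with hK
  have hkK : k ∈ K := by
    by_contra hkK
    apply hk
    rw [expSum]
    apply List.sum_eq_zero
    intro e he
    obtain ⟨p, hp, rfl⟩ := List.mem_map.1 he
    rw [if_neg]
    intro h1
    apply hkK
    rw [hK, List.mem_toFinset]
    exact List.mem_map.2 ⟨p, hp, by rw [h1]⟩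
  have hnn : ∀ k' ∈ K, 0 ≤ expSum (i, k') V * expSum (i, k) V := by
    intro k' _
    by_cases h1 : expSum (i, k') V = 0
    · simp [h1]
    · rw [h k' k h1 hk]; exact mul_self_nonneg _
  have h1 := Finset.single_le_sum hnn hkK
  rw [← Finset.sum_mul, h0, zero_mul] at h1
  exact absurd (mul_self_nonneg _ |>.antisymm' h1) (by simpa using hk)

theorem toAdd_evalWord (φ : G →* Multiplicative ℂ) (x : ι → G) (i : ι)
    (h : ∀ j, j ≠ i → (φ (x j)).toAdd = 0) (W : List (ι × ℤ)) :
    (φ (evalWord x W)).toAdd = expSum i W * (φ (x i)).toAdd := by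
  induction W with
  | nil => simp [evalWord, expSum]
  | cons p W ih =>
    rw [evalWord_cons, expSum_cons, map_mul, toAdd_mul, ih, map_zpow, toAdd_zpow]
    split_ifs with h1
    · rw [h1]; push_cast; simp; ring
    · rw [h _ h1]; simp

theorem toAdd_evalWord_eq_zero (φ : G →* Multiplicative ℂ) (x : ι → G)
    (h : ∀ j, (φ (x j)).toAdd = 0) (W : List (ι × ℤ)) :
    (φ (evalWord x W)).toAdd = 0 := by
  induction W with
  | nil => simp [evalWord]
  | cons p W ih =>
    rw [evalWord_cons, map_mul, toAdd_mul, ih, map_zpow, toAdd_zpow, h]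
    simp

theorem exists_evalWord {x : ι → G} {g : G} (hg : g ∈ Subgroup.closure (range x)) :
    ∃ W, evalWord x W = g := by
  induction hg using Subgroup.closure_induction with
  | mem g hg =>
    obtain ⟨i, rfl⟩ := hg
    exact ⟨[(i, 1)], by simp [evalWord]⟩
  | one => exact ⟨[], by simp [evalWord]⟩
  | mul g h _ _ hg hh =>
    obtain ⟨W, rfl⟩ := hg
    obtain ⟨V, rfl⟩ := hh
    exact ⟨W ++ V, by simp [evalWord]⟩
  | inv g _ hg =>
    obtain ⟨W, rfl⟩ := hg
    refine ⟨(W.map fun p => (p.1, -p.2)).reverse, ?_⟩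
    simp [evalWord, List.prod_inv_reverse, Function.comp_def]

end Words

section Main

variable {T : Set ℂ} {s : ℂ}

theorem exists_coverMap_eq (hs : ‖s‖ < 1) (hsT : s ∈ T) (a : PDisk T) :
    ∃ a', coverMap hs T a' = a := by
  have h1 : exp (log (diskKernel s a)) = diskKernel s a :=
    exp_log (PDisk.kernel_ne_zero hs hsT a)
  have h2 : (log (diskKernel s a)).re ≤ 0 := by
    rw [← Real.exp_le_one_iff, ← norm_exp, h1]; exact diskKernel_norm_le hs a.norm_le
  have h3 : unwind s (cayley (log (diskKernel s a))) = a := by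
    rw [unwind, cayley_cayley (ne_one_of_re h2), h1, diskKernel_neg hs a.norm_le]
  refine ⟨⟨cayley (log (diskKernel s a)),
    by simpa using (norm_cayley_le_iff (ne_one_of_re h2)).2 h2, ?_⟩, Subtype.ext h3⟩
  rintro (h | h)
  · exact cayley_ne_one (ne_one_of_re h2) h
  · rw [h3] at h
    exact a.2.2 h

theorem cayley_re_eq_zero_of_norm_coverMap (hs : ‖s‖ < 1) {z : PDisk (coverSet s T)}
    (hz : ‖(coverMap hs T z : ℂ)‖ = 1) : (cayley z).re = 0 := by
  have h := (diskKernel_norm_eq_one_iff hs hz.le).2 hz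
  rwa [diskKernel_coverMap, norm_exp, Real.exp_eq_one_iff] at h

theorem norm_eq_one_of_norm_coverMap (hs : ‖s‖ < 1) {z : PDisk (coverSet s T)}
    (hz : ‖(coverMap hs T z : ℂ)‖ = 1) : ‖(z : ℂ)‖ = 1 := by
  have h := norm_cayley_eq (cayley_re_eq_zero_of_norm_coverMap hs hz)
  rwa [cayley_cayley z.ne_one] at h

theorem cayley_injective {z w : PDisk (coverSet s T)} (h : cayley z = cayley w) : z = w :=
  Subtype.ext (by rw [← cayley_cayley z.ne_one, h, cayley_cayley w.ne_one])

theorem coverMap_eq_of_exp (hs : ‖s‖ < 1) {z w : PDisk (coverSet s T)}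
    (h : exp (cayley z) = exp (cayley w)) : coverMap hs T z = coverMap hs T w :=
  Subtype.ext (by rw [coverMap_coe, coverMap_coe, unwind, h, unwind])

theorem exp_of_shift {u w : ℂ} {k : ℤ} (h : -I * u = -I * w + (2 * Real.pi * k : ℝ)) :
    exp u = exp w := by
  refine exp_eq_exp_iff_exists_int.2 ⟨k, ?_⟩
  have h2 : I * (-I * u) = I * (-I * w + (2 * Real.pi * k : ℝ)) := by rw [h]
  rw [mul_add, ← mul_assoc, ← mul_assoc] at h2
  push_cast at h2
  simp only [mul_neg, I_mul_I, neg_neg, one_mul] at h2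
  rw [h2]; ring

theorem isHalfArc_lift (hs : ‖s‖ < 1) {a b : PDisk (coverSet s T)} {α : Path a b}
    (hα : Function.Injective α) (ha : ‖(coverMap hs T a : ℂ)‖ = 1)
    (hb : ‖(coverMap hs T b : ℂ)‖ = 1) :
    IsHalfArc (fun t => -I * cayley (α.extend t)) (cayley a).im (cayley b).im where
  cont := continuous_const.mul (continuous_cayley
    (continuous_subtype_val.comp α.extend.continuous) fun t => PDisk.ne_one _)
  im_nonneg t := by simpa using PDisk.cayley_re_le (α.extend t)
  injOn := by
    intro t ht u hu h
    have h1 := cayley_injective (mul_left_cancel₀ (by simp) h)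
    rw [Path.extend_apply _ ht, Path.extend_apply _ hu] at h1
    exact congrArg Subtype.val (hα h1)
  zero := by
    have := cayley_re_eq_zero_of_norm_coverMap hs ha
    apply Complex.ext <;> simp [this]
  one := by
    have := cayley_re_eq_zero_of_norm_coverMap hs hb
    apply Complex.ext <;> simp [this]
  clamp t := ⟨_, (projIcc (0 : ℝ) 1 zero_le_one t).2, by simp [Path.extend, IccExtend]⟩

theorem isHalfPair_lift (hs : ‖s‖ < 1) {a b : PDisk (coverSet s T)} {α β : Path a b}
    (hα : Function.Injective fun t => coverMap hs T (α t))
    (hβ : Function.Injective fun t => coverMap hs T (β t))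
    (ha : ‖(coverMap hs T a : ℂ)‖ = 1) (hb : ‖(coverMap hs T b : ℂ)‖ = 1)
    (h : ∀ t u, coverMap hs T (α t) = coverMap hs T (β u) → ‖(coverMap hs T (α t) : ℂ)‖ = 1) :
    IsHalfPair (fun t => -I * cayley (α.extend t)) (fun t => -I * cayley (β.extend t))
      (cayley a).im (cayley b).im := by
  have aux : ∀ γ : Path a b, (Function.Injective fun t => coverMap hs T (γ t)) →
      ∀ t ∈ Icc (0 : ℝ) 1, ∀ u ∈ Icc (0 : ℝ) 1, ∀ k : ℤ, k ≠ 0 →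
      -I * cayley (γ.extend t) ≠ -I * cayley (γ.extend u) + (2 * Real.pi * k : ℝ) := by
    intro γ hγ t ht u hu k hk h1
    have h2 := coverMap_eq_of_exp hs (exp_of_shift h1)
    rw [Path.extend_apply _ ht, Path.extend_apply _ hu] at h2
    have h3 : t = u := congrArg Subtype.val (hγ h2)
    rw [h3, left_eq_add] at h1
    have h4 : (2 * Real.pi * k : ℝ) = 0 := by exact_mod_cast h1
    simp [Real.pi_ne_zero, hk] at h4
  refine ⟨isHalfArc_lift hs (fun t u h => hα (congrArg (coverMap hs T) h)) ha hb,
    isHalfArc_lift hs (fun t u h => hβ (congrArg (coverMap hs T) h)) ha hb, aux α hα, aux β hβ, ?_⟩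
  intro t ht u hu k h1
  have h2 := coverMap_eq_of_exp hs (exp_of_shift h1)
  rw [Path.extend_apply _ ht, Path.extend_apply _ hu] at h2
  have h3 := cayley_re_eq_zero_of_norm_coverMap hs (h _ _ h2)
  simp only [Path.extend_apply _ ht]
  simp [h3]

theorem winding_cayley {l : ℂ} (hl : l.re < 0) (hlT : cayley l ∈ coverSet s T)
    {a b : PDisk (coverSet s T)} (p : Path a b) :
    winding (cayley l) (Path.Homotopic.Quotient.mk p) =
      dlog (fun t => halfKernel (-I * cayley (p.extend t)) (-I * l)) 0 1 := by
  rw [winding_mk ((norm_cayley_lt_iff (ne_one_of_re hl.le)).2 hl) hlT,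
    ← dlog_diskKernel_cayley hl (u := fun t => cayley (p.extend t))
    (continuous_cayley (continuous_subtype_val.comp p.extend.continuous) fun t => PDisk.ne_one _)
    (fun t => PDisk.cayley_re_le _) fun t h => ?_]
  · simp only [fun t => cayley_cayley (PDisk.ne_one (p.extend t))]
  · apply (p.extend t).ne hlT
    rw [← h, cayley_cayley (PDisk.ne_one _)]

/-- The winding differences of two lifted arcs about translates of a puncture agree as soon as
they do not vanish. -/
theorem winding_sub_eq (hs : ‖s‖ < 1) {a b : PDisk (coverSet s T)} {α β : Path a b}
    (hα : Function.Injective fun t => coverMap hs T (α t))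
    (hβ : Function.Injective fun t => coverMap hs T (β t))
    (ha : ‖(coverMap hs T a : ℂ)‖ = 1) (hb : ‖(coverMap hs T b : ℂ)‖ = 1)
    (h : ∀ t u, coverMap hs T (α t) = coverMap hs T (β u) → ‖(coverMap hs T (α t) : ℂ)‖ = 1)
    {l l' : ℂ} {k : ℤ} (hk : l' = l + k * (2 * Real.pi * I)) (hl : l.re < 0)
    (hlT : cayley l ∈ coverSet s T)
    (h1 : winding (cayley l) (Path.Homotopic.Quotient.mk α) -
      winding (cayley l) (Path.Homotopic.Quotient.mk β) ≠ 0)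
    (h2 : winding (cayley l') (Path.Homotopic.Quotient.mk α) -
      winding (cayley l') (Path.Homotopic.Quotient.mk β) ≠ 0) :
    winding (cayley l) (Path.Homotopic.Quotient.mk α) -
      winding (cayley l) (Path.Homotopic.Quotient.mk β) =
    winding (cayley l') (Path.Homotopic.Quotient.mk α) -
      winding (cayley l') (Path.Homotopic.Quotient.mk β) := by
  by_cases hk0 : k = 0
  · rw [hk, hk0]; simp
  have hre : ∀ j : ℤ, (l + j * (2 * Real.pi * I)).re = l.re := fun j => by simp
  have hmem : ∀ j : ℤ, cayley (l + j * (2 * Real.pi * I)) ∈ coverSet s T := by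
    intro j
    have hj := (hre j).trans_lt hl
    rcases hlT with h | h
    · exact absurd h (cayley_ne_one (ne_one_of_re hl.le))
    · right
      rw [unwind, cayley_cayley (ne_one_of_re hl.le)] at h
      rwa [unwind, cayley_cayley (ne_one_of_re hj.le), exp_add, exp_int_mul_two_pi_mul_I, mul_one]
  have hl' : l'.re < 0 := by rw [hk, hre]; exact hl
  have hlT' : cayley l' ∈ coverSet s T := by rw [hk]; exact hmem k
  have hne : a ≠ b := fun hab => by
    have := @hα 0 1 (by simp [hab])
    simp at this
  have hxy : (cayley a).im ≠ (cayley b).im := fun h => hne (cayley_injective (Complex.ext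
    ((cayley_re_eq_zero_of_norm_coverMap hs ha).trans
      (cayley_re_eq_zero_of_norm_coverMap hs hb).symm) h))
  have hshift : ∀ j : ℤ, -I * l + (2 * Real.pi * j : ℝ) = -I * (l + j * (2 * Real.pi * I)) := by
    intro j; push_cast; linear_combination (2 * Real.pi * j : ℂ) * I_mul_I
  have hav : ∀ p : Path a b, ∀ t : ℝ, ∀ j : ℤ,
      -I * cayley (p.extend t) ≠ -I * l + (2 * Real.pi * j : ℝ) := by
    intro p t j h
    rw [hshift] at h
    have h5 := mul_left_cancel₀ (by simp) h
    apply (p.extend t).ne (hmem j)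
    rw [← h5, cayley_cayley (PDisk.ne_one _)]
  simp only [winding_cayley hl hlT, winding_cayley hl' hlT'] at h1 h2 ⊢
  rw [hk, ← hshift] at h2 ⊢
  exact (isHalfPair_lift hs hα hβ ha hb h).dlog_sub_eq hxy (by simpa using hl) (hav α) (hav β) hk0
    (sub_ne_zero.1 h1) (sub_ne_zero.1 h2)

end Main

section Homotopy

variable {T : Set ℂ} {s : ℂ}

/-- The winding about `q` as a homomorphism on the fundamental group. -/
noncomputable def windingHom {q : ℂ} (hq : ‖q‖ < 1) (hT : q ∈ T) (a : PDisk T) :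
    FundamentalGroup (PDisk T) a →* Multiplicative ℂ :=
  logHom (PDisk.continuous_kernel T hq) (PDisk.kernel_ne_zero hq hT) a

theorem toAdd_windingHom {q : ℂ} (hq : ‖q‖ < 1) (hT : q ∈ T) (a : PDisk T)
    (x : FundamentalGroup (PDisk T) a) : (windingHom hq hT a x).toAdd = winding q x.toPath := rfl

theorem exists_winding_eq_int (hs : ‖s‖ < 1) (hsT : s ∈ T) {a : PDisk (coverSet s T)}
    (x : FundamentalGroup (PDisk T) (coverMap hs T a)) :
    ∃ m : ℤ, winding s x.toPath = m * (2 * Real.pi * I) := by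
  obtain ⟨p, hp⟩ := Path.Homotopic.Quotient.mk_surjective x.toPath
  rw [← hp, winding_mk hs hsT]
  have hne := PDisk.kernel_ne_zero hs hsT
  have hc : Continuous fun t => diskKernel s (p.extend t) :=
    (PDisk.continuous_kernel T hs).comp p.extend.continuous
  have h := exp_dlog hc (fun t => hne _) 0 1
  rw [p.extend_one, p.extend_zero, div_self (hne _)] at h
  obtain ⟨n, hn⟩ := exp_eq_one_iff.1 h
  exact ⟨n, hn⟩

theorem map_evalWord {G H ι : Type*} [Group G] [Group H] (φ : G →* H) (x : ι → G)
    (W : List (ι × ℤ)) : φ (evalWord x W) = evalWord (fun i => φ (x i)) W := by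
  induction W with
  | nil => simp [evalWord]
  | cons p W ih => rw [evalWord_cons, evalWord_cons, map_mul, map_zpow, ih]

/-- Lassos about all lifts of the punctures other than `s`. -/
theorem exists_lift_lassos {ι : Type} (q : ι → ℂ) (hqi : Function.Injective q)
    (hq : ∀ i, q i ∈ T ∧ ‖q i‖ < 1) (i₀ : ι) {a : PDisk (coverSet (q i₀) T)}
    (x : ι → FundamentalGroup (PDisk T) (coverMap (hq i₀).2 T a))
    (hx : ∀ i, IsLasso T (coverMap (hq i₀).2 T a) (q i) (x i)) :
    ∃ (l : {i // i ≠ i₀} × ℤ → ℂ) (κ : {i // i ≠ i₀} → ℂ)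
      (y : {i // i ≠ i₀} × ℤ → FundamentalGroup (PDisk (coverSet (q i₀) T)) a),
      (∀ j, (l j).re < 0) ∧ (∀ j, cayley (l j) ∈ coverSet (q i₀) T) ∧
      Function.Injective (fun j => cayley (l j)) ∧
      (∀ i k k', ∃ m : ℤ, l (i, k') = l (i, k) + m * (2 * Real.pi * I)) ∧
      (∀ j, IsLasso (coverSet (q i₀) T) a (cayley (l j)) (y j)) ∧
      (∀ j, FundamentalGroup.map (coverMap (hq i₀).2 T) a (y j) =
        x i₀ ^ j.2 * x j.1 * (x i₀ ^ j.2)⁻¹) ∧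
      ∀ j, winding (cayley (l j)) (y j).toPath = κ j.1 := by
  have hs := (hq i₀).2
  have hsT := (hq i₀).1
  have H := fun i : {i // i ≠ i₀} => (hx i).exists_lift hs hsT (hq i).2 (hq i).1
    (fun h => i.2 (hqi h))
  choose μ κ H using H
  have hE := fun i g => (H i g).1
  have H' := fun (i : {i // i ≠ i₀}) (k : ℤ) => (H i ((x i₀) ^ (-k))).2
  choose y hy1 hy2 hy3 using H'
  obtain ⟨m, hm⟩ := exists_winding_eq_int hs hsT (x i₀)
  have hm0 : m ≠ 0 := by
    rintro rfl
    exact (hx i₀).winding_ne_zero hs hsT (by rw [hm]; simp)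
  have hpow : ∀ k : ℤ, winding (q i₀) ((x i₀) ^ k).toPath = k * m * (2 * Real.pi * I) := by
    intro k
    have h1 := toAdd_windingHom hs hsT _ (x i₀)
    rw [hm] at h1
    have h2 : (windingHom hs hsT _ (x i₀ ^ k)).toAdd = k * m * (2 * Real.pi * I) := by
      rw [map_zpow, toAdd_zpow, h1, zsmul_eq_mul]; ring
    exact h2
  have hre : ∀ i (k : ℤ), (μ i + winding (q i₀) ((x i₀) ^ (-k)).toPath).re < 0 := by
    intro i k
    have h1 : ‖diskKernel (q i₀) (q i)‖ < 1 :=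
      lt_of_le_of_ne (diskKernel_norm_le hs (hq i).2.le) fun h =>
        (hq i).2.ne ((diskKernel_norm_eq_one_iff hs (hq i).2.le).1 h)
    rwa [← hE i, norm_exp, Real.exp_lt_one_iff] at h1
  refine ⟨fun j => μ j.1 + winding (q i₀) ((x i₀) ^ (-j.2)).toPath, κ, fun j => y j.1 j.2,
    fun j => hre j.1 j.2, fun j => Or.inr ?_, ?_, fun i k k' => ⟨(k - k') * m, ?_⟩,
    fun j => hy1 j.1 j.2, fun j => ?_, fun j => hy3 j.1 j.2⟩
  · rw [unwind, cayley_cayley (ne_one_of_re (hre _ _).le), hE, diskKernel_neg hs (hq _).2.le]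
    exact (hq _).1
  · rintro ⟨i, k⟩ ⟨j, k'⟩ h
    have h1 : μ i + winding (q i₀) ((x i₀) ^ (-k)).toPath =
        μ j + winding (q i₀) ((x i₀) ^ (-k')).toPath := by
      rw [← cayley_cayley (ne_one_of_re (hre i k).le), ← cayley_cayley (ne_one_of_re (hre j k').le)]
      exact congrArg cayley h
    have h2 := congrArg exp h1
    rw [hE, hE] at h2
    obtain rfl : i = j := Subtype.ext (hqi (diskKernel_injOn hs (hq _).2.le (hq _).2.le h2))
    have h3 := add_left_cancel h1
    rw [hpow, hpow] at h3
    have h4 := mul_right_cancel₀ two_pi_I_ne_zero h3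
    have h5 := mul_right_cancel₀ (Int.cast_ne_zero.2 hm0) h4
    have h6 : -k = -k' := by exact_mod_cast h5
    rw [neg_inj.1 h6]
  · simp only [hpow]
    push_cast
    ring
  · rw [hy2]
    simp

theorem mk_eq_of_trans_symm {X : Type*} [TopologicalSpace X] {a b : X}
    {P Q : Path.Homotopic.Quotient a b} (h : P.trans Q.symm = Path.Homotopic.Quotient.refl a) :
    P = Q := by
  have := congrArg (fun R => R.trans Q) h
  simpa using this

theorem mk_eq_mk_of_evalWord (n : ℕ) : ∀ (T : Set ℂ) (a b : PDisk T) (α β : Path a b),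
    Function.Injective α → Function.Injective β → ‖(a : ℂ)‖ = 1 → ‖(b : ℂ)‖ = 1 →
    (∀ t u, α t = β u → ‖(α t : ℂ)‖ = 1) →
    (∀ q ∈ T, ‖q‖ < 1 → winding q (Path.Homotopic.Quotient.mk α) =
      winding q (Path.Homotopic.Quotient.mk β)) →
    ∀ (ι : Type) (q : ι → ℂ) (x : ι → FundamentalGroup (PDisk T) a), Function.Injective q →
    (∀ i, q i ∈ T ∧ ‖q i‖ < 1) → (∀ i, IsLasso T a (q i) (x i)) →
    ∀ W : List (ι × ℤ), W.length ≤ n →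
    FundamentalGroup.fromPath ((Path.Homotopic.Quotient.mk α).trans
      (Path.Homotopic.Quotient.mk β).symm) = evalWord x W →
    Path.Homotopic.Quotient.mk α = Path.Homotopic.Quotient.mk β := by
  induction n with
  | zero =>
    intro T a b α β _ _ _ _ _ _ ι q x _ _ _ W hW h
    rw [List.length_eq_zero_iff.1 (Nat.le_zero.1 hW)] at h
    exact mk_eq_of_trans_symm h
  | succ n ih =>
    intro T a b α β hα hβ ha hb hm hw ι q x hqi hq hx W hW h
    obtain _ | ⟨⟨i₀, e⟩, W'⟩ := W
    · exact mk_eq_of_trans_symm h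
    set W := (i₀, e) :: W' with hWdef
    have hs := (hq i₀).2
    have hsT := (hq i₀).1
    obtain ⟨a, rfl⟩ := exists_coverMap_eq hs hsT a
    obtain ⟨b', hb', β', hβ'⟩ := exists_lift_path hs hsT a β
    obtain ⟨b, rfl, α', hα'⟩ := exists_lift_path hs hsT a α
    have hαm : α'.map (coverMap hs T).continuous = α := Path.ext (funext hα')
    obtain rfl : b' = b := by
      have h1 := winding_map_coverMap hs hsT (Path.Homotopic.Quotient.mk α')
      rw [← Path.Homotopic.Quotient.mk_map, hαm, hw _ hsT hs, winding_mk hs hsT] at h1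
      have h2 := winding_map_coverMap hs hsT (Path.Homotopic.Quotient.mk β')
      rw [← Path.Homotopic.Quotient.mk_map, winding_mk hs hsT] at h2
      have h3 : (fun t => diskKernel (q i₀) ((β'.map (coverMap hs T).continuous).extend t)) =
          fun t => diskKernel (q i₀) (β.extend t) :=
        funext fun t => congrArg (fun z : PDisk T => diskKernel (q i₀) z) (hβ' _)
      rw [h3, h1] at h2
      exact cayley_injective (sub_left_injective h2).symm
    have hβm : β'.map (coverMap hs T).continuous = β := Path.ext (funext hβ')
    have hα2 : Function.Injective fun t => coverMap hs T (α' t) := by simpa only [hα'] using hα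
    have hβ2 : Function.Injective fun t => coverMap hs T (β' t) := by simpa only [hβ'] using hβ
    have hm2 : ∀ t u, coverMap hs T (α' t) = coverMap hs T (β' u) →
        ‖(coverMap hs T (α' t) : ℂ)‖ = 1 := by simpa only [hα', hβ'] using hm
    obtain ⟨l, κ, y, hl, hlT, hli, hlk, hly, hyx, hyκ⟩ := exists_lift_lassos q hqi hq i₀ x hx
    have hl1 : ∀ j, ‖cayley (l j)‖ < 1 := fun j =>
      (norm_cayley_lt_iff (ne_one_of_re (hl j).le)).2 (hl j)
    have hexp : ∀ i, expSum i W = 0 := by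
      intro i
      have h1 := toAdd_evalWord (windingHom (hq i).2 (hq i).1 _) x i
        (fun j hj => (hx j).winding_eq_zero (hq i).2 (hq i).1 fun h => hj (hqi h)) W
      rw [← h] at h1
      have h2 : winding (q i) ((Path.Homotopic.Quotient.mk α).trans
          (Path.Homotopic.Quotient.mk β).symm) = expSum i W * winding (q i) (x i).toPath := h1
      rw [winding_trans (hq i).2 (hq i).1, winding_symm (hq i).2 (hq i).1,
        hw _ (hq i).1 (hq i).2, add_neg_cancel] at h2
      rcases mul_eq_zero.1 h2.symm with h3 | h3
      · exact_mod_cast h3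
      · exact absurd h3 ((hx i).winding_ne_zero (hq i).2 (hq i).1)
    set V := conjWord i₀ 0 W with hV
    have hVW : evalWord y V = FundamentalGroup.fromPath ((Path.Homotopic.Quotient.mk α').trans
        (Path.Homotopic.Quotient.mk β').symm) := by
      apply (isCoveringMap_coverMap hs hsT).injective_path_homotopic_map
      have h1 := evalWord_conjWord x i₀ 0 W
      rw [hexp, zpow_zero, one_mul, add_zero, zpow_zero, mul_one, ← h] at h1
      have h2 := map_evalWord (FundamentalGroup.map (coverMap hs T) a) y V
      simp only [hyx] at h2
      rw [← hV] at h1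
      refine Eq.trans (h2.trans h1.symm) ?_
      change _ = ((Path.Homotopic.Quotient.mk α').trans
        (Path.Homotopic.Quotient.mk β').symm).map (coverMap hs T)
      rw [quotient_map_trans, quotient_map_symm, ← Path.Homotopic.Quotient.mk_map,
        ← Path.Homotopic.Quotient.mk_map, hαm, hβm]
    have hdiff : ∀ c (hc : ‖c‖ < 1) (hcT : c ∈ coverSet (q i₀) T),
        winding c (Path.Homotopic.Quotient.mk α') - winding c (Path.Homotopic.Quotient.mk β') =
          (windingHom hc hcT a (evalWord y V)).toAdd := by
      intro c hc hcT
      rw [hVW]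
      refine Eq.trans ?_ (toAdd_windingHom hc hcT _ _).symm
      change _ = winding c ((Path.Homotopic.Quotient.mk α').trans
        (Path.Homotopic.Quotient.mk β').symm)
      rw [winding_trans hc hcT, winding_symm hc hcT, sub_eq_add_neg]
    have hdiffj : ∀ j, winding (cayley (l j)) (Path.Homotopic.Quotient.mk α') -
        winding (cayley (l j)) (Path.Homotopic.Quotient.mk β') = expSum j V * κ j.1 := by
      intro j
      rw [hdiff _ (hl1 j) (hlT j), toAdd_evalWord _ y j fun j' hj' =>
        (hly j').winding_eq_zero (hl1 j) (hlT j) fun h => hj' (hli h), toAdd_windingHom, hyκ]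
    have hκ : ∀ j : {i // i ≠ i₀} × ℤ, κ j.1 ≠ 0 := fun j => by
      rw [← hyκ]; exact (hly j).winding_ne_zero (hl1 j) (hlT j)
    have hzero : ∀ j, expSum j V = 0 := by
      rintro ⟨i, k⟩
      refine expSum_eq_zero i V ?_ ?_ k
      · rw [sum_expSum i V _ fun p hp => by
          rw [List.mem_toFinset]; exact List.mem_map.2 ⟨p, hp, rfl⟩, hV]
        have h1 := (sum_conjWord i₀ i 0 W).trans (hexp i)
        convert h1
      · intro k k' hk hk'
        obtain ⟨m, hm'⟩ := hlk i k k'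
        have h1 := winding_sub_eq hs hα2 hβ2 ha hb hm2 hm' (hl (i, k)) (hlT (i, k))
          (by rw [hdiffj]; exact mul_ne_zero (Int.cast_ne_zero.2 hk) (hκ _))
          (by rw [hdiffj]; exact mul_ne_zero (Int.cast_ne_zero.2 hk') (hκ _))
        rw [hdiffj, hdiffj] at h1
        exact_mod_cast mul_right_cancel₀ (hκ (i, k)) h1
    have key := ih _ a b' α' β' (fun t u h => hα2 (congrArg _ h)) (fun t u h => hβ2 (congrArg _ h))
      (norm_eq_one_of_norm_coverMap hs ha) (norm_eq_one_of_norm_coverMap hs hb)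
      (fun t u h => norm_eq_one_of_norm_coverMap hs (hm2 t u (congrArg _ h)))
      (fun c hcT hc => by
        rw [← sub_eq_zero]
        by_cases hcj : ∃ j, cayley (l j) = c
        · obtain ⟨j, rfl⟩ := hcj
          rw [hdiffj, hzero]; simp
        · rw [hdiff c hc hcT]
          exact toAdd_evalWord_eq_zero _ y (fun j =>
            (hly j).winding_eq_zero hc hcT fun h => hcj ⟨j, h⟩) V)
      _ (fun j => cayley (l j)) y hli (fun j => ⟨hlT j, hl1 j⟩) hly V
      ((length_conjWord_cons_le i₀ 0 e W').trans (by simpa [hWdef] using hW)) hVW.symm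
    rw [← hαm, ← hβm, Path.Homotopic.Quotient.mk_map, key, ← Path.Homotopic.Quotient.mk_map]

end Homotopy

section Generation

/-- Any two paths in `U` with the same endpoints are homotopic in the ambient space. -/
def PathsHomotopicIn {X : Type*} [TopologicalSpace X] (U : Set X) : Prop :=
  ∀ ⦃y z : X⦄ (p q : Path y z), (∀ t, p t ∈ U) → (∀ t, q t ∈ U) → p.Homotopic q

variable {X : Type*} [TopologicalSpace X]

theorem PathsHomotopicIn.mk_eq {U : Set X} (hU : PathsHomotopicIn U) {y z : X} {p q : Path y z}
    (hp : ∀ t, p t ∈ U) (hq : ∀ t, q t ∈ U) :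
    Path.Homotopic.Quotient.mk p = Path.Homotopic.Quotient.mk q :=
  Path.Homotopic.Quotient.eq.2 (hU p q hp hq)

theorem Path.trans_mem {U : Set X} {x y z : X} {p : Path x y} {q : Path y z}
    (hp : ∀ t, p t ∈ U) (hq : ∀ t, q t ∈ U) (t : unitInterval) : p.trans q t ∈ U := by
  have h : p.trans q t ∈ range (p.trans q) := mem_range_self t
  rw [Path.trans_range] at h
  rcases h with ⟨s, hs⟩ | ⟨s, hs⟩
  · exact hs ▸ hp s
  · exact hs ▸ hq s

theorem quotient_symm_cancel {x y z : X} (P : Path.Homotopic.Quotient x y)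
    (Q : Path.Homotopic.Quotient y z) : P.symm.trans (P.trans Q) = Q := by
  rw [← Path.Homotopic.Quotient.trans_assoc, Path.Homotopic.Quotient.symm_trans,
    Path.Homotopic.Quotient.refl_trans]

/-- The class `Q` becomes an element of `H` when its ends are joined to `a` along `base`. -/
def ClosesUpIn {a : X} (H : Subgroup (FundamentalGroup X a))
    (base : ∀ z, Path.Homotopic.Quotient a z) {y z : X} (Q : Path.Homotopic.Quotient y z) : Prop :=
  FundamentalGroup.fromPath (((base y).trans Q).trans (base z).symm) ∈ H

namespace ClosesUpIn

variable {a : X} {H : Subgroup (FundamentalGroup X a)} {base : ∀ z, Path.Homotopic.Quotient a z}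

theorem trans {x y z : X} {P : Path.Homotopic.Quotient x y} {Q : Path.Homotopic.Quotient y z}
    (hP : ClosesUpIn H base P) (hQ : ClosesUpIn H base Q) : ClosesUpIn H base (P.trans Q) := by
  have h := H.mul_mem hQ hP
  rw [FundamentalGroup.mul_def] at h
  unfold ClosesUpIn
  convert h using 1
  change _ = FundamentalGroup.fromPath ((((base x).trans P).trans (base y).symm).trans
    (((base y).trans Q).trans (base z).symm))
  simp only [Path.Homotopic.Quotient.trans_assoc, quotient_symm_cancel]

theorem symm {x y : X} {P : Path.Homotopic.Quotient x y} (hP : ClosesUpIn H base P) :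
    ClosesUpIn H base P.symm := by
  have h := H.inv_mem hP
  rw [FundamentalGroup.inv_def] at h
  unfold ClosesUpIn
  convert h using 1
  change _ = FundamentalGroup.fromPath (((base x).trans P).trans (base y).symm).symm
  simp only [quotient_trans_symm, Path.Homotopic.Quotient.trans_assoc]
  congr 2
  obtain ⟨p, hp⟩ := Path.Homotopic.Quotient.mk_surjective (base y)
  rw [← hp, ← Path.Homotopic.Quotient.mk_symm, ← Path.Homotopic.Quotient.mk_symm, Path.symm_symm]

theorem of_eq {y z : X} {Q : Path.Homotopic.Quotient y z} (h : base z = (base y).trans Q) :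
    ClosesUpIn H base Q := by
  unfold ClosesUpIn
  rw [h, Path.Homotopic.Quotient.trans_symm]
  exact H.one_mem

theorem of_cast {y z y' z' : X} {σ : Path y z} (hy : y' = y) (hz : z' = z)
    (h : ClosesUpIn H base (Path.Homotopic.Quotient.mk (σ.cast hy hz))) :
    ClosesUpIn H base (Path.Homotopic.Quotient.mk σ) := by
  subst hy hz
  exact h

/-- Being in `H` can be checked on the pieces of a path subordinate to an open cover. -/
theorem of_cover {κ : Type*} {W : κ → Set X} (hW : ∀ k, IsOpen (W k)) (hcov : ∀ z, ∃ k, z ∈ W k)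
    (h : ∀ k {y z : X} (σ : Path y z), (∀ t, σ t ∈ W k) →
      ClosesUpIn H base (Path.Homotopic.Quotient.mk σ)) {y z : X} (σ : Path y z) :
    ClosesUpIn H base (Path.Homotopic.Quotient.mk σ) := by
  obtain ⟨t, ht0, htm, ⟨n, hn⟩, ht⟩ := exists_monotone_Icc_subset_open_cover_unitInterval
    (fun k => (hW k).preimage σ.continuous)
    (fun s _ => mem_iUnion.2 (hcov (σ s)))
  have key : ∀ m, ClosesUpIn H base (Path.Homotopic.Quotient.mk (σ.subpath 0 (t m))) := by
    intro m
    induction m with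
    | zero =>
      rw [ht0, Path.subpath_self, Path.Homotopic.Quotient.mk_refl]
      exact of_eq (Path.Homotopic.Quotient.trans_refl _).symm
    | succ m ih =>
      obtain ⟨k, hk⟩ := ht m
      have h1 := ih.trans (h k (σ.subpath (t m) (t (m + 1))) fun s => by
        have h2 : σ.subpath (t m) (t (m + 1)) s ∈ range (σ.subpath (t m) (t (m + 1))) :=
          mem_range_self s
        rw [Path.range_subpath_of_le _ _ _ (htm m.le_succ)] at h2
        obtain ⟨u, hu, hu'⟩ := h2
        rw [← hu']
        exact hk hu)
      rwa [← Path.Homotopic.Quotient.mk_trans, Path.Homotopic.Quotient.eq.2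
        ⟨Path.Homotopy.subpathTransSubpath σ _ _ _⟩] at h1
  have h1 := key n
  rw [hn n le_rfl, Path.subpath_zero_one] at h1
  exact of_cast _ _ h1

end ClosesUpIn

/-- A criterion for generation of the fundamental group: `X` is the union of open sets `U` and
`V i` in which homotopy is trivial, `U` is path connected, and `V i ∩ U` has two path components.
The generators pass through `V i` from one component to the other. -/
theorem closure_range_eq_top {ι : Type*} {a : X} {U : Set X} {V : ι → Set X} {v u : ι → X}
    (hUo : IsOpen U) (hVo : ∀ i, IsOpen (V i)) (hcov : ∀ z, z ∉ U → ∃ i, z ∈ V i)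
    (hdisj : ∀ i j z, z ∉ U → z ∈ V i → z ∈ V j → i = j)
    (hU : PathsHomotopicIn U) (hV : ∀ i, PathsHomotopicIn (V i))
    (hUj : ∀ z ∈ U, JoinedIn U a z) (hVj : ∀ i, ∀ z ∈ V i, JoinedIn (V i) (v i) z)
    (hUV : ∀ i, ∀ z ∈ V i, z ∈ U → JoinedIn (V i ∩ U) (v i) z ∨ JoinedIn (V i ∩ U) (u i) z)
    {x : ι → FundamentalGroup X a}
    (hx : ∀ i, ∃ (α : Path a (v i)) (σ : Path (v i) (u i)) (β : Path a (u i)),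
      (∀ t, α t ∈ U) ∧ (∀ t, σ t ∈ V i) ∧ (∀ t, β t ∈ U) ∧
      x i = FundamentalGroup.fromPath (((Path.Homotopic.Quotient.mk α).trans
        (Path.Homotopic.Quotient.mk σ)).trans (Path.Homotopic.Quotient.mk β).symm)) :
    Subgroup.closure (range x) = ⊤ := by
  classical
  choose α σ β hα hσ hβ hx using hx
  choose i hi using hcov
  set base : ∀ z, Path.Homotopic.Quotient a z := fun z =>
    if h : z ∈ U then Path.Homotopic.Quotient.mk (hUj z h).somePath
    else Path.Homotopic.Quotient.mk ((α (i z h)).trans (hVj _ z (hi z h)).somePath) with hbase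
  have hbU : ∀ {z} (p : Path a z), (∀ t, p t ∈ U) → base z = Path.Homotopic.Quotient.mk p := by
    intro z p hp
    have hz : z ∈ U := by simpa using hp 1
    simp only [hbase, dif_pos hz]
    exact hU.mk_eq (hUj z hz).somePath_mem hp
  set H := Subgroup.closure (range x)
  have goodU : ∀ {y z : X} (τ : Path y z), (∀ t, τ t ∈ U) →
      ClosesUpIn H base (Path.Homotopic.Quotient.mk τ) := by
    intro y z τ hτ
    have hy : y ∈ U := by simpa using hτ 0
    apply ClosesUpIn.of_eq
    rw [hbU _ (hUj y hy).somePath_mem, ← Path.Homotopic.Quotient.mk_trans]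
    exact hbU _ (Path.trans_mem (hUj y hy).somePath_mem hτ)
  have goodσ : ∀ i, ClosesUpIn H base (Path.Homotopic.Quotient.mk (σ i)) := by
    intro i
    unfold ClosesUpIn
    rw [hbU _ (hα i), hbU _ (hβ i), ← hx]
    exact Subgroup.subset_closure (mem_range_self i)
  have goodv : ∀ i, ∀ z ∈ V i, ∃ τ : Path (v i) z, (∀ t, τ t ∈ V i) ∧
      ClosesUpIn H base (Path.Homotopic.Quotient.mk τ) := by
    intro k z hz
    by_cases hzU : z ∈ U
    · rcases hUV k z hz hzU with h | h
      · exact ⟨h.somePath, fun t => (h.somePath_mem t).1, goodU _ fun t => (h.somePath_mem t).2⟩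
      · refine ⟨(σ k).trans h.somePath, Path.trans_mem (hσ k) fun t => (h.somePath_mem t).1, ?_⟩
        rw [Path.Homotopic.Quotient.mk_trans]
        exact (goodσ k).trans (goodU _ fun t => (h.somePath_mem t).2)
    · obtain rfl := hdisj _ k z hzU (hi z hzU) hz
      refine ⟨(hVj _ z (hi z hzU)).somePath, (hVj _ z (hi z hzU)).somePath_mem, ?_⟩
      apply ClosesUpIn.of_eq
      rw [hbU _ (hα _), ← Path.Homotopic.Quotient.mk_trans]
      simp only [hbase, dif_neg hzU]
  have goodV : ∀ i {y z : X} (τ : Path y z), (∀ t, τ t ∈ V i) →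
      ClosesUpIn H base (Path.Homotopic.Quotient.mk τ) := by
    intro i y z τ hτ
    obtain ⟨p, hp, hp'⟩ := goodv i y (by simpa using hτ 0)
    obtain ⟨q, hq, hq'⟩ := goodv i z (by simpa using hτ 1)
    have h := hp'.symm.trans hq'
    rwa [← quotient_symm_cancel (Path.Homotopic.Quotient.mk p) (Path.Homotopic.Quotient.mk τ),
      ← Path.Homotopic.Quotient.mk_trans p τ,
      (hV i).mk_eq (Path.trans_mem hp hτ) hq]
  have good : ∀ {y z : X} (τ : Path y z), ClosesUpIn H base (Path.Homotopic.Quotient.mk τ) := by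
    intro y z τ
    refine ClosesUpIn.of_cover (W := fun k : Option ι => k.elim U V) ?_ ?_ ?_ τ
    · rintro (_ | k)
      exacts [hUo, hVo k]
    · intro z
      by_cases hz : z ∈ U
      · exact ⟨none, hz⟩
      · exact ⟨some (i z hz), hi z hz⟩
    · rintro (_ | k) y z τ hτ
      exacts [goodU τ hτ, goodV k τ hτ]
  rw [eq_top_iff]
  intro g _
  obtain ⟨τ, hτ⟩ := Path.Homotopic.Quotient.mk_surjective
    (((base a).symm.trans (FundamentalGroup.toPath g)).trans (base a))
  have h := good τ
  unfold ClosesUpIn at h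
  rw [hτ] at h
  convert h using 1
  have hg : g = FundamentalGroup.fromPath (FundamentalGroup.toPath g) := rfl
  rw [hg]
  congr 1
  have h1 : ∀ P : Path.Homotopic.Quotient a a, P = ((base a).trans (((base a).symm.trans P).trans
      (base a))).trans (base a).symm := by
    intro P
    simp only [Path.Homotopic.Quotient.trans_assoc, Path.Homotopic.Quotient.trans_symm,
      Path.Homotopic.Quotient.trans_refl]
    rw [← Path.Homotopic.Quotient.trans_assoc, Path.Homotopic.Quotient.trans_symm,
      Path.Homotopic.Quotient.refl_trans]
  exact h1 _

end Generation

section StarConvexSubsets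

variable {T S : Set ℂ}

theorem pathsHomotopicIn_of_starConvex {c : ℂ} (hc : c ∈ S) (hS : StarConvex ℝ c S)
    (hST : S ⊆ ClosedDisk \ T) :
    PathsHomotopicIn ((↑) ⁻¹' S : Set (PDisk T)) := by
  intro y z p q hp hq
  have : ContractibleSpace S := hS.contractibleSpace ⟨c, hc⟩
  let f : C(S, PDisk T) := ⟨Set.inclusion hST, continuous_inclusion hST⟩
  let lift : ∀ r : Path y z, (∀ t, r t ∈ ((↑) ⁻¹' S : Set (PDisk T))) →
      Path (⟨y, by simpa using hp 0⟩ : S) ⟨z, by simpa using hp 1⟩ := fun r hr =>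
    { toFun := fun t => ⟨r t, hr t⟩
      continuous_toFun := by fun_prop
      source' := by simp
      target' := by simp }
  have h := (SimplyConnectedSpace.paths_homotopic (lift p hp) (lift q hq)).map f
  exact h

theorem joinedIn_of_starConvex {c z : PDisk T} (hc : (c : ℂ) ∈ S) (hS : StarConvex ℝ (c : ℂ) S)
    (hST : S ⊆ ClosedDisk \ T) (hz : (z : ℂ) ∈ S) :
    JoinedIn ((↑) ⁻¹' S : Set (PDisk T)) c z := by
  rw [← Topology.IsInducing.subtypeVal.joinedIn_image hc hz, Subtype.image_preimage_coe,
    inter_eq_self_of_subset_right hST]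
  exact JoinedIn.of_segment_subset (hS.segment_subset hz)

end StarConvexSubsets

/-- A path can be cut into three pieces. -/
theorem Path.exists_mk_eq_trans {X : Type*} [TopologicalSpace X] {a b : X} (γ : Path a b)
    {t₁ t₂ : unitInterval} (h : t₁ ≤ t₂) :
    ∃ (p : Path a (γ t₁)) (q : Path (γ t₁) (γ t₂)) (r : Path (γ t₂) b),
      (∀ t, p t ∈ γ '' Icc 0 t₁) ∧ (∀ t, q t ∈ γ '' Icc t₁ t₂) ∧ (∀ t, r t ∈ γ '' Icc t₂ 1) ∧
      Path.Homotopic.Quotient.mk γ = ((Path.Homotopic.Quotient.mk p).trans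
        (Path.Homotopic.Quotient.mk q)).trans (Path.Homotopic.Quotient.mk r) := by
  have hsub : ∀ {s t : unitInterval}, s ≤ t → ∀ u, γ.subpath s t u ∈ γ '' Icc s t := by
    intro s t hst u
    rw [← Path.range_subpath_of_le _ _ _ hst]
    exact mem_range_self u
  have hcast : ∀ {x y x' y' : X} (p q : Path x y) (hx : x' = x) (hy : y' = y),
      p.Homotopic q → (p.cast hx hy).Homotopic (q.cast hx hy) := by
    intro x y x' y' p q hx hy
    subst hx hy
    exact id
  refine ⟨(γ.subpath 0 t₁).cast γ.source.symm rfl, γ.subpath t₁ t₂,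
    (γ.subpath t₂ 1).cast rfl γ.target.symm, hsub t₁.2.1, hsub h, hsub t₂.2.2, ?_⟩
  rw [← Path.Homotopic.Quotient.mk_trans, ← Path.Homotopic.Quotient.mk_trans,
    Path.Homotopic.Quotient.eq]
  have h1 : (((γ.subpath 0 t₁).trans (γ.subpath t₁ t₂)).trans (γ.subpath t₂ 1)).Homotopic
      (γ.subpath 0 1) := by
    have h2 : ((γ.subpath 0 t₁).trans (γ.subpath t₁ t₂)).Homotopic (γ.subpath 0 t₂) :=
      ⟨Path.Homotopy.subpathTransSubpath γ _ _ _⟩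
    exact (h2.hcomp (Path.Homotopic.refl _)).trans ⟨Path.Homotopy.subpathTransSubpath γ _ _ _⟩
  rw [Path.subpath_zero_one] at h1
  exact (hcast _ _ γ.source.symm γ.target.symm h1).symm

theorem finite_setOf_quadratic (A : ℝ) {B E : ℝ} (h : B ≠ 0 ∨ E ≠ 0) :
    {t : ℝ | A + B * t ^ 2 - E * t = 0}.Finite := by
  set f : Polynomial ℝ := Polynomial.C A + Polynomial.C B * Polynomial.X ^ 2 -
    Polynomial.C E * Polynomial.X with hf
  have hf0 : f ≠ 0 := by
    intro h0
    have h1 := congrArg (fun g => Polynomial.coeff g 1) h0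
    have h2 := congrArg (fun g => Polynomial.coeff g 2) h0
    simp [hf, Polynomial.coeff_C, Polynomial.coeff_X_pow] at h1 h2
    tauto
  refine f.roots.toFinset.finite_toSet.subset ?_
  intro t ht
  rw [mem_ofPred_eq] at ht
  simp only [Finset.mem_coe, Multiset.mem_toFinset, Polynomial.mem_roots hf0]
  simpa [hf, Polynomial.IsRoot] using ht

/-- There is a point of the open disk seeing the points of a finite set in pairwise different
directions. -/
theorem exists_generic_center {T : Set ℂ} (hT : T.Finite) :
    ∃ o : ℂ, ‖o‖ < 1 ∧ (∀ p ∈ T, p ≠ o) ∧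
      ∀ p ∈ T, ∀ p' ∈ T, p ≠ p' → ((p' - o) / (p - o)).im ≠ 0 := by
  have hfin : (⋃ p ∈ T, ⋃ p' ∈ T, {t : ℝ | t = p.re ∨ (p ≠ p' ∧
      (p' * conj p).im + (p' - p).re * t ^ 2 - (p' - p).im * t = 0)}).Finite := by
    refine hT.biUnion fun p _ => hT.biUnion fun p' _ => ?_
    refine (finite_singleton p.re).union ?_
    by_cases hpp : p = p'
    · exact Set.finite_empty.subset fun t ht => ht.1 hpp
    refine (finite_setOf_quadratic (p' * conj p).im (B := (p' - p).re) (E := (p' - p).im)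
      ?_).subset fun t ht => ht.2
    by_contra! h
    exact hpp (sub_eq_zero.1 (Complex.ext h.1 h.2)).symm
  obtain ⟨t, ht, hbad⟩ :=
    (Ioo_infinite (show (0 : ℝ) < 1 / 2 by norm_num)).exists_notMem_finite hfin
  have hbad' : ∀ p ∈ T, ∀ p' ∈ T, ¬ (t = p.re ∨ (p ≠ p' ∧
      (p' * conj p).im + (p' - p).re * t ^ 2 - (p' - p).im * t = 0)) := by
    simpa only [mem_iUnion, exists_prop, mem_ofPred_eq, not_exists, not_and] using hbad
  have hne : ∀ p ∈ T, p ≠ (⟨t, t ^ 2⟩ : ℂ) := by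
    rintro p hp rfl
    exact hbad' _ hp _ hp (Or.inl rfl)
  refine ⟨⟨t, t ^ 2⟩, ?_, hne, ?_⟩
  · rw [← sq_lt_one_iff₀ (norm_nonneg _), ← normSq_eq_norm_sq, normSq_apply]
    have := ht.1; have := ht.2
    simp only
    nlinarith [mul_pos ht.1 ht.1, show t ^ 2 < 1 / 4 by nlinarith]
  · intro p hp p' hp' hpp h
    apply hbad' p hp p' hp'
    refine Or.inr ⟨hpp, ?_⟩
    have h1 : normSq (p - ⟨t, t ^ 2⟩) ≠ 0 := by
      rw [Ne, normSq_eq_zero, sub_eq_zero]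
      exact hne p hp
    rw [div_im, ← sub_div, div_eq_zero_iff, or_iff_left h1] at h
    simp at h ⊢
    linarith

section Cuts

variable {T : Set ℂ} {o : ℂ} {δ : ℝ}

/-- The complement of the radial cuts from the points of `T` away from `o`. -/
def cutDisk (T : Set ℂ) (o : ℂ) : Set ℂ :=
  {z | ‖z‖ ≤ 1 ∧ ∀ p ∈ T, 1 - (z - o) / (p - o) ∈ slitPlane}

/-- A thin sector behind `p` as seen from `o`. -/
def cutSector (o : ℂ) (δ : ℝ) (p : ℂ) : Set ℂ :=
  {z | ‖z‖ ≤ 1 ∧ 1 < ((z - o) / (p - o)).re ∧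
    |((z - o) / (p - o)).im| < δ * ((z - o) / (p - o)).re}

theorem convexComb_sub_div (o p z w : ℂ) {s t : ℝ} (h : s + t = 1) :
    (s • z + t • w - o) / (p - o) = s • ((z - o) / (p - o)) + t • ((w - o) / (p - o)) := by
  have h' : (t : ℂ) = 1 - s := by rw [← ofReal_one, ← h]; push_cast; ring
  simp only [real_smul, h']
  ring

theorem norm_convexComb_le {z w : ℂ} (hz : ‖z‖ ≤ 1) (hw : ‖w‖ ≤ 1) {s t : ℝ} (hs : 0 ≤ s)
    (ht : 0 ≤ t) (h : s + t = 1) : ‖s • z + t • w‖ ≤ 1 := by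
  have := (convex_closedBall (0 : ℂ) 1) (mem_closedBall_zero_iff.2 hz)
    (mem_closedBall_zero_iff.2 hw) hs ht h
  simpa using this

theorem center_mem_cutDisk (ho : ‖o‖ < 1) : o ∈ cutDisk T o := by
  simp [cutDisk, ho.le]

theorem starConvex_cutDisk (ho : ‖o‖ < 1) : StarConvex ℝ o (cutDisk T o) := by
  intro z hz s t hs ht hst
  refine ⟨norm_convexComb_le ho.le hz.1 hs ht hst, fun p hp => ?_⟩
  rw [convexComb_sub_div o p o z hst]
  have := starConvex_one_slitPlane (hz.2 p hp) hs ht hst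
  convert this using 1
  have h' : (t : ℂ) = 1 - s := by rw [← ofReal_one, ← hst]; push_cast; ring
  simp only [real_smul, h']
  simp
  ring

theorem cutDisk_subset (hne : ∀ p ∈ T, p ≠ o) : cutDisk T o ⊆ ClosedDisk \ T := by
  intro z hz
  refine ⟨by simpa using hz.1, fun h => ?_⟩
  have := hz.2 z h
  rw [div_self (sub_ne_zero.2 (hne z h)), sub_self] at this
  exact slitPlane_ne_zero this rfl

theorem mul_add_mul_pos_of_convexComb {x y s t : ℝ} (hx : 0 < x) (hy : 0 < y) (hs : 0 ≤ s)
    (ht : 0 ≤ t) (h : s + t = 1) : 0 < s * x + t * y := by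
  rcases hs.eq_or_lt with rfl | hs
  · simp_all
  · positivity

theorem convex_cutSector (p : ℂ) : Convex ℝ (cutSector o δ p) := by
  intro z hz w hw s t hs ht hst
  refine ⟨norm_convexComb_le hz.1 hw.1 hs ht hst, ?_⟩
  rw [convexComb_sub_div o p z w hst]
  simp only [add_re, add_im, real_smul, re_ofReal_mul, im_ofReal_mul]
  obtain ⟨-, h1, h2⟩ := hz
  obtain ⟨-, h3, h4⟩ := hw
  rw [abs_lt] at h2 h4 ⊢
  have e1 := mul_add_mul_pos_of_convexComb (sub_pos.2 h1) (sub_pos.2 h3) hs ht hst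
  have e2 := mul_add_mul_pos_of_convexComb (sub_pos.2 h2.1) (sub_pos.2 h4.1) hs ht hst
  have e3 := mul_add_mul_pos_of_convexComb (sub_pos.2 h2.2) (sub_pos.2 h4.2) hs ht hst
  exact ⟨by linarith, by linarith, by linarith⟩

/-- The sector of `p` meets only the cut of `p`. -/
theorem eq_of_mem_cutSector (hne : ∀ p ∈ T, p ≠ o)
    (hδ : ∀ p ∈ T, ∀ p' ∈ T, p ≠ p' →
      δ * |((p' - o) / (p - o)).re| < |((p' - o) / (p - o)).im|) (hδ0 : 0 < δ)
    {p p' z : ℂ} (hp : p ∈ T) (hp' : p' ∈ T) (hz : z ∈ cutSector o δ p)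
    (hz' : 1 - (z - o) / (p' - o) ∉ slitPlane) : p = p' := by
  by_contra hpp
  rw [mem_slitPlane_iff, not_or, not_lt, not_not] at hz'
  set r : ℝ := ((z - o) / (p' - o)).re with hr
  have h0 : ((z - o) / (p' - o)).im = 0 := by simpa using hz'.2
  have hr1 : 0 < r := by
    have := hz'.1
    simp only [sub_re, one_re] at this
    linarith
  have h1 : (z - o) / (p' - o) = r := Complex.ext rfl (by rw [h0, ofReal_im])
  have h2 : (z - o) / (p - o) = r * ((p' - o) / (p - o)) := by
    rw [← h1]
    have := sub_ne_zero.2 (hne p' hp')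
    field_simp
  have h3 := hz.2.2
  rw [h2, im_ofReal_mul, re_ofReal_mul, abs_mul, abs_of_pos hr1] at h3
  have h4 := mul_lt_mul_of_pos_left (hδ p hp p' hp' hpp) hr1
  have h5 := mul_le_mul_of_nonneg_left (le_abs_self ((p' - o) / (p - o)).re) (mul_pos hr1 hδ0).le
  linarith

theorem not_mem_slitPlane_self {p : ℂ} (h : p ≠ o) : 1 - (p - o) / (p - o) ∉ slitPlane := by
  rw [div_self (sub_ne_zero.2 h), sub_self]
  exact fun h => slitPlane_ne_zero h rfl

theorem cutSector_subset (hne : ∀ p ∈ T, p ≠ o)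
    (hδ : ∀ p ∈ T, ∀ p' ∈ T, p ≠ p' →
      δ * |((p' - o) / (p - o)).re| < |((p' - o) / (p - o)).im|) (hδ0 : 0 < δ)
    {p : ℂ} (hp : p ∈ T) : cutSector o δ p ⊆ ClosedDisk \ T := by
  intro z hz
  refine ⟨by simpa using hz.1, fun h => ?_⟩
  obtain rfl := eq_of_mem_cutSector hne hδ hδ0 hp h hz (not_mem_slitPlane_self (hne z h))
  have := hz.2.1
  rw [div_self (sub_ne_zero.2 (hne _ h))] at this
  simp at this

theorem exists_mem_cutSector (hδ0 : 0 < δ) (z : PDisk T) (hne : ∀ p ∈ T, p ≠ o)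
    (hz : (z : ℂ) ∉ cutDisk T o) : ∃ p ∈ T, (z : ℂ) ∈ cutSector o δ p := by
  simp only [cutDisk, mem_ofPred_eq, PDisk.norm_le, true_and, not_forall] at hz
  obtain ⟨p, hp, hz⟩ := hz
  refine ⟨p, hp, PDisk.norm_le z, ?_⟩
  rw [mem_slitPlane_iff, not_or, not_lt, not_not] at hz
  simp only [sub_re, one_re, sub_im, one_im, zero_sub, neg_eq_zero] at hz
  have h1 : ((z - o) / (p - o)).re ≠ 1 := by
    intro h
    have h2 : ((z : ℂ) - o) / (p - o) = 1 := Complex.ext h hz.2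
    rw [div_eq_one_iff_eq (sub_ne_zero.2 (hne p hp)), sub_left_inj] at h2
    exact PDisk.ne z hp h2
  have h2 : 1 < ((z - o) / (p - o)).re := lt_of_le_of_ne (by linarith [hz.1]) h1.symm
  refine ⟨h2, ?_⟩
  rw [hz.2, abs_zero]
  positivity

theorem isOpen_cutDisk (hT : T.Finite) (o : ℂ) :
    IsOpen ((↑) ⁻¹' cutDisk T o : Set (PDisk T)) := by
  have h : ((↑) : PDisk T → ℂ) ⁻¹' cutDisk T o =
      ⋂ p ∈ T, {z : PDisk T | 1 - ((z : ℂ) - o) / (p - o) ∈ slitPlane} := by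
    ext z
    simp [cutDisk, PDisk.norm_le z]
  rw [h]
  exact hT.isOpen_biInter fun p _ => isOpen_slitPlane.preimage (by fun_prop)

theorem isOpen_cutSector (o : ℂ) (δ : ℝ) (p : ℂ) :
    IsOpen ((↑) ⁻¹' cutSector o δ p : Set (PDisk T)) := by
  have h : ((↑) : PDisk T → ℂ) ⁻¹' cutSector o δ p =
      {z : PDisk T | 1 < (((z : ℂ) - o) / (p - o)).re} ∩
      {z : PDisk T | |(((z : ℂ) - o) / (p - o)).im| < δ * (((z : ℂ) - o) / (p - o)).re} := by
    ext z
    simp [cutSector, PDisk.norm_le z]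
  rw [h]
  exact (isOpen_lt (by fun_prop) (by fun_prop)).inter (isOpen_lt (by fun_prop) (by fun_prop))

/-- The sector minus the cut has two path components. -/
theorem joinedIn_cutSector (hne : ∀ p ∈ T, p ≠ o)
    (hδ : ∀ p ∈ T, ∀ p' ∈ T, p ≠ p' →
      δ * |((p' - o) / (p - o)).re| < |((p' - o) / (p - o)).im|) (hδ0 : 0 < δ)
    {p : ℂ} (hp : p ∈ T) {v z : PDisk T} (hv : (v : ℂ) ∈ cutSector o δ p)
    (hz : (z : ℂ) ∈ cutSector o δ p)
    (h : 0 < ((v - o) / (p - o)).im * ((z - o) / (p - o)).im) :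
    JoinedIn ((↑) ⁻¹' cutSector o δ p ∩ (↑) ⁻¹' cutDisk T o : Set (PDisk T)) v z := by
  set e : ℝ := ((v - o) / (p - o)).im with he
  have he0 : e ≠ 0 := left_ne_zero_of_mul h.ne'
  set S : Set ℂ := cutSector o δ p ∩ {z | 0 < e * ((z - o) / (p - o)).im} with hS
  have hSc : Convex ℝ S := by
    refine (convex_cutSector p).inter ?_
    intro z hz w hw s t hs ht hst
    simp only [mem_ofPred_eq] at hz hw ⊢
    rw [convexComb_sub_div o p z w hst]
    simp only [add_im, real_smul, im_ofReal_mul]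
    have := mul_add_mul_pos_of_convexComb hz hw hs ht hst
    linarith
  have hSs : S ⊆ ClosedDisk \ T := fun z hz => cutSector_subset hne hδ hδ0 hp hz.1
  have hvS : (v : ℂ) ∈ S := ⟨hv, mul_self_pos.2 he0⟩
  refine (joinedIn_of_starConvex hvS (hSc.starConvex hvS) hSs ⟨hz, h⟩).mono ?_
  intro w hw
  refine ⟨hw.1, PDisk.norm_le w, fun p' hp' => ?_⟩
  by_contra h1
  obtain rfl := eq_of_mem_cutSector hne hδ hδ0 hp hp' hw.1 h1
  rw [mem_slitPlane_iff, not_or, not_lt, not_not] at h1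
  have h2 : ((w - o) / (p - o)).im = 0 := by simpa using h1.2
  have h3 := hw.2
  simp [h2] at h3

end Cuts

section Generators

variable {T : Set ℂ} {o : ℂ} {δ : ℝ}

/-- The radial retraction of the plane onto the closed unit disk. -/
noncomputable def toDisk (z : ℂ) : ℂ := z / (max 1 ‖z‖ : ℝ)

theorem continuous_toDisk : Continuous toDisk := by
  unfold toDisk
  refine continuous_id.div (by fun_prop) fun z => ?_
  have : (0 : ℝ) < max 1 ‖z‖ := by positivity
  exact_mod_cast this.ne'

theorem norm_toDisk_le (z : ℂ) : ‖toDisk z‖ ≤ 1 := by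
  have : (0 : ℝ) < max 1 ‖z‖ := by positivity
  rw [toDisk, norm_div, norm_real, Real.norm_of_nonneg this.le, div_le_one this]
  exact le_max_right _ _

theorem toDisk_of_norm_le {z : ℂ} (h : ‖z‖ ≤ 1) : toDisk z = z := by simp [toDisk, h]

theorem toDisk_ne_zero {z : ℂ} (h : z ≠ 0) : toDisk z ≠ 0 := by
  have : (0 : ℝ) < max 1 ‖z‖ := by positivity
  exact div_ne_zero h (by exact_mod_cast this.ne')

theorem toDisk_circ (t : ℝ) : toDisk (circ t) = circ t := toDisk_of_norm_le (norm_circ t).le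

theorem circ_im (t : ℝ) : (circ t).im = Real.sin (2 * Real.pi * t) := by
  rw [circ, show (2 * Real.pi * t * I : ℂ) = ((2 * Real.pi * t : ℝ) : ℂ) * I by push_cast; ring,
    exp_ofReal_mul_I_im]

theorem circ_im_pos {t : ℝ} (h0 : 0 < t) (h1 : t < 1 / 2) : 0 < (circ t).im := by
  rw [circ_im]
  apply Real.sin_pos_of_pos_of_lt_pi <;> nlinarith [Real.pi_pos]

theorem circ_im_neg {t : ℝ} (h0 : 1 / 2 < t) (h1 : t < 1) : (circ t).im < 0 := by
  have h := circ_half (t - 1 / 2)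
  rw [sub_add_cancel] at h
  rw [h, neg_im, neg_lt_zero]
  exact circ_im_pos (by linarith) (by linarith)

theorem circ_mem_slitPlane {t : ℝ} (h0 : 0 ≤ t) (h1 : t ≤ 1) (h : t ≠ 1 / 2) :
    circ t ∈ slitPlane := by
  rcases h0.eq_or_lt with rfl | h0
  · rw [circ_zero]; exact one_mem_slitPlane
  rcases h1.eq_or_lt with rfl | h1
  · rw [circ_one]; exact one_mem_slitPlane
  rw [mem_slitPlane_iff]
  right
  rcases h.lt_or_gt with h | h
  · exact (circ_im_pos h0 h).ne'
  · exact (circ_im_neg h h1).ne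

/-- A small circle around `p`, cut into pieces by a sector. -/
theorem exists_lasso_through_sector (hT : T.Finite) (hT1 : ∀ p ∈ T, ‖p‖ < 1)
    (hne : ∀ p ∈ T, p ≠ o)
    (him : ∀ p ∈ T, ∀ p' ∈ T, p ≠ p' → ((p' - o) / (p - o)).im ≠ 0) (hδ0 : 0 < δ)
    {a : PDisk T}
    (haj : ∀ z : PDisk T, (z : ℂ) ∈ cutDisk T o →
      JoinedIn ((↑) ⁻¹' cutDisk T o : Set (PDisk T)) a z)
    {p : ℂ} (hp : p ∈ T) :
    ∃ (v u : PDisk T) (x : FundamentalGroup (PDisk T) a), IsLasso T a p x ∧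
      ((v : ℂ) ∈ cutSector o δ p ∧ ((v - o) / (p - o)).im < 0) ∧
      ((u : ℂ) ∈ cutSector o δ p ∧ 0 < ((u - o) / (p - o)).im) ∧
      ∃ (α : Path a v) (σ : Path v u) (β : Path a u),
        (∀ t, (α t : ℂ) ∈ cutDisk T o) ∧ (∀ t, (σ t : ℂ) ∈ cutSector o δ p) ∧
        (∀ t, (β t : ℂ) ∈ cutDisk T o) ∧
        x = FundamentalGroup.fromPath (((Path.Homotopic.Quotient.mk α).trans
          (Path.Homotopic.Quotient.mk σ)).trans (Path.Homotopic.Quotient.mk β).symm) := by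
  have hpo : p - o ≠ 0 := sub_ne_zero.2 (hne p hp)
  have hO : IsOpen (Metric.ball (0 : ℂ) 1 ∩
      ⋂ p' ∈ T \ {p}, {z | 1 - (z - o) / (p' - o) ∈ slitPlane}) :=
    Metric.isOpen_ball.inter <| (hT.subset sdiff_subset).isOpen_biInter fun p' _ =>
      isOpen_slitPlane.preimage (by fun_prop)
  have hpO : p ∈ Metric.ball (0 : ℂ) 1 ∩
      ⋂ p' ∈ T \ {p}, {z | 1 - (z - o) / (p' - o) ∈ slitPlane} := by
    refine ⟨by simpa using hT1 p hp, mem_iInter₂.2 fun p' hp' => ?_⟩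
    rw [mem_ofPred_eq, mem_slitPlane_iff]
    right
    simpa using him p' hp'.1 p hp hp'.2
  obtain ⟨r, hr, hrO⟩ := Metric.isOpen_iff.1 hO p hpO
  obtain ⟨R, hR0, hR⟩ : ∃ R : ℝ, 0 < R ∧ R * ‖p - o‖ < r :=
    ⟨r / (2 * ‖p - o‖), by positivity, by field_simp; norm_num⟩
  set ψ : ℂ → ℂ := fun z => p - R * (p - o) * toDisk z with hψ
  have hψF : ∀ z, (ψ z - o) / (p - o) = 1 - R * toDisk z := by
    intro z
    simp only [hψ]
    field_simp
    ring
  have hψO : ∀ z, ψ z ∈ Metric.ball (0 : ℂ) 1 ∩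
      ⋂ p' ∈ T \ {p}, {z | 1 - (z - o) / (p' - o) ∈ slitPlane} := by
    intro z
    apply hrO
    rw [Metric.mem_ball, dist_eq_norm, hψ]
    simp only [sub_sub_cancel_left, norm_neg, norm_mul, norm_real, Real.norm_of_nonneg hR0.le]
    exact (mul_le_of_le_one_right (by positivity) (norm_toDisk_le z)).trans_lt hR
  have hψ1 : ∀ z, ‖ψ z‖ ≤ 1 := fun z => by simpa using (Metric.ball_subset_closedBall (hψO z).1)
  have hψs : ∀ z, ∀ p' ∈ T, p' ≠ p → 1 - (ψ z - o) / (p' - o) ∈ slitPlane := fun z p' hp' h =>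
    mem_iInter₂.1 (hψO z).2 p' ⟨hp', h⟩
  have hRp : (R : ℂ) * (p - o) ≠ 0 := mul_ne_zero (ofReal_ne_zero.2 hR0.ne') hpo
  have hψT : ∀ z, z ≠ 0 → ψ z ∉ T := by
    intro z hz h
    by_cases hzp : ψ z = p
    · rw [hψ, sub_eq_self] at hzp
      exact mul_ne_zero hRp (toDisk_ne_zero hz) hzp
    · exact not_mem_slitPlane_self (hne _ h) (hψs z _ h hzp)
  have hψc : Continuous ψ := by
    have := continuous_toDisk
    fun_prop
  have hψi : InjOn ψ (Metric.closedBall 0 1) := by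
    intro z hz w hw h
    rw [mem_closedBall_zero_iff] at hz hw
    simpa [hψ, hRp, toDisk_of_norm_le hz, toDisk_of_norm_le hw, hR0.ne', hpo] using h
  have hU : ∀ t : ℝ, 0 ≤ t → t ≤ 1 → t ≠ 1 / 2 → ψ (circ t) ∈ cutDisk T o := by
    intro t h0 h1 ht
    refine ⟨hψ1 _, fun p' hp' => ?_⟩
    by_cases h : p' = p
    · rw [h, hψF, toDisk_circ, sub_sub_cancel]
      have h2 := circ_mem_slitPlane h0 h1 ht
      rw [mem_slitPlane_iff] at h2 ⊢
      rw [re_ofReal_mul, im_ofReal_mul]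
      exact h2.imp (fun h => mul_pos hR0 h) fun h => mul_ne_zero hR0.ne' h
    · exact hψs _ _ hp' h
  obtain ⟨ε, hε0, hε1, hε⟩ : ∃ ε : ℝ, 0 < ε ∧ ε < 1 / 2 ∧ ∀ t ∈ Icc (1 / 2 - ε) (1 / 2 + ε),
      ψ (circ t) ∈ cutSector o δ p := by
    have hc1 : circ (1 / 2) = -1 := by simpa [circ_zero] using circ_half 0
    have hopen : IsOpen ({t : ℝ | 1 < ((ψ (circ t) - o) / (p - o)).re} ∩
        {t | |((ψ (circ t) - o) / (p - o)).im| < δ * ((ψ (circ t) - o) / (p - o)).re}) := by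
      have := continuous_circ
      exact (isOpen_lt (by fun_prop) (by fun_prop)).inter (isOpen_lt (by fun_prop) (by fun_prop))
    obtain ⟨e, he, hsub⟩ := Metric.isOpen_iff.1 hopen (1 / 2) (by
      simp only [mem_inter_iff, mem_ofPred_eq, hψF, toDisk_circ, hc1]
      simp
      exact ⟨hR0, by positivity⟩)
    refine ⟨min (e / 2) (1 / 4), by positivity, (min_le_right _ _).trans_lt (by norm_num),
      fun t ht => ⟨hψ1 _, ?_⟩⟩
    apply hsub
    rw [Metric.mem_ball, Real.dist_eq, abs_lt]
    have := min_le_left (e / 2) (1 / 4)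
    constructor <;> linarith [ht.1, ht.2]
  let w : PDisk T := ⟨ψ (circ 0), by simpa using hψ1 _, hψT _ (circ_ne_zero _)⟩
  let ω : Path w w :=
    { toFun := fun t => ⟨ψ (circ t), by simpa using hψ1 _, hψT _ (circ_ne_zero _)⟩
      continuous_toFun := by
        have := continuous_circ
        fun_prop
      source' := Subtype.ext (by simp [w])
      target' := Subtype.ext (by simp [w, circ_zero, circ_one]) }
  have hω : ∀ t : unitInterval, (ω t : ℂ) = ψ (circ t) := fun t => rfl
  have hwU : (w : ℂ) ∈ cutDisk T o := hU 0 le_rfl zero_le_one (by norm_num)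
  set c := (haj w hwU).somePath
  have hc : ∀ t, (c t : ℂ) ∈ cutDisk T o := (haj w hwU).somePath_mem
  let t₁ : unitInterval := ⟨1 / 2 - ε, by linarith, by linarith⟩
  let t₂ : unitInterval := ⟨1 / 2 + ε, by linarith, by linarith⟩
  obtain ⟨p₁, p₂, p₃, h₁, h₂, h₃, hmk⟩ := ω.exists_mk_eq_trans
    (show t₁ ≤ t₂ from Subtype.coe_le_coe.1 (show 1 / 2 - ε ≤ 1 / 2 + ε by linarith))
  have hF : ∀ t : unitInterval, ((ω t - o) / (p - o)).im = - (R * (circ t).im) := by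
    intro t
    rw [hω, hψF, toDisk_circ, sub_im, one_im, im_ofReal_mul, zero_sub]
  refine ⟨ω t₁, ω t₂, FundamentalGroup.fromPath (((Path.Homotopic.Quotient.mk c).trans
    (Path.Homotopic.Quotient.mk ω)).trans (Path.Homotopic.Quotient.mk c).symm),
    ⟨ψ, hψc, fun z => by simpa using hψ1 z, hψT, hψi, by simp [hψ, toDisk], w, ω, hω, _, rfl⟩,
    ⟨hε (1 / 2 - ε) ⟨le_rfl, by linarith⟩, ?_⟩, ⟨hε (1 / 2 + ε) ⟨by linarith, le_rfl⟩, ?_⟩,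
    c.trans p₁, p₂, c.trans p₃.symm, ?_, ?_, ?_, ?_⟩
  · rw [hF, neg_lt_zero]
    exact mul_pos hR0 (circ_im_pos (by simpa [t₁] using hε1) (by simpa [t₁] using hε0))
  · rw [hF, neg_pos]
    exact mul_neg_of_pos_of_neg hR0 (circ_im_neg (by simpa [t₂] using hε0)
      (by simp only [t₂]; linarith))
  · refine Path.trans_mem (U := ((↑) ⁻¹' cutDisk T o : Set (PDisk T))) hc fun t => ?_
    obtain ⟨s, hs, hs'⟩ := h₁ t
    rw [← hs']
    exact hU s s.2.1 s.2.2 (by have : (s : ℝ) ≤ 1 / 2 - ε := hs.2; linarith)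
  · intro t
    obtain ⟨s, hs, hs'⟩ := h₂ t
    rw [← hs']
    exact hε s ⟨hs.1, hs.2⟩
  · refine Path.trans_mem (U := ((↑) ⁻¹' cutDisk T o : Set (PDisk T))) hc fun t => ?_
    obtain ⟨s, hs, hs'⟩ := h₃ (unitInterval.symm t)
    rw [Path.symm_apply, Function.comp_apply, ← hs']
    exact hU s s.2.1 s.2.2 (by have : 1 / 2 + ε ≤ (s : ℝ) := hs.1; linarith)
  · rw [hmk, Path.Homotopic.Quotient.mk_trans, Path.Homotopic.Quotient.mk_trans,
      Path.Homotopic.Quotient.mk_symm, quotient_trans_symm, ← Path.Homotopic.Quotient.mk_symm p₃,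
      ← Path.Homotopic.Quotient.mk_symm p₃.symm, Path.symm_symm]
    simp only [Path.Homotopic.Quotient.trans_assoc]

/-- The fundamental group of a punctured disk is generated by one lasso for each puncture. -/
theorem exists_generating_lassos (hT : T.Finite) (hT1 : ∀ p ∈ T, ‖p‖ < 1) (a : PDisk T) :
    ∃ x : T → FundamentalGroup (PDisk T) a, (∀ p : T, IsLasso T a p (x p)) ∧
      Subgroup.closure (range x) = ⊤ := by
  obtain ⟨o, ho, hne, him⟩ := exists_generic_center (hT.insert (a : ℂ))
  have hne' : ∀ p ∈ T, p ≠ o := fun p hp => hne p (mem_insert_of_mem _ hp)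
  have him' : ∀ p ∈ T, ∀ p' ∈ T, p ≠ p' → ((p' - o) / (p - o)).im ≠ 0 := fun p hp p' hp' =>
    him p (mem_insert_of_mem _ hp) p' (mem_insert_of_mem _ hp')
  obtain ⟨δ, hδ, hδ0⟩ : ∃ δ : ℝ, (∀ p ∈ T, ∀ p' ∈ T, p ≠ p' →
      δ * |((p' - o) / (p - o)).re| < |((p' - o) / (p - o)).im|) ∧ 0 < δ := by
    have h : ∀ᶠ δ in nhdsWithin (0 : ℝ) (Ioi 0), ∀ p ∈ T, ∀ p' ∈ T, p ≠ p' →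
        δ * |((p' - o) / (p - o)).re| < |((p' - o) / (p - o)).im| := by
      simp only [Filter.eventually_all_finite hT, Filter.eventually_imp_distrib_left]
      intro p hp p' hp' hpp
      apply eventually_nhdsWithin_of_eventually_nhds
      have h1 : Filter.Tendsto (fun δ : ℝ => δ * |((p' - o) / (p - o)).re|) (nhds 0) (nhds 0) :=
        (continuous_id.mul continuous_const).tendsto' 0 0 (by simp)
      exact h1.eventually_lt_const (abs_pos.2 (him' p hp p' hp' hpp))
    exact (h.and self_mem_nhdsWithin).exists
  have ha : (a : ℂ) ∈ cutDisk T o := by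
    refine ⟨PDisk.norm_le a, fun p hp => ?_⟩
    rw [mem_slitPlane_iff]
    right
    have := him p (mem_insert_of_mem _ hp) a (mem_insert _ _) (PDisk.ne a hp).symm
    simpa using this
  have hcs := cutDisk_subset (T := T) hne'
  have hsc := starConvex_cutDisk (T := T) ho
  have hoU := center_mem_cutDisk (T := T) ho
  let o' : PDisk T := ⟨o, hcs hoU⟩
  have haj : ∀ z : PDisk T, (z : ℂ) ∈ cutDisk T o →
      JoinedIn ((↑) ⁻¹' cutDisk T o : Set (PDisk T)) a z := fun z hz =>
    (joinedIn_of_starConvex (c := o') hoU hsc hcs ha).symm.trans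
      (joinedIn_of_starConvex (c := o') hoU hsc hcs hz)
  choose v u x hx hv hu hpaths using fun p : T =>
    exists_lasso_through_sector hT hT1 hne' him' hδ0 haj p.2
  refine ⟨x, hx, closure_range_eq_top (isOpen_cutDisk hT o)
    (fun p : T => isOpen_cutSector o δ (p : ℂ)) ?_ ?_ (pathsHomotopicIn_of_starConvex hoU hsc hcs)
    (fun p => ?_) haj (fun p z hz => ?_) (fun p z hz hzU => ?_) hpaths⟩
  · intro z hz
    obtain ⟨p, hp, h⟩ := exists_mem_cutSector hδ0 z hne' hz
    exact ⟨⟨p, hp⟩, h⟩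
  · intro p p' z hz hp hp'
    obtain ⟨q, hq, h⟩ : ∃ q ∈ T, 1 - ((z : ℂ) - o) / (q - o) ∉ slitPlane := by
      by_contra! h
      exact hz ⟨PDisk.norm_le z, h⟩
    exact Subtype.ext ((eq_of_mem_cutSector hne' hδ hδ0 p.2 hq hp h).trans
      (eq_of_mem_cutSector hne' hδ hδ0 p'.2 hq hp' h).symm)
  · exact pathsHomotopicIn_of_starConvex (hv p).1 ((convex_cutSector _).starConvex (hv p).1)
      (cutSector_subset hne' hδ hδ0 p.2)
  · exact joinedIn_of_starConvex (hv p).1 ((convex_cutSector _).starConvex (hv p).1)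
      (cutSector_subset hne' hδ hδ0 p.2) hz
  · have h : (((z : ℂ) - o) / (p - o)).im ≠ 0 := by
      intro h
      have h1 := hzU.2 p p.2
      rw [mem_slitPlane_iff] at h1
      simp [h] at h1
      exact absurd hz.2.1 (by linarith)
    rcases h.lt_or_gt with h | h
    · exact Or.inl (joinedIn_cutSector hne' hδ hδ0 p.2 (hv p).1 hz
        (mul_pos_of_neg_of_neg (hv p).2 h))
    · exact Or.inr (joinedIn_cutSector hne' hδ hδ0 p.2 (hu p).1 hz (mul_pos (hu p).2 h))

end Generators

section Arcs

variable {T : Set ℂ}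

/-- Two arcs meeting only on the circle are homotopic if they wind equally around all
punctures. -/
theorem mk_eq_mk_of_winding_eq (hT : T.Finite) (hT1 : ∀ p ∈ T, ‖p‖ < 1) {a b : PDisk T}
    {α β : Path a b} (hα : Function.Injective α) (hβ : Function.Injective β)
    (ha : ‖(a : ℂ)‖ = 1) (hb : ‖(b : ℂ)‖ = 1) (hm : ∀ t u, α t = β u → ‖(α t : ℂ)‖ = 1)
    (hw : ∀ q ∈ T, winding q (Path.Homotopic.Quotient.mk α) =
      winding q (Path.Homotopic.Quotient.mk β)) :
    Path.Homotopic.Quotient.mk α = Path.Homotopic.Quotient.mk β := by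
  obtain ⟨x, hx, hgen⟩ := exists_generating_lassos hT hT1 a
  obtain ⟨W, hW⟩ := exists_evalWord (x := x) (g := FundamentalGroup.fromPath
    ((Path.Homotopic.Quotient.mk α).trans (Path.Homotopic.Quotient.mk β).symm))
    (hgen ▸ Subgroup.mem_top _)
  exact mk_eq_mk_of_evalWord W.length T a b α β hα hβ ha hb hm (fun q hq _ => hw q hq)
    T (↑) x Subtype.val_injective (fun p => ⟨p.2, hT1 p p.2⟩) hx W le_rfl hW.symm

/-- The change of the logarithm of the distance function of `q` along an arc. -/
noncomputable def arcWinding (q : ℂ) (γ : C(unitInterval, PDisk T)) : ℂ :=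
  dlog (fun t => diskKernel q (γ (projIcc 0 1 zero_le_one t))) 0 1

theorem winding_mk_eq_arcWinding {q : ℂ} (hq : ‖q‖ < 1) (hqT : q ∈ T) {a b : PDisk T}
    (p : Path a b) :
    winding q (Path.Homotopic.Quotient.mk p) = arcWinding q p.toContinuousMap :=
  winding_mk hq hqT p

theorem continuous_arc_kernel {q : ℂ} (hq : ‖q‖ < 1) (γ : C(unitInterval, PDisk T)) :
    Continuous fun t => diskKernel q (γ (projIcc 0 1 zero_le_one t)) :=
  (PDisk.continuous_kernel T hq).comp (γ.continuous.comp continuous_projIcc)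

theorem arcWinding_bound {q : ℂ} (hq : ‖q‖ < 1) (hqT : q ∈ T) {γ : C(unitInterval, PDisk T)}
    (hγ : Function.Injective γ) (h0 : ‖(γ 0 : ℂ)‖ = 1) (h1 : ‖(γ 1 : ℂ)‖ = 1) :
    (arcWinding q γ).re = 0 ∧ |(arcWinding q γ).im| < 2 * Real.pi := by
  refine dlog_of_injOn (continuous_arc_kernel hq γ) (fun t => PDisk.kernel_ne_zero hq hqT _)
    (fun t => diskKernel_norm_le hq (PDisk.norm_le _)) ?_ ?_ ?_
  · intro s hs t ht h
    have h2 := hγ (Subtype.ext (diskKernel_injOn hq (PDisk.norm_le _) (PDisk.norm_le _) h))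
    rw [projIcc_of_mem _ hs, projIcc_of_mem _ ht] at h2
    exact congrArg Subtype.val h2
  · rw [diskKernel_norm_eq_one_iff hq (PDisk.norm_le _), projIcc_left]
    exact h0
  · rw [diskKernel_norm_eq_one_iff hq (PDisk.norm_le _), projIcc_right]
    exact h1

theorem exp_arcWinding {q : ℂ} (hq : ‖q‖ < 1) (hqT : q ∈ T) (γ : C(unitInterval, PDisk T)) :
    exp (arcWinding q γ) = diskKernel q (γ 1) / diskKernel q (γ 0) := by
  rw [arcWinding, exp_dlog (continuous_arc_kernel hq γ) fun t => PDisk.kernel_ne_zero hq hqT _,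
    projIcc_left, projIcc_right]
  rfl

theorem homotopicRel_endpoints {X : Type*} [TopologicalSpace X] {f g : C(unitInterval, X)}
    (h : f.HomotopicRel g {0, 1}) : f 0 = g 0 ∧ f 1 = g 1 := by
  obtain ⟨F⟩ := h
  exact ⟨F.fst_eq_snd (by simp), F.fst_eq_snd (by simp)⟩

theorem arcWinding_eq_of_homotopicRel {q : ℂ} (hq : ‖q‖ < 1) (hqT : q ∈ T)
    {f g : C(unitInterval, PDisk T)} (h : f.HomotopicRel g {0, 1}) :
    arcWinding q f = arcWinding q g := by
  obtain ⟨h0, h1⟩ := homotopicRel_endpoints h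
  let α : Path (f 0) (f 1) := ⟨f, rfl, rfl⟩
  let β : Path (f 0) (f 1) := ⟨g, h0.symm, h1.symm⟩
  have hαβ : Path.Homotopic.Quotient.mk α = Path.Homotopic.Quotient.mk β :=
    Path.Homotopic.Quotient.eq.2 h
  have := congrArg (winding q) hαβ
  rwa [winding_mk_eq_arcWinding hq hqT, winding_mk_eq_arcWinding hq hqT] at this

theorem homotopicRel_of_arcWinding_eq (hT : T.Finite) (hT1 : ∀ p ∈ T, ‖p‖ < 1)
    {f g : C(unitInterval, PDisk T)} (hf : Function.Injective f) (hg : Function.Injective g)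
    (h0 : f 0 = g 0) (h1 : f 1 = g 1) (hf0 : ‖(f 0 : ℂ)‖ = 1) (hf1 : ‖(f 1 : ℂ)‖ = 1)
    (hm : ∀ s t, f s = g t → ‖(f s : ℂ)‖ = 1)
    (hw : ∀ q ∈ T, arcWinding q f = arcWinding q g) : f.HomotopicRel g {0, 1} := by
  let α : Path (f 0) (f 1) := ⟨f, rfl, rfl⟩
  let β : Path (f 0) (f 1) := ⟨g, h0.symm, h1.symm⟩
  exact Path.Homotopic.Quotient.eq.1 (mk_eq_mk_of_winding_eq (α := α) (β := β) hT hT1 hf hg hf0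
    hf1 hm fun q hq => by
      rw [winding_mk_eq_arcWinding (hT1 q hq) hq, winding_mk_eq_arcWinding (hT1 q hq) hq]
      exact hw q hq)

/-- Among three arcs with the same endpoints, two have the same winding around `q`. -/
theorem arcWinding_eq_of_three {q : ℂ} (hq : ‖q‖ < 1) (hqT : q ∈ T)
    (γ : Fin 3 → C(unitInterval, PDisk T)) (hγ : ∀ i, Function.Injective (γ i)) {a b : PDisk T}
    (h0 : ∀ i, γ i 0 = a) (h1 : ∀ i, γ i 1 = b) (ha : ‖(a : ℂ)‖ = 1) (hb : ‖(b : ℂ)‖ = 1) :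
    ∃ i j, i ≠ j ∧ arcWinding q (γ i) = arcWinding q (γ j) := by
  have hbd := fun i => arcWinding_bound hq hqT (hγ i) (by rwa [h0]) (by rwa [h1])
  have hturn : ∀ i j, ∃ n : ℤ,
      (arcWinding q (γ i)).im = (arcWinding q (γ j)).im + n * (2 * Real.pi) := by
    intro i j
    have h : exp (arcWinding q (γ i)) = exp (arcWinding q (γ j)) := by
      rw [exp_arcWinding hq hqT, exp_arcWinding hq hqT, h0, h1, h0, h1]
    obtain ⟨n, hn⟩ := exp_eq_exp_iff_exists_int.1 h
    exact ⟨n, by rw [hn]; simp⟩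
  by_contra! hne
  have hne' : ∀ i j (n : ℤ), i ≠ j →
      (arcWinding q (γ i)).im = (arcWinding q (γ j)).im + n * (2 * Real.pi) → n ≤ -1 ∨ 1 ≤ n := by
    intro i j n hij hn
    by_contra! h
    obtain rfl : n = 0 := by lia
    exact hne i j hij (Complex.ext ((hbd i).1.trans (hbd j).1.symm) (by simpa using hn))
  obtain ⟨n, hn⟩ := hturn 0 1
  obtain ⟨k, hk⟩ := hturn 1 2
  have hnk : (arcWinding q (γ 0)).im = (arcWinding q (γ 2)).im + (n + k : ℤ) * (2 * Real.pi) := by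
    rw [hn, hk]; push_cast; ring
  have hbig : ∀ i j (n : ℤ),
      (arcWinding q (γ i)).im = (arcWinding q (γ j)).im + n * (2 * Real.pi) → -2 < n ∧ n < 2 := by
    intro i j n hn
    have hi := abs_lt.1 (hbd i).2
    have hj := abs_lt.1 (hbd j).2
    have hp := Real.pi_pos
    constructor
    · have : (-2 : ℝ) < n := by nlinarith
      exact_mod_cast this
    · have : (n : ℝ) < 2 := by nlinarith
      exact_mod_cast this
  have b1 := hbig _ _ _ hn
  have b2 := hbig _ _ _ hk
  have b3 := hbig _ _ _ hnk
  have c1 := hne' 0 1 n (by decide) hn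
  have c2 := hne' 1 2 k (by decide) hk
  have c3 := hne' 0 2 (n + k) (by decide) hnk
  lia

end Arcs

section Counting

theorem infinite_unit_sphere : (Metric.sphere (0 : ℂ) 1).Infinite := by
  have h : (1 : Cardinal) < Module.rank ℝ ℂ := by
    rw [Complex.rank_real_complex]
    exact Cardinal.one_lt_two
  refine (isPreconnected_sphere h 0 1).infinite_of_nontrivial ⟨1, by simp, -1, by simp, ?_⟩
  norm_num [Complex.ext_iff]

theorem norm_eq_one_of_mem_frontier {z : ℂ} (hz : z ∈ frontier ClosedDisk) : ‖z‖ = 1 := by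
  rw [frontier_closedBall _ one_ne_zero] at hz
  simpa using hz

theorem norm_lt_one_of_mem_interior {z : ℂ} (hz : z ∈ interior ClosedDisk) : ‖z‖ < 1 := by
  rw [interior_closedBall _ one_ne_zero] at hz
  simpa using hz

/-- Filling in the punctures of `T` outside `Q`. -/
def fillIn {Q T : Set ℂ} (h : Q ⊆ T) : C(PDisk T, PDisk Q) :=
  ⟨Set.inclusion (sdiff_subset_sdiff_right h), continuous_inclusion _⟩

theorem fillIn_injective {Q T : Set ℂ} (h : Q ⊆ T) : Function.Injective (fillIn h) :=
  Set.inclusion_injective (sdiff_subset_sdiff_right h)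

/-- An equivalence relation on `Fin m` without three pairwise related elements has at least
`m / 2` classes. -/
theorem exists_representatives {m : ℕ} (S : Setoid (Fin m))
    (h : ∀ f : Fin 3 → Fin m, Function.Injective f → ¬ ∀ i j, S.r (f i) (f j)) :
    ∃ (c : ℕ) (g : Fin c → Fin m), m ≤ 2 * c ∧ ∀ i j, i ≠ j → ¬ S.r (g i) (g j) := by
  classical
  have : Finite (Quotient S) := inferInstance
  obtain ⟨c, ⟨e⟩⟩ := Finite.exists_equiv_fin (Quotient S)
  refine ⟨c, fun i => (e.symm i).out, ?_, fun i j hij hS => hij ?_⟩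
  · have h1 := Finset.card_le_mul_card_image (s := Finset.univ) (f := fun i : Fin m => e ⟦i⟧) 2
      fun b _ => by
        by_contra! hb
        obtain ⟨i, j, k, hi, hj, hk, hij, hik, hjk⟩ := Finset.two_lt_card_iff.1 hb
        simp only [Finset.mem_filter, Finset.mem_univ, true_and] at hi hj hk
        refine h ![i, j, k] ?_ ?_
        · intro x y hxy
          fin_cases x <;> fin_cases y <;> simp_all
        · have hc : ∀ x, e ⟦![i, j, k] x⟧ = b := by
            intro x
            fin_cases x <;> assumption
          exact fun x y => Quotient.exact (e.injective ((hc x).trans (hc y).symm))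
    have h2 := Finset.card_le_univ (Finset.univ.image fun i : Fin m => e ⟦i⟧)
    simp only [Finset.card_univ, Fintype.card_fin] at h1 h2
    lia
  · have h1 := Quotient.sound hS
    rw [Quotient.out_eq, Quotient.out_eq] at h1
    exact e.symm.injective h1

/-- Three arcs that become homotopic when the puncture `p` is filled in are not pairwise
non-homotopic. -/
theorem exists_homotopicRel_of_three {Q T : Set ℂ} (hQT : Q ⊆ T) {p : ℂ} (hp : T ⊆ insert p Q)
    (hpT : p ∈ T) (hT : T.Finite) (hT1 : ∀ q ∈ T, ‖q‖ < 1)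
    (γ : Fin 3 → C(unitInterval, PDisk T)) (hγ : ∀ i, Function.Injective (γ i))
    (hend : ∀ i, ‖(γ i 0 : ℂ)‖ = 1 ∧ ‖(γ i 1 : ℂ)‖ = 1)
    (hm : ∀ i j, i ≠ j → ∀ s t, γ i s = γ j t → ‖(γ i s : ℂ)‖ = 1)
    (h : ∀ i j, ((fillIn hQT).comp (γ i)).HomotopicRel ((fillIn hQT).comp (γ j)) {0, 1}) :
    ∃ i j, i ≠ j ∧ (γ i).HomotopicRel (γ j) {0, 1} := by
  have hE : ∀ i j, γ i 0 = γ j 0 ∧ γ i 1 = γ j 1 := fun i j =>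
    (homotopicRel_endpoints (h i j)).imp (fun e => fillIn_injective hQT e)
      (fun e => fillIn_injective hQT e)
  obtain ⟨i, j, hij, hw⟩ := arcWinding_eq_of_three (hT1 p hpT) hpT γ hγ
    (fun i => (hE i 0).1) (fun i => (hE i 0).2) (hend 0).1 (hend 0).2
  refine ⟨i, j, hij, homotopicRel_of_arcWinding_eq hT hT1 (hγ i) (hγ j) (hE i j).1 (hE i j).2
    (hend i).1 (hend i).2 (hm i j hij) fun q hq => ?_⟩
  rcases hp hq with rfl | hqQ
  · exact hw
  · exact arcWinding_eq_of_homotopicRel (hT1 q hq) hqQ (h i j)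

theorem arcFamilyBound_succ {r k M : ℕ} (hM : ArcFamilyBound (r + 1) k M) :
    ArcFamilyBound r (k + 1) (2 * M) := by
  intro marked punct hmk hmi hpk hpi m γ hγ hend hdisj hnon
  have hQT : range (punct ∘ Fin.succ) ⊆ range punct := range_comp_subset_range _ _
  have hmk1 : ∀ z ∈ range marked, ‖z‖ = 1 := by
    rintro _ ⟨i, rfl⟩
    exact norm_eq_one_of_mem_frontier (hmk i)
  have hT1 : ∀ q ∈ range punct, ‖q‖ < 1 := by
    rintro _ ⟨i, rfl⟩
    exact norm_lt_one_of_mem_interior (hpk i)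
  have hp : range punct ⊆ insert (punct 0) (range (punct ∘ Fin.succ)) := by
    rintro _ ⟨i, rfl⟩
    refine Fin.cases (mem_insert _ _) (fun i => mem_insert_of_mem _ ⟨i, rfl⟩) i
  let S : Setoid (Fin m) :=
    ⟨fun i j => ((fillIn hQT).comp (γ i)).HomotopicRel ((fillIn hQT).comp (γ j)) {0, 1},
      fun _ => .refl _, fun h => h.symm, fun h h' => h.trans h'⟩
  obtain ⟨c, g, hc, hg⟩ := exists_representatives S fun f hf hS => by
    obtain ⟨i, j, hij, h⟩ := exists_homotopicRel_of_three hQT hp (mem_range_self 0)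
      (finite_range punct) hT1 (fun i => γ (f i)) (fun i => hγ _)
      (fun i => ⟨hmk1 _ (hend _).1, hmk1 _ (hend _).2⟩)
      (fun i j hij s t h => hmk1 _ (hdisj _ _ (hf.ne hij) s t (congrArg Subtype.val h))) hS
    exact hnon _ _ (hf.ne hij) h
  obtain ⟨e, he, hem⟩ := infinite_unit_sphere.exists_notMem_finite (finite_range marked)
  have hgi : ∀ i j, i ≠ j → g i ≠ g j := fun i j hij h => hg i j hij (h ▸ S.refl _)
  have hsub : range marked ⊆ range (Fin.cons e marked : Fin (r + 1) → ℂ) := by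
    rintro _ ⟨i, rfl⟩
    exact ⟨i.succ, by simp⟩
  have := hM (Fin.cons e marked) (punct ∘ Fin.succ)
    (Fin.cases (by rw [frontier_closedBall _ one_ne_zero]; simpa using he)
      (fun i => by simpa using hmk i))
    (Fin.cons_injective_iff.2 ⟨hem, hmi⟩) (fun j => hpk _)
    (hpi.comp (Fin.succ_injective _)) c (fun i => (fillIn hQT).comp (γ (g i)))
    (fun i => (fillIn_injective hQT).comp (hγ _))
    (fun i => ⟨hsub (hend _).1, hsub (hend _).2⟩)
    (fun i j hij s t h => hsub (hdisj _ _ (hgi i j hij) s t h)) hg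
  lia

theorem arcFamilyBound_zero (r : ℕ) : ArcFamilyBound r 0 (r * r) := by
  intro marked punct hmk hmi hpk hpi m γ hγ hend hdisj hnon
  have hmk1 : ∀ z ∈ range marked, ‖z‖ = 1 := by
    rintro _ ⟨i, rfl⟩
    exact norm_eq_one_of_mem_frontier (hmk i)
  choose a ha using fun i => (hend i).1
  choose b hb using fun i => (hend i).2
  have hinj : Function.Injective fun i => (a i, b i) := by
    intro i j hij
    by_contra hne
    rw [Prod.mk.injEq] at hij
    refine hnon i j hne (homotopicRel_of_arcWinding_eq (finite_range punct) (by simp) (hγ i) (hγ j)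
      (Subtype.ext ?_) (Subtype.ext ?_) (hmk1 _ (hend i).1) (hmk1 _ (hend i).2)
      (fun s t h => hmk1 _ (hdisj i j hne s t (congrArg Subtype.val h))) (by simp))
    · rw [← ha, ← ha, hij.1]
    · rw [← hb, ← hb, hij.2]
  simpa using Fintype.card_le_of_injective _ hinj

theorem exists_arcFamilyBound (r l : ℕ) : ∃ B : ℕ, ArcFamilyBound r l B := by
  induction l generalizing r with
  | zero => exact ⟨_, arcFamilyBound_zero r⟩
  | succ k ih => exact ⟨_, arcFamilyBound_succ (ih (r + 1)).choose_spec⟩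

end Counting

/-- The recursion `N(r, ℓ) ≤ 2r² + 2·N(r+1, ℓ−1)` for `ℓ ≥ 1`; consequently `N(r, ℓ)` is finite. -/

theorem stmt_10 :
    (∀ r l M : ℕ, 1 ≤ r → 1 ≤ l → ArcFamilyBound (r + 1) (l - 1) M →
      ArcFamilyBound r l (2 * r ^ 2 + 2 * M)) ∧
    (∀ r l : ℕ, 1 ≤ r → ∃ B : ℕ, ArcFamilyBound r l B) := by
  refine ⟨fun r l M _ hl hM => ?_, fun r l _ => exists_arcFamilyBound r l⟩
  obtain ⟨k, rfl⟩ := Nat.exists_eq_add_of_le' hl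
  intro marked punct h1 h2 h3 h4 m γ h5 h6 h7 h8
  exact (arcFamilyBound_succ hM marked punct h1 h2 h3 h4 m γ h5 h6 h7 h8).trans
    (Nat.le_add_left _ _)
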